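/- Ahlfors–Bers theorem (measurable Riemann mapping theorem for the disc): Let μ : 𝔻 → ℂ be a measurable function on the open unit disc 𝔻 with ‖μ‖_∞ < 1. Then there exists a homeomorphism ω of 𝔻 onto 𝔻 which possesses locally integrable distributional derivatives ∂_z ω and ∂_{z̄} ω satisfying the Beltrami equation ∂_{z̄} ω(z) = μ(z) ∂_z ω(z) for almost every z ∈ 𝔻 (so ω is ‖μ‖_∞-quasiconformal), and which extends to a homeomorphism of the closed unit disc fixing the three points 1, −1 and i. Moreover ω is unique: any two such homeomorphisms coincide on 𝔻. -/

import Mathlib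

open Complex MeasureTheory Metric Set

/-- The open unit disc in `ℂ`. -/
def unitDisc : Set ℂ := Metric.ball (0 : ℂ) 1

/-- The Wirtinger derivative `∂_z f = (∂_x f − i ∂_y f)/2` of `f : ℂ → ℂ`. -/
noncomputable def wirtingerZ (f : ℂ → ℂ) (z : ℂ) : ℂ :=
  (fderiv ℝ f z 1 - Complex.I * fderiv ℝ f z Complex.I) / 2

/-- The Wirtinger derivative `∂_z̄ f = (∂_x f + i ∂_y f)/2` of `f : ℂ → ℂ`. -/
noncomputable def wirtingerZBar (f : ℂ → ℂ) (z : ℂ) : ℂ :=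
  (fderiv ℝ f z 1 + Complex.I * fderiv ℝ f z Complex.I) / 2

/-- `g` and `h` are the distributional derivatives `∂_z f` and `∂_z̄ f` of `f` on the open
set `A ⊆ ℂ`: they are locally integrable on `A` and the integration-by-parts identities
`∫_A f ∂_z φ = −∫_A g φ` and `∫_A f ∂_z̄ φ = −∫_A h φ` hold for every smooth compactly
supported test function `φ` with support in `A`. -/
def HasDistribWirtingerDerivs (A : Set ℂ) (f g h : ℂ → ℂ) : Prop :=
  MeasureTheory.LocallyIntegrableOn g A ∧ MeasureTheory.LocallyIntegrableOn h A ∧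
  ∀ φ : ℂ → ℂ, ContDiff ℝ (⊤ : ℕ∞) φ → HasCompactSupport φ → tsupport φ ⊆ A →
    (∫ z in A, f z * wirtingerZ φ z) = -∫ z in A, g z * φ z ∧
    (∫ z in A, f z * wirtingerZBar φ z) = -∫ z in A, h z * φ z

/-- `ω` is a solution of the Beltrami equation on the unit disc for the Beltrami coefficient
`μ`, which is a homeomorphism of the closed unit disc onto itself, maps the open disc onto
itself, and fixes the three boundary points `1`, `−1`, `i`. (A continuous bijection of the
compact set `closure 𝔻` onto itself is automatically a homeomorphism.) -/
def IsNormalizedBeltramiSolution (μ : ℂ → ℂ) (ω : ℂ → ℂ) : Prop :=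
  ContinuousOn ω (closure unitDisc) ∧
  Set.BijOn ω (closure unitDisc) (closure unitDisc) ∧
  Set.BijOn ω unitDisc unitDisc ∧
  ω 1 = 1 ∧ ω (-1) = -1 ∧ ω Complex.I = Complex.I ∧
  ∃ g h : ℂ → ℂ, HasDistribWirtingerDerivs unitDisc ω g h ∧
    ∀ᵐ z ∂(volume.restrict unitDisc), h z = μ z * g z

section
open scoped ContDiff Topology ComplexConjugate

set_option linter.unnecessarySeqFocus false

noncomputable section

/-- The real-linear map `v ↦ a v + b v̄`. -/
def bel (a b : ℂ) : ℂ →L[ℝ] ℂ :=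
  (ContinuousLinearMap.mul ℝ ℂ a) + (ContinuousLinearMap.mul ℝ ℂ b).comp
    (Complex.conjCLE : ℂ →L[ℝ] ℂ)

@[simp] lemma bel_apply (a b v : ℂ) : bel a b v = a * v + b * conj v := by
  simp [bel]

lemma bel_add (a b c d : ℂ) : bel a b + bel c d = bel (a + c) (b + d) := by
  ext v <;> simp <;> ring

lemma bel_sub (a b c d : ℂ) : bel a b - bel c d = bel (a - c) (b - d) := by
  ext v <;> simp <;> ring

lemma norm_bel_le (a b : ℂ) : ‖bel a b‖ ≤ ‖a‖ + ‖b‖ := by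
  apply ContinuousLinearMap.opNorm_le_bound _ (by positivity)
  intro v
  rw [bel_apply]
  refine (norm_add_le _ _).trans (le_of_eq ?_)
  simp
  ring

lemma norm_bel_apply_ge (a b v : ℂ) : (‖a‖ - ‖b‖) * ‖v‖ ≤ ‖bel a b v‖ := by
  rw [bel_apply]
  have := norm_sub_norm_le (a * v) (-(b * conj v))
  rw [sub_neg_eq_add] at this
  simp at this
  linarith

lemma bel_wirtinger (f : ℂ → ℂ) (z : ℂ) :
    fderiv ℝ f z = bel (wirtingerZ f z) (wirtingerZBar f z) := by
  have key : ∀ (L : ℂ →L[ℝ] ℂ) (v : ℂ), L v = v.re * L 1 + v.im * L I := by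
    intro L v
    conv_lhs => rw [show v = v.re • (1:ℂ) + v.im • I by simp]
    rw [map_add, map_smul, map_smul]; simp
  apply ContinuousLinearMap.ext
  intro v
  rw [key, bel_apply, wirtingerZ, wirtingerZBar]
  conv_rhs => rw [← Complex.re_add_im v]
  simp only [map_add, map_mul, conj_ofReal, conj_I]
  ring_nf
  simp only [I_sq]
  ring

lemma wirtingerZ_of_hasFDerivAt {f : ℂ → ℂ} {z a b : ℂ} (h : HasFDerivAt f (bel a b) z) :
    wirtingerZ f z = a := by
  rw [wirtingerZ, h.fderiv]; simp only [bel_apply, conj_I, map_one]; ring_nf; simp only [I_sq]; ring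

lemma wirtingerZBar_of_hasFDerivAt {f : ℂ → ℂ} {z a b : ℂ} (h : HasFDerivAt f (bel a b) z) :
    wirtingerZBar f z = b := by
  rw [wirtingerZBar, h.fderiv]; simp only [bel_apply, conj_I, map_one]; ring_nf
  simp only [I_sq]; ring

lemma hasFDerivAt_bel {f : ℂ → ℂ} {z : ℂ} (h : DifferentiableAt ℝ f z) :
    HasFDerivAt f (bel (wirtingerZ f z) (wirtingerZBar f z)) z := by
  rw [← bel_wirtinger]; exact h.hasFDerivAt

lemma hasFDerivAt_bel_mul {f g : ℂ → ℂ} {z a b c d : ℂ} (hf : HasFDerivAt f (bel a b) z)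
    (hg : HasFDerivAt g (bel c d) z) :
    HasFDerivAt (fun z => f z * g z) (bel (f z * c + g z * a) (f z * d + g z * b)) z := by
  convert! hf.mul hg using 1
  ext v <;> simp <;> ring

lemma bel_comp (a b c d : ℂ) :
    (bel a b).comp (bel c d) = bel (a * c + b * conj d) (a * d + b * conj c) := by
  ext v <;> simp <;> ring

lemma det_bel (a b : ℂ) : (bel a b).det = ‖a‖ ^ 2 - ‖b‖ ^ 2 := by
  have : (bel a b).det = LinearMap.det (bel a b : ℂ →ₗ[ℝ] ℂ) := rfl
  rw [this, ← LinearMap.det_toMatrix Complex.basisOneI, Matrix.det_fin_two]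
  simp [LinearMap.toMatrix_apply, Complex.coe_basisOneI_repr, Complex.sq_norm, Complex.normSq_apply]
  ring

lemma continuous_bel : Continuous fun p : ℂ × ℂ => bel p.1 p.2 := by
  unfold bel
  exact ((ContinuousLinearMap.mul ℝ ℂ).continuous.comp continuous_fst).add
    (((ContinuousLinearMap.mul ℝ ℂ).continuous.comp continuous_snd).clm_comp continuous_const)

/-- smooth compactly supported functions -/
def Test (h : ℂ → ℂ) : Prop := ContDiff ℝ ∞ h ∧ HasCompactSupport h

lemma contDiff_wZ {n : WithTop ℕ∞} {m : WithTop ℕ∞} {f : ℂ → ℂ} (hf : ContDiff ℝ n f)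
    (hmn : m + 1 ≤ n) : ContDiff ℝ m (wirtingerZ f) := by
  have h := hf.fderiv_right hmn
  unfold wirtingerZ
  exact ((h.clm_apply contDiff_const).sub (contDiff_const.mul (h.clm_apply contDiff_const))).div_const _

lemma contDiff_wZBar {n : WithTop ℕ∞} {m : WithTop ℕ∞} {f : ℂ → ℂ} (hf : ContDiff ℝ n f)
    (hmn : m + 1 ≤ n) : ContDiff ℝ m (wirtingerZBar f) := by
  have h := hf.fderiv_right hmn
  unfold wirtingerZBar
  exact ((h.clm_apply contDiff_const).add (contDiff_const.mul (h.clm_apply contDiff_const))).div_const _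

lemma tsupport_wZ (f : ℂ → ℂ) : tsupport (wirtingerZ f) ⊆ tsupport f := by
  refine closure_minimal ?_ isClosed_closure
  refine Set.Subset.trans ?_ (support_fderiv_subset ℝ)
  intro z hz hz2
  exact hz (by simp [wirtingerZ, hz2])

lemma tsupport_wZBar (f : ℂ → ℂ) : tsupport (wirtingerZBar f) ⊆ tsupport f := by
  refine closure_minimal ?_ isClosed_closure
  refine Set.Subset.trans ?_ (support_fderiv_subset ℝ)
  intro z hz hz2
  exact hz (by simp [wirtingerZBar, hz2])

lemma Test.wZ {h : ℂ → ℂ} (hh : Test h) : Test (wirtingerZ h) :=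
  ⟨contDiff_wZ hh.1 (by simp), hh.2.of_isClosed_subset (isClosed_tsupport _) (tsupport_wZ h)⟩

lemma Test.wZBar {h : ℂ → ℂ} (hh : Test h) : Test (wirtingerZBar h) :=
  ⟨contDiff_wZBar hh.1 (by simp), hh.2.of_isClosed_subset (isClosed_tsupport _) (tsupport_wZBar h)⟩

lemma Test.memLp {h : ℂ → ℂ} (hh : Test h) (p : ENNReal) : MemLp h p volume :=
  hh.1.continuous.memLp_of_hasCompactSupport hh.2

lemma Test.diff {h : ℂ → ℂ} (hh : Test h) : Differentiable ℝ h :=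
  hh.1.differentiable (by simp)

lemma wZ_mul {f g : ℂ → ℂ} {z : ℂ} (hf : DifferentiableAt ℝ f z) (hg : DifferentiableAt ℝ g z) :
    wirtingerZ (fun z => f z * g z) z = f z * wirtingerZ g z + g z * wirtingerZ f z :=
  wirtingerZ_of_hasFDerivAt (hasFDerivAt_bel_mul (hasFDerivAt_bel hf) (hasFDerivAt_bel hg))

lemma wZBar_mul {f g : ℂ → ℂ} {z : ℂ} (hf : DifferentiableAt ℝ f z) (hg : DifferentiableAt ℝ g z) :
    wirtingerZBar (fun z => f z * g z) z = f z * wirtingerZBar g z + g z * wirtingerZBar f z :=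
  wirtingerZBar_of_hasFDerivAt (hasFDerivAt_bel_mul (hasFDerivAt_bel hf) (hasFDerivAt_bel hg))

end

end

section
open Complex MeasureTheory Metric Set
open scoped ContDiff Topology ComplexConjugate
set_option linter.unnecessarySeqFocus false

noncomputable section

open scoped FourierTransform
open Real (fourierChar)

lemma fourier_test_schwartz {h : ℂ → ℂ} (hh : Test h) :
    𝓕 h = (𝓕 (hh.2.toSchwartzMap hh.1) : SchwartzMap ℂ ℂ) := by
  rw [SchwartzMap.fourier_coe]; rfl

lemma fourier_fderiv_apply {h : ℂ → ℂ} (hh : Test h) (v e : ℂ) :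
    𝓕 (fun x => fderiv ℝ h x e) v = (2 * Real.pi * I * inner ℝ v e) * 𝓕 h v := by
  have hi : Integrable h := (hh.1.continuous.integrable_of_hasCompactSupport hh.2)
  have hi' : Integrable (fderiv ℝ h) :=
    (hh.1.continuous_fderiv (by simp)).integrable_of_hasCompactSupport (hh.2.fderiv ℝ)
  have := congrFun (Real.fourier_fderiv hi hh.diff hi') v
  have h2 := Real.fourier_continuousLinearMap_apply (a := e) (v := v) hi'
  rw [← h2, this]
  have hin : (innerSL ℝ v) e = inner ℝ v e := rfl
  simp only [VectorFourier.fourierSMulRight_apply, neg_apply, hin, smul_eq_mul, Complex.real_smul]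
  push_cast
  ring

lemma integrable_fderiv_apply {h : ℂ → ℂ} (hh : Test h) (e : ℂ) :
    Integrable (fun x => fderiv ℝ h x e) := by
  have hi' : Integrable (fderiv ℝ h) :=
    (hh.1.continuous_fderiv (by simp)).integrable_of_hasCompactSupport (hh.2.fderiv ℝ)
  exact hi'.apply_continuousLinearMap e

lemma fourier_lin {f g : ℂ → ℂ} (hf : Integrable f) (hg : Integrable g) (c d : ℂ) (v : ℂ) :
    𝓕 (fun x => c * f x + d * g x) v = c * 𝓕 f v + d * 𝓕 g v := by
  simp only [Real.fourier_eq', smul_eq_mul]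
  rw [← integral_const_mul, ← integral_const_mul, ← integral_add]
  · congr 1; ext x; ring
  · refine Integrable.const_mul ?_ _
    refine (hf.norm.mono' (by fun_prop) (ae_of_all _ fun x => ?_))
    rw [norm_mul, Complex.norm_exp]; simp
  · refine Integrable.const_mul ?_ _
    refine (hg.norm.mono' (by fun_prop) (ae_of_all _ fun x => ?_))
    rw [norm_mul, Complex.norm_exp]; simp

lemma fourier_wZ {h : ℂ → ℂ} (hh : Test h) (v : ℂ) :
    𝓕 (wirtingerZ h) v = (Real.pi * I * conj v) * 𝓕 h v := by
  have : wirtingerZ h = fun x => (1/2 : ℂ) * fderiv ℝ h x 1 + (- I / 2) * fderiv ℝ h x I := by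
    ext x; rw [wirtingerZ]; ring
  rw [this, fourier_lin (integrable_fderiv_apply hh 1) (integrable_fderiv_apply hh I),
    fourier_fderiv_apply hh, fourier_fderiv_apply hh]
  have hv : conj v = v.re - v.im * I := by
    apply Complex.ext <;> simp
  rw [hv]
  simp [Complex.inner]
  ring

lemma fourier_wZBar {h : ℂ → ℂ} (hh : Test h) (v : ℂ) :
    𝓕 (wirtingerZBar h) v = (Real.pi * I * v) * 𝓕 h v := by
  have : wirtingerZBar h = fun x => (1/2 : ℂ) * fderiv ℝ h x 1 + (I / 2) * fderiv ℝ h x I := by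
    ext x; rw [wirtingerZBar]; ring
  rw [this, fourier_lin (integrable_fderiv_apply hh 1) (integrable_fderiv_apply hh I),
    fourier_fderiv_apply hh, fourier_fderiv_apply hh]
  simp [Complex.inner]
  linear_combination (Real.pi * I * 𝓕 h v) * (Complex.re_add_im v)

lemma hasFDerivAt_fourierInv {w : ℂ → ℂ} (hw : Integrable w)
    (hw1 : Integrable fun v => ‖v‖ * ‖w v‖) (x : ℂ) :
    HasFDerivAt (𝓕⁻ w) (bel (𝓕⁻ (fun v => (Real.pi * I * conj v) * w v) x)
      (𝓕⁻ (fun v => (Real.pi * I * v) * w v) x)) x := by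
  have hd := Real.hasFDerivAt_fourier hw hw1 (-x)
  have hd2 : HasFDerivAt (𝓕⁻ w) ((𝓕 (VectorFourier.fourierSMulRight (innerSL ℝ) w) (-x)).comp
      (-(ContinuousLinearMap.id ℝ ℂ))) x := by
    rw [Real.fourierInv_eq_fourier_comp_neg]
    have := hd.comp x (hasFDerivAt_id (𝕜 := ℝ) x).neg
    have e : 𝓕 (fun x => w (-x)) = 𝓕 w ∘ Neg.neg := by
      ext y
      rw [← Real.fourierInv_eq_fourier_comp_neg, Real.fourierInv_eq_fourier_neg]; rfl
    rw [e]; exact this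
  convert! hd2 using 1
  have hi2 : Integrable (VectorFourier.fourierSMulRight (innerSL ℝ) w) := by
    refine (hw1.const_mul (2 * Real.pi)).mono' hw.1.fourierSMulRight (ae_of_all _ fun v => ?_)
    refine (VectorFourier.norm_fourierSMulRight_le (innerSL ℝ) w v).trans ?_
    have : ‖innerSL ℝ (E := ℂ)‖ ≤ 1 := norm_innerSL_le ℝ
    have h3 : (0:ℝ) ≤ 2 * Real.pi := by positivity
    nlinarith [mul_nonneg (mul_nonneg h3 (norm_nonneg v)) (norm_nonneg (w v))]
  have hI : ∀ c : ℂ → ℂ, Continuous c → (∀ v, ‖c v‖ = Real.pi * ‖v‖) →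
      Integrable (fun v => cexp (2 * Real.pi * (inner ℝ v x : ℝ) * I) * (c v * w v)) := by
    intro c hc hcn
    refine (hw1.const_mul Real.pi).mono' ?_ (ae_of_all _ fun v => ?_)
    · have := hw.1
      fun_prop
    · rw [norm_mul, Complex.norm_exp, norm_mul, hcn]
      simp; linarith
  apply ContinuousLinearMap.ext
  intro e
  rw [bel_apply]
  simp only [Real.fourierInv_eq', smul_eq_mul, ContinuousLinearMap.comp_apply,
    neg_apply, ContinuousLinearMap.id_apply, map_neg]
  rw [Real.fourier_continuousLinearMap_apply hi2, Real.fourier_eq']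
  rw [← integral_mul_const, ← integral_mul_const, ← integral_add, ← integral_neg]
  · congr 1
    ext v
    have hin : (innerSL ℝ v) e = inner ℝ v e := rfl
    simp only [VectorFourier.fourierSMulRight_apply, inner_neg_right, smul_eq_mul, hin,
      Complex.real_smul]
    have hv : (inner ℝ v e : ℝ) = (conj v * e + v * conj e) / 2 := by
      simp [Complex.inner]
      apply Complex.ext <;> simp <;> ring
    rw [hv]
    push_cast
    ring_nf
  · have := hI (fun v => Real.pi * I * conj v) (by fun_prop) (by
      intro v; simp [abs_of_pos Real.pi_pos])
    refine (this.mul_const e).congr (ae_of_all _ fun v => ?_)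
    push_cast; rfl
  · have := hI (fun v => Real.pi * I * v) (by fun_prop) (by
      intro v; simp [abs_of_pos Real.pi_pos])
    refine (this.mul_const (conj e)).congr (ae_of_all _ fun v => ?_)
    push_cast; rfl

end

end

section
open Complex MeasureTheory Metric Set
open scoped ContDiff Topology ComplexConjugate
set_option linter.unnecessarySeqFocus false

noncomputable section

open scoped FourierTransform

/-- real-valued L² norm -/
def n2 (ν : Measure ℂ) (f : ℂ → ℂ) : ℝ := (eLpNorm f 2 ν).toReal

lemma n2_nonneg (ν : Measure ℂ) (f : ℂ → ℂ) : 0 ≤ n2 ν f := ENNReal.toReal_nonneg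

lemma n2_sq {ν : Measure ℂ} {f : ℂ → ℂ} (hf : MemLp f 2 ν) :
    n2 ν f ^ 2 = ∫ x, ‖f x‖ ^ 2 ∂ν := by
  have := hf.eLpNorm_eq_integral_rpow_norm (by norm_num) (by norm_num)
  rw [n2, this, ENNReal.toReal_ofReal (by positivity)]
  simp only [ENNReal.toReal_ofNat, Real.rpow_ofNat]
  rw [← Real.rpow_natCast, ← Real.rpow_mul (by positivity)]
  norm_num

lemma memLp_sq_integrable {ν : Measure ℂ} {f : ℂ → ℂ} (hf : MemLp f 2 ν) :
    Integrable (fun x => ‖f x‖ ^ 2) ν := by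
  have := hf.integrable_norm_rpow (by norm_num) (by norm_num)
  simpa using this

lemma memLp_mul_integrable {ν : Measure ℂ} {f g : ℂ → ℂ} (hf : MemLp f 2 ν) (hg : MemLp g 2 ν) :
    Integrable (fun x => f x * g x) ν := hf.integrable_mul hg

lemma cs_integral {ν : Measure ℂ} {f g : ℂ → ℂ} (hf : MemLp f 2 ν) (hg : MemLp g 2 ν) :
    ∫ x, ‖f x‖ * ‖g x‖ ∂ν ≤ n2 ν f * n2 ν g := by
  have := integral_mul_norm_le_Lp_mul_Lq (μ := ν) (f := f) (g := g) (p := 2) (q := 2)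
    ⟨by norm_num, by norm_num, by norm_num⟩ (by simpa using hf) (by simpa using hg)
  refine this.trans (le_of_eq ?_)
  have e : ∀ {f : ℂ → ℂ}, MemLp f 2 ν → (∫ x, ‖f x‖ ^ (2:ℝ) ∂ν) ^ (1 / (2:ℝ)) = n2 ν f := by
    intro f hf
    simp only [Real.rpow_ofNat]
    rw [← n2_sq hf, ← Real.sqrt_eq_rpow, Real.sqrt_sq (n2_nonneg _ _)]
  rw [e hf, e hg]

lemma n2_add_le {ν : Measure ℂ} {f g : ℂ → ℂ} (hf : MemLp f 2 ν) (hg : MemLp g 2 ν) :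
    n2 ν (fun x => f x + g x) ≤ n2 ν f + n2 ν g := by
  have := eLpNorm_add_le hf.1 hg.1 (p := 2) (by norm_num)
  have h2 := ENNReal.toReal_mono (by simp [hf.2.ne, hg.2.ne]) this
  rwa [ENNReal.toReal_add hf.2.ne hg.2.ne] at h2

lemma n2_mono {ν : Measure ℂ} {f g : ℂ → ℂ} (hg : MemLp g 2 ν)
    (h : ∀ x, ‖f x‖ ≤ ‖g x‖) : n2 ν f ≤ n2 ν g :=
  ENNReal.toReal_mono hg.2.ne (eLpNorm_mono h)

/-- all moments integrable -/
def Mom (w : ℂ → ℂ) : Prop := ∀ n : ℕ, Integrable (fun v => ‖v‖ ^ n * ‖w v‖)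

lemma contDiff_fourierInv {w : ℂ → ℂ} (hw : Mom w) : ContDiff ℝ ∞ (𝓕⁻ w) := by
  have h1 : ContDiff ℝ ∞ (𝓕 w) := Real.contDiff_fourier (N := ⊤) (fun n _ => hw n)
  have : 𝓕⁻ w = fun x => 𝓕 w (-x) := by
    ext x; rw [Real.fourierInv_eq_fourier_neg]
  rw [this]; exact h1.comp contDiff_neg

lemma n2_fourier {h : ℂ → ℂ} (hh : Test h) : n2 volume (𝓕 h) = n2 volume h := by
  have h1 := SchwartzMap.integral_norm_sq_fourier (hh.2.toSchwartzMap hh.1)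
  have h2 : MemLp (𝓕 h) 2 volume := by
    rw [fourier_test_schwartz hh]; exact SchwartzMap.memLp _ _ _
  have h3 : n2 volume (𝓕 h) ^ 2 = n2 volume h ^ 2 := by
    rw [n2_sq h2, n2_sq (hh.memLp 2)]
    rw [fourier_test_schwartz hh]
    exact h1
  exact (pow_left_inj₀ (n2_nonneg _ _) (n2_nonneg _ _) (by norm_num)).1 h3

lemma memLp_fourier {h : ℂ → ℂ} (hh : Test h) : MemLp (𝓕 h) 2 volume := by
  rw [fourier_test_schwartz hh]; exact SchwartzMap.memLp _ _ _

lemma mom_fourier {h : ℂ → ℂ} (hh : Test h) : Mom (𝓕 h) := by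
  intro n
  rw [fourier_test_schwartz hh]
  exact SchwartzMap.integrable_pow_mul _ _ n

lemma integrable_of_mom {w : ℂ → ℂ} (hw : Mom w) (hm : AEStronglyMeasurable w volume) :
    Integrable w := by
  have := hw 0
  simp only [pow_zero, one_mul] at this
  exact (integrable_norm_iff hm).1 this

lemma integral_fourier_swap {f g : ℂ → ℂ} (hf : Integrable f) (hg : Integrable g) :
    ∫ x, 𝓕 f x * g x = ∫ x, f x * 𝓕 g x := by
  have := VectorFourier.integral_fourierIntegral_smul_eq_flip (L := innerₗ ℂ) (μ := volume)
    (ν := volume) Real.continuous_fourierChar continuous_inner hf hg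
  rw [flip_innerₗ] at this
  exact this

lemma integral_fourierInv_swap {f g : ℂ → ℂ} (hf : Integrable f) (hg : Integrable g) :
    ∫ x, 𝓕⁻ f x * g x = ∫ x, f x * 𝓕⁻ g x := by
  have h1 := integral_fourier_swap hf (hg.comp_neg)
  rw [← Real.fourierInv_eq_fourier_comp_neg] at h1
  rw [← h1, ← integral_neg_eq_self]
  congr 1; ext x
  rw [Real.fourierInv_eq_fourier_neg, neg_neg]

lemma n2_fourierInv {h : ℂ → ℂ} (hh : Test h) : n2 volume (𝓕⁻ h) = n2 volume h := by
  have hh' : Test (fun x => h (-x)) :=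
    ⟨hh.1.comp contDiff_neg, hh.2.comp_homeomorph (Homeomorph.neg ℂ)⟩
  rw [Real.fourierInv_eq_fourier_comp_neg, n2_fourier hh']
  have h3 : n2 volume (fun x => h (-x)) ^ 2 = n2 volume h ^ 2 := by
    rw [n2_sq (hh'.memLp 2), n2_sq (hh.memLp 2)]
    exact integral_neg_eq_self (fun x => ‖h x‖ ^ 2) volume
  exact (pow_left_inj₀ (n2_nonneg _ _) (n2_nonneg _ _) (by norm_num)).1 h3

lemma memLp_fourierInv {h : ℂ → ℂ} (hh : Test h) : MemLp (𝓕⁻ h) 2 volume := by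
  have hh' : Test (fun x => h (-x)) :=
    ⟨hh.1.comp contDiff_neg, hh.2.comp_homeomorph (Homeomorph.neg ℂ)⟩
  rw [Real.fourierInv_eq_fourier_comp_neg]
  exact memLp_fourier hh'

lemma Test.mul_smooth {a u : ℂ → ℂ} (ha : Test a) (hu : ContDiff ℝ ∞ u) :
    Test (fun z => a z * u z) := ⟨ha.1.mul hu, ha.2.mul_right⟩

lemma contDiff_conj_comp {n : WithTop ℕ∞} {f : ℂ → ℂ} (hf : ContDiff ℝ n f) :
    ContDiff ℝ n (fun z => conj (f z)) :=
  (Complex.conjCLE : ℂ →L[ℝ] ℂ).contDiff.comp hf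

/-- local L² bound for the inverse Fourier transform -/
lemma n2_mul_fourierInv {a w : ℂ → ℂ} {C : ℝ} (ha : Test a) (hC : ∀ z, ‖a z‖ ≤ C)
    (hw : Mom w) (hw2 : MemLp w 2 volume) :
    n2 volume (fun z => a z * 𝓕⁻ w z) ≤ C * n2 volume w := by
  have hC0 : 0 ≤ C := (norm_nonneg _).trans (hC 0)
  have hwi := integrable_of_mom hw hw2.1
  set u := 𝓕⁻ w with hu
  have hus : ContDiff ℝ ∞ u := contDiff_fourierInv hw
  have hau : Test (fun z => a z * u z) := ha.mul_smooth hus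
  set ψ : ℂ → ℂ := fun z => a z * conj (a z * u z) with hψ
  have hψT : Test ψ := ha.mul_smooth (contDiff_conj_comp hau.1)
  have hψi : Integrable ψ := hψT.1.continuous.integrable_of_hasCompactSupport hψT.2
  have h1 : ((n2 volume (fun z => a z * u z) ^ 2 : ℝ) : ℂ) = ∫ x, w x * 𝓕⁻ ψ x := by
    rw [n2_sq (hau.memLp 2), ← integral_fourierInv_swap hwi hψi, ← integral_complex_ofReal]
    congr 1; ext x
    rw [hψ, ← hu, ← Complex.normSq_eq_norm_sq, Complex.normSq_eq_conj_mul_self]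
    ring
  have h2 : n2 volume (fun z => a z * u z) ^ 2 ≤ n2 volume w * n2 volume ψ := by
    have : n2 volume (fun z => a z * u z) ^ 2 = ‖∫ x, w x * 𝓕⁻ ψ x‖ := by
      rw [← h1, Complex.norm_real, Real.norm_of_nonneg (sq_nonneg _)]
    rw [this]
    refine (norm_integral_le_integral_norm _).trans ?_
    simp only [norm_mul]
    rw [← n2_fourierInv hψT]
    exact cs_integral hw2 (memLp_fourierInv hψT)
  have h3 : n2 volume ψ ≤ C * n2 volume (fun z => a z * u z) := by
    have : n2 volume (fun z => (C:ℂ) * (a z * u z)) = C * n2 volume (fun z => a z * u z) := by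
      have := eLpNorm_const_smul (c := (C:ℂ)) (f := fun z => a z * u z) (p := 2) (μ := volume)
      rw [n2]
      change (eLpNorm ((C:ℂ) • fun z => a z * u z) 2 volume).toReal = _
      rw [this, n2, ENNReal.toReal_mul]
      simp [abs_of_nonneg hC0]
    rw [← this]
    refine n2_mono ((hau.memLp 2).const_mul _) fun x => ?_
    simp only [hψ, norm_mul, RCLike.norm_conj, Complex.norm_real, Real.norm_of_nonneg hC0]
    gcongr
    exact hC x
  by_cases h0 : n2 volume (fun z => a z * u z) = 0
  · rw [h0]; exact mul_nonneg hC0 (n2_nonneg _ _)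
  · have hpos : 0 < n2 volume (fun z => a z * u z) := lt_of_le_of_ne (n2_nonneg _ _) (Ne.symm h0)
    have h4 : n2 volume (fun z => a z * u z) ^ 2 ≤
        n2 volume w * (C * n2 volume (fun z => a z * u z)) :=
      h2.trans (mul_le_mul_of_nonneg_left h3 (n2_nonneg _ _))
    nlinarith

end

end

section
open Complex MeasureTheory Metric Set
open scoped ContDiff Topology ComplexConjugate
set_option linter.unnecessarySeqFocus false

noncomputable section

open scoped FourierTransform

/-- Beurling transform on test functions -/
def TT (h : ℂ → ℂ) : ℂ → ℂ := 𝓕⁻ (fun v => conj v / v * 𝓕 h v)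

lemma norm_mlt_le (v : ℂ) : ‖conj v / v‖ ≤ 1 := by
  rw [norm_div, RCLike.norm_conj]; exact div_self_le_one _

lemma measurable_mlt : Measurable fun v : ℂ => conj v / v := by
  exact (Complex.continuous_conj.measurable).div measurable_id

lemma aesm_mlt {h : ℂ → ℂ} (hh : Test h) :
    AEStronglyMeasurable (fun v => conj v / v * 𝓕 h v) volume :=
  measurable_mlt.aestronglyMeasurable.mul (memLp_fourier hh).1

lemma norm_mlt_fourier_le (h : ℂ → ℂ) (v : ℂ) : ‖conj v / v * 𝓕 h v‖ ≤ ‖𝓕 h v‖ := by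
  rw [norm_mul]; exact mul_le_of_le_one_left (norm_nonneg _) (norm_mlt_le v)

lemma mom_mlt {h : ℂ → ℂ} (hh : Test h) : Mom (fun v => conj v / v * 𝓕 h v) := by
  intro n
  refine (mom_fourier hh n).mono' ((by fun_prop : AEStronglyMeasurable (fun v : ℂ => ‖v‖ ^ n) volume).mul (aesm_mlt hh).norm)
    (ae_of_all _ fun v => ?_)
  rw [norm_mul, norm_norm, norm_pow, norm_norm]
  gcongr
  exact norm_mlt_fourier_le h v

lemma memLp_mlt {h : ℂ → ℂ} (hh : Test h) : MemLp (fun v => conj v / v * 𝓕 h v) 2 volume :=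
  (memLp_fourier hh).mono (aesm_mlt hh) (ae_of_all _ fun v => norm_mlt_fourier_le h v)

lemma contDiff_TT {h : ℂ → ℂ} (hh : Test h) : ContDiff ℝ ∞ (TT h) :=
  contDiff_fourierInv (mom_mlt hh)

lemma n2_mul_TT {a h : ℂ → ℂ} {C : ℝ} (ha : Test a) (hC : ∀ z, ‖a z‖ ≤ C) (hh : Test h) :
    n2 volume (fun z => a z * TT h z) ≤ C * n2 volume h := by
  refine (n2_mul_fourierInv ha hC (mom_mlt hh) (memLp_mlt hh)).trans ?_
  refine mul_le_mul_of_nonneg_left ?_ ((norm_nonneg _).trans (hC 0))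
  rw [← n2_fourier hh]
  exact n2_mono (memLp_fourier hh) (norm_mlt_fourier_le h)

lemma hasFDerivAt_TT {h : ℂ → ℂ} (hh : Test h) (x : ℂ) :
    HasFDerivAt (TT h) (bel (TT (wirtingerZ h) x) (TT (wirtingerZBar h) x)) x := by
  have h1 := mom_mlt hh 1
  simp only [pow_one] at h1
  have := hasFDerivAt_fourierInv (integrable_of_mom (mom_mlt hh) (aesm_mlt hh)) h1 x
  have e1 : (fun v => conj v / v * 𝓕 (wirtingerZ h) v) =
      fun v => (Real.pi * I * conj v) * (conj v / v * 𝓕 h v) := by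
    ext v; rw [fourier_wZ hh]; ring
  have e2 : (fun v => conj v / v * 𝓕 (wirtingerZBar h) v) =
      fun v => (Real.pi * I * v) * (conj v / v * 𝓕 h v) := by
    ext v; rw [fourier_wZBar hh]; ring
  unfold TT
  rw [e1, e2]
  exact this

lemma wZ_TT {h : ℂ → ℂ} (hh : Test h) : wirtingerZ (TT h) = TT (wirtingerZ h) := by
  ext x; exact wirtingerZ_of_hasFDerivAt (hasFDerivAt_TT hh x)
lemma wZBar_TT {h : ℂ → ℂ} (hh : Test h) : wirtingerZBar (TT h) = TT (wirtingerZBar h) := by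
  ext x; exact wirtingerZBar_of_hasFDerivAt (hasFDerivAt_TT hh x)

/-- `h ↦ μ T h` -/
def SS (μ h : ℂ → ℂ) : ℂ → ℂ := fun z => μ z * TT h z

lemma Test.SS {μ h : ℂ → ℂ} (hμ : Test μ) (hh : Test h) : Test (SS μ h) :=
  hμ.mul_smooth (contDiff_TT hh)

lemma wZ_SS {μ h : ℂ → ℂ} (hμ : Test μ) (hh : Test h) : wirtingerZ (SS μ h) =
    fun z => SS μ (wirtingerZ h) z + SS (wirtingerZ μ) h z := by
  ext z
  have := wZ_mul (hμ.diff z) (hasFDerivAt_TT hh z).differentiableAt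
  rw [wZ_TT hh] at this
  unfold SS; rw [this]; ring

lemma wZBar_SS {μ h : ℂ → ℂ} (hμ : Test μ) (hh : Test h) : wirtingerZBar (SS μ h) =
    fun z => SS μ (wirtingerZBar h) z + SS (wirtingerZBar μ) h z := by
  ext z
  have := wZBar_mul (hμ.diff z) (hasFDerivAt_TT hh z).differentiableAt
  rw [wZBar_TT hh] at this
  unfold SS; rw [this]; ring

lemma wZ_add {f g : ℂ → ℂ} {z : ℂ} (hf : DifferentiableAt ℝ f z) (hg : DifferentiableAt ℝ g z) :
    wirtingerZ (fun z => f z + g z) z = wirtingerZ f z + wirtingerZ g z := by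
  apply wirtingerZ_of_hasFDerivAt (b := wirtingerZBar f z + wirtingerZBar g z)
  rw [← bel_add]
  exact (hasFDerivAt_bel hf).add (hasFDerivAt_bel hg)

lemma wZwZBar_SS {μ h : ℂ → ℂ} (hμ : Test μ) (hh : Test h) :
    wirtingerZ (wirtingerZBar (SS μ h)) = fun z =>
      (SS μ (wirtingerZ (wirtingerZBar h)) z + SS (wirtingerZ μ) (wirtingerZBar h) z) +
      (SS (wirtingerZBar μ) (wirtingerZ h) z + SS (wirtingerZ (wirtingerZBar μ)) h z) := by
  ext z
  rw [wZBar_SS hμ hh, wZ_add ((hμ.SS hh.wZBar).diff z) ((hμ.wZBar.SS hh).diff z),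
    wZ_SS hμ hh.wZBar, wZ_SS hμ.wZBar hh]

/-- weighted Sobolev norm -/
def NN (ε : ℝ) (h : ℂ → ℂ) : ℝ := n2 volume h + ε * (n2 volume (wirtingerZ h) +
  n2 volume (wirtingerZBar h)) + ε ^ 2 * n2 volume (wirtingerZ (wirtingerZBar h))

lemma Test.bounded {a : ℂ → ℂ} (ha : Test a) : ∃ C, ∀ z, ‖a z‖ ≤ C :=
  ha.2.exists_bound_of_continuous ha.1.continuous

lemma NN_contract {μ : ℂ → ℂ} (hμ : Test μ) {k : ℝ} (hk0 : 0 ≤ k) (hk : k < 1) (hb : ∀ z, ‖μ z‖ ≤ k) :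
    ∃ ε > 0, ∃ k', 0 ≤ k' ∧ k' < 1 ∧ ∀ h, Test h → NN ε (SS μ h) ≤ k' * NN ε h := by
  obtain ⟨C1, hC1⟩ := hμ.wZ.bounded
  obtain ⟨C2, hC2⟩ := hμ.wZBar.bounded
  obtain ⟨C3, hC3⟩ := hμ.wZBar.wZ.bounded
  have h1 := (norm_nonneg _).trans (hC1 0)
  have h2 := (norm_nonneg _).trans (hC2 0)
  have h3 := (norm_nonneg _).trans (hC3 0)
  set C := C1 + C2 + C3 + 1 with hC
  set ε := (1 - k) / (4 * C) with hε
  have hCpos : 0 < C := by positivity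
  have hεpos : 0 < ε := by apply div_pos <;> linarith
  have hεC : ε * C = (1 - k) / 4 := by rw [hε]; field_simp
  have hε1 : ε ≤ 1 := by nlinarith
  refine ⟨ε, hεpos, (1 + k) / 2, by linarith, by linarith, fun h hh => ?_⟩
  have a0 := n2_mul_TT hμ hb hh
  have a1 : n2 volume (wirtingerZ (SS μ h)) ≤ k * n2 volume (wirtingerZ h) + C1 * n2 volume h := by
    rw [wZ_SS hμ hh]
    refine (n2_add_le ((hμ.SS hh.wZ).memLp 2) ((hμ.wZ.SS hh).memLp 2)).trans ?_
    exact add_le_add (n2_mul_TT hμ hb hh.wZ) (n2_mul_TT hμ.wZ hC1 hh)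
  have a2 : n2 volume (wirtingerZBar (SS μ h)) ≤
      k * n2 volume (wirtingerZBar h) + C2 * n2 volume h := by
    rw [wZBar_SS hμ hh]
    refine (n2_add_le ((hμ.SS hh.wZBar).memLp 2) ((hμ.wZBar.SS hh).memLp 2)).trans ?_
    exact add_le_add (n2_mul_TT hμ hb hh.wZBar) (n2_mul_TT hμ.wZBar hC2 hh)
  have a3 : n2 volume (wirtingerZ (wirtingerZBar (SS μ h))) ≤
      (k * n2 volume (wirtingerZ (wirtingerZBar h)) + C1 * n2 volume (wirtingerZBar h)) +
      (C2 * n2 volume (wirtingerZ h) + C3 * n2 volume h) := by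
    rw [wZwZBar_SS hμ hh]
    refine (n2_add_le (((hμ.SS hh.wZBar.wZ).memLp 2).add ((hμ.wZ.SS hh.wZBar).memLp 2))
      (((hμ.wZBar.SS hh.wZ).memLp 2).add ((hμ.wZBar.wZ.SS hh).memLp 2))).trans ?_
    refine add_le_add ((n2_add_le ((hμ.SS hh.wZBar.wZ).memLp 2)
      ((hμ.wZ.SS hh.wZBar).memLp 2)).trans ?_) ((n2_add_le ((hμ.wZBar.SS hh.wZ).memLp 2)
      ((hμ.wZBar.wZ.SS hh).memLp 2)).trans ?_)
    · exact add_le_add (n2_mul_TT hμ hb hh.wZBar.wZ) (n2_mul_TT hμ.wZ hC1 hh.wZBar)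
    · exact add_le_add (n2_mul_TT hμ.wZBar hC2 hh.wZ) (n2_mul_TT hμ.wZBar.wZ hC3 hh)
  unfold NN
  have p0 := n2_nonneg volume h
  have p1 := n2_nonneg volume (wirtingerZ h)
  have p2 := n2_nonneg volume (wirtingerZBar h)
  have p3 := n2_nonneg volume (wirtingerZ (wirtingerZBar h))
  generalize n2 volume h = x0 at *
  generalize n2 volume (wirtingerZ h) = x1 at *
  generalize n2 volume (wirtingerZBar h) = x2 at *
  generalize n2 volume (wirtingerZ (wirtingerZBar h)) = x3 at *
  change n2 volume (SS μ h) ≤ _ at a0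
  have e2 : 0 < ε ^ 2 := by positivity
  have b1 := mul_le_mul_of_nonneg_left a1 hεpos.le
  have b2 := mul_le_mul_of_nonneg_left a2 hεpos.le
  have b3 := mul_le_mul_of_nonneg_left a3 e2.le
  have c1 : ε * C1 + ε * C2 + ε * C3 + ε = (1 - k) / 4 := by rw [← hεC, hC]; ring
  have d1 : 0 ≤ ε * C1 := by positivity
  have d2 : 0 ≤ ε * C2 := by positivity
  have d3 : 0 ≤ ε * C3 := by positivity
  have e3 : ε ^ 2 * C3 ≤ ε * C3 := by nlinarith
  have f0 : (ε * C1 + ε * C2 + ε ^ 2 * C3) * x0 ≤ (1 - k) / 2 * x0 := by gcongr; linarith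
  have f1 : (ε * C2) * (ε * x1) ≤ (1 - k) / 2 * (ε * x1) := by gcongr; linarith
  have f2 : (ε * C1) * (ε * x2) ≤ (1 - k) / 2 * (ε * x2) := by gcongr; linarith
  have f3 : 0 ≤ (1 - k) / 2 * (ε ^ 2 * x3) := by
    apply mul_nonneg (by linarith) (by positivity)
  nlinarith

end

end

section
open Complex MeasureTheory Metric Set Filter
open scoped ContDiff Topology ComplexConjugate
set_option linter.unnecessarySeqFocus false

noncomputable section

open scoped FourierTransform

lemma integrableOn_inv_norm : IntegrableOn (fun v : ℂ => ‖v‖⁻¹) (closedBall 0 1) := by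
  have hm : Measurable fun v : ℂ => ‖v‖⁻¹ := measurable_norm.inv
  rw [← integrable_indicator_iff measurableSet_closedBall]
  refine ⟨(hm.indicator measurableSet_closedBall).aestronglyMeasurable, ?_⟩
  rw [hasFiniteIntegral_iff_enorm, ← Complex.lintegral_comp_polarCoord_symm]
  have : ∫⁻ p in polarCoord.target, ENNReal.ofReal p.1 • ‖(closedBall (0:ℂ) 1).indicator (fun v : ℂ => ‖v‖⁻¹) (Complex.polarCoord.symm p)‖ₑ
      ≤ ∫⁻ p in (Icc 0 1 ×ˢ Icc (-Real.pi) Real.pi : Set (ℝ × ℝ)), 1 := by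
    rw [← lintegral_indicator (by measurability), ← lintegral_indicator (by measurability)]
    apply lintegral_mono
    intro p
    simp only [indicator]
    by_cases hp : p ∈ polarCoord.target
    · rw [if_pos hp]
      simp only [polarCoord_target, mem_prod, mem_Ioi, mem_Ioo] at hp
      by_cases h1 : p.1 ≤ 1
      · have h2 : Complex.polarCoord.symm p ∈ closedBall (0:ℂ) 1 := by
          simp [Complex.norm_polarCoord_symm, abs_of_pos hp.1, h1]
        rw [if_pos h2, if_pos (by exact ⟨⟨hp.1.le, h1⟩, hp.2.1.le, hp.2.2.le⟩)]
        rw [Complex.norm_polarCoord_symm, abs_of_pos hp.1]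
        rw [Real.enorm_of_nonneg (inv_nonneg.2 hp.1.le), smul_eq_mul,
          ← ENNReal.ofReal_mul hp.1.le, mul_inv_cancel₀ hp.1.ne']
        simp
      · have h2 : Complex.polarCoord.symm p ∉ closedBall (0:ℂ) 1 := by
          simp [Complex.norm_polarCoord_symm, abs_of_pos hp.1]; linarith
        rw [if_neg h2]; simp
    · rw [if_neg hp]; simp
  refine this.trans_lt ?_
  rw [setLIntegral_one]
  exact (isCompact_Icc.prod isCompact_Icc).measure_lt_top

lemma memLp_jap : MemLp (fun v : ℂ => ((1 + ‖v‖ ^ 2)⁻¹ : ℂ)) 2 volume := by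
  have hc : Continuous fun v : ℂ => ((1 + ‖v‖ ^ 2)⁻¹ : ℂ) := by
    refine Continuous.inv₀ (by fun_prop) fun v => ?_
    have : (1 + ‖v‖ ^ 2 : ℝ) ≠ 0 := by positivity
    exact_mod_cast this
  rw [memLp_two_iff_integrable_sq_norm hc.aestronglyMeasurable]
  have := integrable_rpow_neg_one_add_norm_sq (E := ℂ) (μ := volume) (r := 4) (by
    rw [Complex.finrank_real_complex]; norm_num)
  refine this.congr (ae_of_all _ fun v => ?_)
  have h0 : (0:ℝ) < 1 + ‖v‖ ^ 2 := by positivity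
  have e : ((1 + ‖v‖ ^ 2 : ℂ)) = ((1 + ‖v‖ ^ 2 : ℝ) : ℂ) := by push_cast; ring
  simp only [e]
  rw [norm_inv, Complex.norm_real, Real.norm_of_nonneg h0.le]
  rw [show (-4 / 2 : ℝ) = -(2:ℕ) by norm_num, Real.rpow_neg h0.le, Real.rpow_natCast, inv_pow]

lemma norm_fourier_le_n2 (K : Set ℂ) (hK : IsCompact K) : ∃ C, 0 ≤ C ∧ ∀ h, Test h → tsupport h ⊆ K →
    ∀ v, ‖𝓕 h v‖ ≤ C * n2 volume h := by
  refine ⟨n2 volume (K.indicator fun _ => 1), n2_nonneg _ _, fun h hh hs v => ?_⟩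
  have hm : MemLp (K.indicator fun _ => (1:ℂ)) 2 volume :=
    memLp_indicator_const 2 hK.measurableSet 1 (Or.inr hK.measure_lt_top.ne)
  refine (VectorFourier.norm_fourierIntegral_le_integral_norm _ _ _ _ _).trans ?_
  refine le_trans (le_of_eq ?_) (cs_integral hm (hh.memLp 2))
  congr 1; ext x
  by_cases hx : x ∈ K
  · simp [hx]
  · have : h x = 0 := image_eq_zero_of_notMem_tsupport fun h' => hx (hs h')
    simp [this]

lemma weight_bound (K : Set ℂ) (hK : IsCompact K) : ∃ C, 0 ≤ C ∧ ∀ h, Test h → tsupport h ⊆ K →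
    Integrable (fun v => ‖𝓕 h v‖ * (1 + ‖v‖⁻¹)) ∧
    ∫ v, ‖𝓕 h v‖ * (1 + ‖v‖⁻¹) ≤ C * (n2 volume h + n2 volume (wirtingerZ (wirtingerZBar h))) := by
  obtain ⟨C, hC0, hC⟩ := norm_fourier_le_n2 K hK
  set p : ℂ → ℝ := (closedBall (0:ℂ) 1).indicator (fun v => 1 + ‖v‖⁻¹) with hp
  have hpi : Integrable p := by
    rw [hp, integrable_indicator_iff measurableSet_closedBall]
    exact (integrableOn_const (by exact (isCompact_closedBall _ _).measure_lt_top.ne)).add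
      integrableOn_inv_norm
  have hp0 : ∀ v, 0 ≤ p v := fun v => indicator_nonneg (fun v _ => by positivity) v
  set q : ℂ → ℂ := fun v : ℂ => ((1 + ‖v‖ ^ 2)⁻¹ : ℂ) with hq
  have hq2 : MemLp q 2 volume := memLp_jap
  refine ⟨C * (∫ v, p v) + 2 * n2 volume q, by
    have : 0 ≤ ∫ v, p v := integral_nonneg hp0
    have := n2_nonneg volume q
    positivity, fun h hh hs => ?_⟩
  set h2 := wirtingerZ (wirtingerZBar h) with hh2
  have hT2 : Test h2 := hh.wZBar.wZ
  have hF2 : ∀ v, ‖𝓕 h2 v‖ = Real.pi ^ 2 * ‖v‖ ^ 2 * ‖𝓕 h v‖ := by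
    intro v
    rw [hh2, fourier_wZ hh.wZBar, fourier_wZBar hh]
    simp only [norm_mul, RCLike.norm_conj, Complex.norm_I, Complex.norm_real,
      Real.norm_of_nonneg Real.pi_pos.le]
    ring
  have i1 : Integrable (fun v => ‖q v‖ * ‖𝓕 h v‖) := by
    simpa only [norm_mul] using (memLp_mul_integrable hq2 (memLp_fourier hh)).norm
  have i2 : Integrable (fun v => ‖q v‖ * ‖𝓕 h2 v‖) := by
    simpa only [norm_mul] using (memLp_mul_integrable hq2 (memLp_fourier hT2)).norm
  have key : ∀ v, ‖𝓕 h v‖ * (1 + ‖v‖⁻¹) ≤ (C * n2 volume h) * p v +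
      2 * (‖q v‖ * ‖𝓕 h v‖ + ‖q v‖ * ‖𝓕 h2 v‖) := by
    intro v
    by_cases hv : v ∈ closedBall (0:ℂ) 1
    · have : p v = 1 + ‖v‖⁻¹ := by rw [hp, indicator_of_mem hv]
      rw [this]
      have h3 : ‖𝓕 h v‖ * (1 + ‖v‖⁻¹) ≤ (C * n2 volume h) * (1 + ‖v‖⁻¹) := by
        gcongr; exact hC h hh hs v
      have h4 : 0 ≤ 2 * (‖q v‖ * ‖𝓕 h v‖ + ‖q v‖ * ‖𝓕 h2 v‖) := by positivity
      linarith
    · have : p v = 0 := by rw [hp, indicator_of_notMem hv]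
      rw [this]
      simp only [mem_closedBall, dist_zero_right, not_le] at hv
      have hq' : ‖q v‖ = (1 + ‖v‖ ^ 2)⁻¹ := by
        have e : ((1 + ‖v‖ ^ 2 : ℂ)) = ((1 + ‖v‖ ^ 2 : ℝ) : ℂ) := by push_cast; ring
        simp only [hq, e]
        rw [norm_inv, Complex.norm_real, Real.norm_of_nonneg (by positivity)]
      have h5 : ‖𝓕 h v‖ = ‖q v‖ * ‖𝓕 h v‖ + ‖q v‖ * (‖v‖ ^ 2 * ‖𝓕 h v‖) := by
        rw [hq']; field_simp
      have h6 : ‖q v‖ * (‖v‖ ^ 2 * ‖𝓕 h v‖) ≤ ‖q v‖ * ‖𝓕 h2 v‖ := by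
        rw [hF2]
        have : (1:ℝ) ≤ Real.pi ^ 2 := by nlinarith [Real.pi_gt_three]
        have h8 : 0 ≤ ‖v‖ ^ 2 * ‖𝓕 h v‖ := by positivity
        gcongr
        nlinarith
      have h7 : ‖v‖⁻¹ ≤ 1 := inv_le_one_of_one_le₀ hv.le
      have : ‖𝓕 h v‖ * (1 + ‖v‖⁻¹) ≤ ‖𝓕 h v‖ * 2 := by gcongr; linarith
      linarith
  have iR : Integrable (fun v => (C * n2 volume h) * p v +
      2 * (‖q v‖ * ‖𝓕 h v‖ + ‖q v‖ * ‖𝓕 h2 v‖)) := (hpi.const_mul _).add ((i1.add i2).const_mul _)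
  have iL : Integrable (fun v => ‖𝓕 h v‖ * (1 + ‖v‖⁻¹)) := by
    refine iR.mono' ((memLp_fourier hh).1.norm.mul (measurable_const.add measurable_norm.inv).aestronglyMeasurable)
      (ae_of_all _ fun v => ?_)
    rw [Real.norm_of_nonneg (by positivity)]
    exact key v
  have i12 : Integrable (fun v => 2 * (‖q v‖ * ‖𝓕 h v‖ + ‖q v‖ * ‖𝓕 h2 v‖)) :=
    (i1.add i2).const_mul _
  refine ⟨iL, (integral_mono iL iR key).trans ?_⟩
  rw [integral_add (hpi.const_mul _) i12, integral_const_mul,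
    integral_const_mul, integral_add i1 i2]
  have j1 := cs_integral hq2 (memLp_fourier hh)
  have j2 := cs_integral hq2 (memLp_fourier hT2)
  rw [n2_fourier hh] at j1
  rw [n2_fourier hT2] at j2
  have := mul_nonneg hC0 (show 0 ≤ ∫ v, p v from integral_nonneg hp0)
  have := n2_nonneg volume h2
  nlinarith

lemma norm_fourierInv_le (w : ℂ → ℂ) (x : ℂ) : ‖𝓕⁻ w x‖ ≤ ∫ v, ‖w v‖ := by
  rw [Real.fourierInv_eq_fourier_neg]
  exact VectorFourier.norm_fourierIntegral_le_integral_norm _ _ _ _ _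

lemma fourierInv_zero_at_infty (w : ℂ → ℂ) : Tendsto (𝓕⁻ w) (cocompact ℂ) (𝓝 0) := by
  have h := tendsto_integral_exp_inner_smul_cocompact (V := ℂ) w
  have e : (𝓕⁻ w) = (fun x => 𝓕 w x) ∘ Neg.neg := by
    ext x; rw [Real.fourierInv_eq_fourier_neg]; rfl
  rw [e]
  refine Tendsto.comp (y := cocompact ℂ) ?_ (Homeomorph.neg ℂ).isClosedEmbedding.tendsto_cocompact
  exact h

/-- data of a solution of `σ_z̄ = h`, `σ_z = T h` -/
lemma cauchy_sol {h : ℂ → ℂ} (hh : Test h)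
    (hi : Integrable (fun v => ‖𝓕 h v‖ * (1 + ‖v‖⁻¹))) :
    ∃ s : ℂ → ℂ, (∀ x, HasFDerivAt s (bel (TT h x) (h x)) x) ∧
      Tendsto s (cocompact ℂ) (𝓝 0) ∧
      (∀ x, ‖s x‖ ≤ ∫ v, ‖𝓕 h v‖ * (1 + ‖v‖⁻¹)) ∧
      (∀ x, ‖bel (TT h x) (h x)‖ ≤ 2 * ∫ v, ‖𝓕 h v‖ * (1 + ‖v‖⁻¹)) := by
  set w : ℂ → ℂ := fun v => 𝓕 h v / (Real.pi * I * v) with hw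
  have hF := integrable_of_mom (mom_fourier hh) (memLp_fourier hh).1
  have hmw : AEStronglyMeasurable w volume :=
    (hF.1.aemeasurable.div (measurable_const.mul measurable_id).aemeasurable).aestronglyMeasurable
  have hpi : (1:ℝ) ≤ Real.pi := by linarith [Real.pi_gt_three]
  have hwn : ∀ v, ‖w v‖ ≤ ‖𝓕 h v‖ * (1 + ‖v‖⁻¹) := by
    intro v
    simp only [hw, norm_div, norm_mul, Complex.norm_I, Complex.norm_real,
      Real.norm_of_nonneg Real.pi_pos.le]
    rw [div_eq_mul_inv]
    gcongr
    rw [mul_one, mul_inv]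
    have : Real.pi⁻¹ ≤ 1 := inv_le_one_of_one_le₀ hpi
    have h2 : 0 ≤ ‖v‖⁻¹ := by positivity
    nlinarith
  have hFn : ∀ v, ‖𝓕 h v‖ ≤ ‖𝓕 h v‖ * (1 + ‖v‖⁻¹) := fun v =>
    le_mul_of_one_le_right (norm_nonneg _) (by have : 0 ≤ ‖v‖⁻¹ := by positivity
                                               linarith)
  have hwi : Integrable w := hi.mono' hmw (ae_of_all _ hwn)
  have hvw : ∀ v, ‖v‖ * ‖w v‖ ≤ ‖𝓕 h v‖ := by
    intro v
    simp only [hw, norm_div, norm_mul, Complex.norm_I, Complex.norm_real,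
      Real.norm_of_nonneg Real.pi_pos.le]
    by_cases hv : ‖v‖ = 0
    · rw [hv]; simp
    · have : ‖v‖ * (‖𝓕 h v‖ / (Real.pi * 1 * ‖v‖)) = ‖𝓕 h v‖ / Real.pi := by field_simp
      rw [this]; exact div_le_self (norm_nonneg _) hpi
  have hw1 : Integrable fun v => ‖v‖ * ‖w v‖ := by
    refine hF.norm.mono' (measurable_norm.aestronglyMeasurable.mul hmw.norm) (ae_of_all _ fun v => ?_)
    rw [Real.norm_of_nonneg (by positivity)]
    exact hvw v
  have hT : ∀ x, ‖TT h x‖ ≤ ∫ v, ‖𝓕 h v‖ * (1 + ‖v‖⁻¹) := by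
    intro x
    refine (norm_fourierInv_le _ x).trans ?_
    exact integral_mono (hi.mono' (memLp_mlt hh).1.norm (ae_of_all _ fun v => by
      rw [norm_norm]; exact (norm_mlt_fourier_le h v).trans (hFn v))) hi fun v =>
        (norm_mlt_fourier_le h v).trans (hFn v)
  have hinv : 𝓕⁻ (𝓕 h) = h :=
    Continuous.fourierInv_fourier_eq hh.1.continuous
      (hh.1.continuous.integrable_of_hasCompactSupport hh.2) hF
  have hH : ∀ x, ‖h x‖ ≤ ∫ v, ‖𝓕 h v‖ * (1 + ‖v‖⁻¹) := by
    intro x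
    rw [← congrFun hinv x]
    refine (norm_fourierInv_le _ x).trans ?_
    exact integral_mono hF.norm hi hFn
  have hae : ∀ᵐ v : ℂ, v ≠ 0 := by
    simp [ae_iff, measure_singleton]
  refine ⟨𝓕⁻ w, fun x => ?_, fourierInv_zero_at_infty w, fun x => ?_, fun x => ?_⟩
  · have := hasFDerivAt_fourierInv hwi hw1 x
    have e1 : 𝓕⁻ (fun v => (Real.pi * I * conj v) * w v) x = TT h x := by
      unfold TT
      simp only [Real.fourierInv_eq']
      apply integral_congr_ae
      filter_upwards [hae] with v hv
      have : (Real.pi : ℂ) ≠ 0 := by exact_mod_cast Real.pi_ne_zero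
      congr 1
      simp only [hw]
      field_simp
    have e2 : 𝓕⁻ (fun v => (Real.pi * I * v) * w v) x = h x := by
      conv_rhs => rw [← congrFun hinv x]
      simp only [Real.fourierInv_eq']
      apply integral_congr_ae
      filter_upwards [hae] with v hv
      have : (Real.pi : ℂ) ≠ 0 := by exact_mod_cast Real.pi_ne_zero
      congr 1
      simp only [hw]
      field_simp
    rw [e1, e2] at this
    exact this
  · exact (norm_fourierInv_le w x).trans (integral_mono hwi.norm hi hwn)
  · refine (norm_bel_le _ _).trans ?_
    linarith [hT x, hH x]

end

end

section
open Complex MeasureTheory Metric Set Filter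
open scoped ContDiff Topology ComplexConjugate
set_option linter.unnecessarySeqFocus false

noncomputable section

open scoped FourierTransform

lemma exists_sigma {μ : ℂ → ℂ} (hμ : Test μ) {k : ℝ} (hk0 : 0 ≤ k) (hk : k < 1)
    (hb : ∀ z, ‖μ z‖ ≤ k) : ∃ σ p : ℂ → ℂ, Continuous p ∧
      (∀ x, HasFDerivAt σ (bel (p x) (μ x * p x + wirtingerZ μ x)) x) ∧
      Tendsto σ (cocompact ℂ) (𝓝 0) := by
  obtain ⟨ε, hε, k', hk'0, hk'1, hcon⟩ := NN_contract hμ hk0 hk hb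
  set H : ℕ → ℂ → ℂ := fun n => (SS μ)^[n] (wirtingerZ μ) with hH
  have H0 : H 0 = wirtingerZ μ := rfl
  have Hs : ∀ n, H (n+1) = SS μ (H n) := fun n => Function.iterate_succ_apply' _ _ _
  have HT : ∀ n, Test (H n) := by
    intro n
    induction n with
    | zero => exact hμ.wZ
    | succ n ih => rw [Hs]; exact hμ.SS ih
  have Hsupp : ∀ n, tsupport (H n) ⊆ tsupport μ := by
    intro n
    cases n with
    | zero => exact tsupport_wZ μ
    | succ n => rw [Hs]; exact tsupport_mul_subset_left
  have HN : ∀ n, NN ε (H n) ≤ k' ^ n * NN ε (H 0) := by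
    intro n
    induction n with
    | zero => simp
    | succ n ih =>
      rw [Hs]
      refine (hcon _ (HT n)).trans ?_
      rw [pow_succ]
      nlinarith
  obtain ⟨C, hC0, hC⟩ := weight_bound (tsupport μ) hμ.2
  set B : ℕ → ℝ := fun n => ∫ v, ‖𝓕 (H n) v‖ * (1 + ‖v‖⁻¹) with hB
  have hBle : ∀ n, B n ≤ (C * ((1 + (ε ^ 2)⁻¹) * NN ε (H 0))) * k' ^ n := by
    intro n
    refine (hC _ (HT n) (Hsupp n)).2.trans ?_
    have h1 : n2 volume (H n) + n2 volume (wirtingerZ (wirtingerZBar (H n))) ≤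
        (1 + (ε ^ 2)⁻¹) * NN ε (H n) := by
      unfold NN
      have p0 := n2_nonneg volume (H n)
      have p1 := n2_nonneg volume (wirtingerZ (H n))
      have p2 := n2_nonneg volume (wirtingerZBar (H n))
      have p3 := n2_nonneg volume (wirtingerZ (wirtingerZBar (H n)))
      generalize n2 volume (H n) = x0 at *
      generalize n2 volume (wirtingerZ (H n)) = x1 at *
      generalize n2 volume (wirtingerZBar (H n)) = x2 at *
      generalize n2 volume (wirtingerZ (wirtingerZBar (H n))) = x3 at *
      have e1 : (ε ^ 2)⁻¹ * (ε ^ 2 * x3) = x3 := by field_simp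
      have e2 : 0 ≤ (ε ^ 2)⁻¹ * (x0 + ε * (x1 + x2)) := by positivity
      have e3 : 0 ≤ ε * (x1 + x2) := by positivity
      have e4 : 0 ≤ ε ^ 2 * x3 := by positivity
      linarith
    have h2 : (1 + (ε ^ 2)⁻¹) * NN ε (H n) ≤ (1 + (ε ^ 2)⁻¹) * (k' ^ n * NN ε (H 0)) := by
      gcongr; exact HN n
    calc _ ≤ C * ((1 + (ε ^ 2)⁻¹) * (k' ^ n * NN ε (H 0))) := by
          gcongr; exact h1.trans h2
      _ = _ := by ring
  have hB0 : ∀ n, 0 ≤ B n := fun n => integral_nonneg fun v => by positivity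
  have hBs : Summable B := Summable.of_nonneg_of_le hB0 hBle
    ((summable_geometric_of_lt_one hk'0 hk'1).mul_left _)
  choose s hs1 hs2 hs3 hs4 using fun n => cauchy_sol (HT n) (hC _ (HT n) (Hsupp n)).1
  have hT : ∀ n x, ‖TT (H n) x‖ ≤ 4 * B n := by
    intro n x
    have h1 := (bel (TT (H n) x) (H n x)).le_opNorm 1
    have h2 := (bel (TT (H n) x) (H n x)).le_opNorm I
    have h4 := hs4 n x
    simp only [bel_apply, map_one, conj_I, norm_one, Complex.norm_I, mul_one] at h1 h2
    have : ‖TT (H n) x‖ = ‖((TT (H n) x + H n x) - I * (TT (H n) x * I + H n x * -I)) / 2‖ := by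
      congr 1; ring_nf; simp only [I_sq]; ring
    rw [this, norm_div]
    have h5 := norm_sub_le (TT (H n) x + H n x) (I * (TT (H n) x * I + H n x * -I))
    rw [norm_mul, Complex.norm_I, one_mul] at h5
    simp only [RCLike.norm_ofNat]
    simp only [hB] at *
    have := hB0 n
    linarith
  have hTs : ∀ x, Summable fun n => TT (H n) x := fun x =>
    Summable.of_norm_bounded (hBs.mul_left 4) fun n => hT n x
  refine ⟨fun x => ∑' n, s n x, fun x => ∑' n, TT (H n) x, ?_, fun x => ?_, ?_⟩
  · exact continuous_tsum (fun n => (contDiff_TT (HT n)).continuous) (hBs.mul_left 4) hT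
  · have hd := hasFDerivAt_tsum (𝕜 := ℝ) (f := s) (f' := fun n x => bel (TT (H n) x) (H n x))
      (u := fun n => 2 * B n) (hBs.mul_left 2) hs1 hs4 (x₀ := 0)
      (Summable.of_norm_bounded hBs fun n => hs3 n 0) x
    have hHs : Summable fun n => H n x := by
      rw [← summable_nat_add_iff 1]
      simp only [Hs]
      exact (hTs x).mul_left (μ x)
    have hsum : ∑' n, bel (TT (H n) x) (H n x) =
        bel (∑' n, TT (H n) x) (μ x * ∑' n, TT (H n) x + wirtingerZ μ x) := by
      have e : ∑' n, H n x = μ x * ∑' n, TT (H n) x + wirtingerZ μ x := by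
        rw [hHs.tsum_eq_zero_add, H0, add_comm, ← tsum_mul_left]
        simp only [Hs]; rfl
      rw [← e]
      have hsm : Summable fun n => bel (TT (H n) x) (H n x) :=
        Summable.of_norm_bounded (hBs.mul_left 2) fun n => hs4 n x
      apply ContinuousLinearMap.ext
      intro v
      rw [← ContinuousLinearMap.apply_apply v, ContinuousLinearMap.map_tsum _ hsm]
      simp only [ContinuousLinearMap.apply_apply, bel_apply]
      rw [((hTs x).mul_right v).tsum_add (hHs.mul_right (conj v)), tsum_mul_right, tsum_mul_right]
    rw [hsum] at hd
    exact hd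
  · have := tendsto_tsum_of_dominated_convergence (f := fun x n => s n x) (g := fun _ => (0:ℂ))
      hBs (fun n => hs2 n) (Eventually.of_forall fun x n => hs3 n x)
    simpa using this

end

end

section
open Complex MeasureTheory Metric Set Filter
open scoped ContDiff Topology ComplexConjugate
set_option linter.unnecessarySeqFocus false

noncomputable section

lemma contDiff_bel_comp {n : WithTop ℕ∞} {a b : ℂ → ℂ} (ha : ContDiff ℝ n a) (hb : ContDiff ℝ n b) :
    ContDiff ℝ n (fun z => bel (a z) (b z)) := by
  unfold bel
  exact ((ContinuousLinearMap.mul ℝ ℂ).contDiff.comp ha).add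
    (((ContinuousLinearMap.mul ℝ ℂ).contDiff.comp hb).clm_comp contDiff_const)

/-- invertible `bel` as an equivalence -/
def belE (a b : ℂ) (h : ‖b‖ < ‖a‖) : ℂ ≃L[ℝ] ℂ :=
  (bel a b).toContinuousLinearEquivOfDetNeZero (by
    rw [det_bel]; nlinarith [norm_nonneg b, norm_nonneg a])

@[simp] lemma coe_belE (a b : ℂ) (h : ‖b‖ < ‖a‖) : (belE a b h : ℂ →L[ℝ] ℂ) = bel a b := by
  ext v <;> simp [belE]

lemma hasFDerivAt_bel_lin {α β γ δ : ℂ} {a b : ℂ → ℂ} {z : ℂ}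
    (ha : HasFDerivAt a (bel α β) z) (hb : HasFDerivAt b (bel γ δ) z) :
    ∃ D : ℂ →L[ℝ] ℂ →L[ℝ] ℂ, HasFDerivAt (fun z => bel (a z) (b z)) D z ∧
      ∀ x y, D x y = (bel α β x) * y + (bel γ δ x) * conj y := by
  have h1 := ((ContinuousLinearMap.mul ℝ ℂ).hasFDerivAt (x := a z)).comp z ha
  have h2 := ((ContinuousLinearMap.mul ℝ ℂ).hasFDerivAt (x := b z)).comp z hb
  have h3 := h2.clm_comp (hasFDerivAt_const (Complex.conjCLE : ℂ →L[ℝ] ℂ) z)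
  refine ⟨_, h1.add h3, fun x y => ?_⟩
  simp; ring

/-- primitive -/
lemma exists_primitive {μ : ℂ → ℂ} (hμ : Test μ) {k : ℝ} (hk0 : 0 ≤ k) (hk : k < 1)
    (hb : ∀ z, ‖μ z‖ ≤ k) : ∃ f a : ℂ → ℂ, ContDiff ℝ 2 f ∧ ContDiff ℝ 1 a ∧
      (∀ z, HasFDerivAt f (bel (a z) (a z * μ z)) z) ∧ (∀ z, a z ≠ 0) ∧
      Tendsto a (cocompact ℂ) (𝓝 1) ∧ f 0 = 0 := by
  obtain ⟨σ, p, hp, hσ, hσ0⟩ := exists_sigma hμ hk0 hk hb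
  set E : ℂ → ℂ := fun z => cexp (σ z) with hE
  have hEd : ∀ z, HasFDerivAt E (bel (E z * p z) (E z * (μ z * p z + wirtingerZ μ z))) z := by
    intro z
    have := ((Complex.hasDerivAt_exp (σ z)).hasFDerivAt.restrictScalars ℝ).comp z (hσ z)
    convert! this using 1
    ext v <;> simp [hE] <;> ring
  have hEc : Continuous E := continuous_iff_continuousAt.2 fun z => (hEd z).continuousAt
  have hμc := hμ.1.continuous
  have hμzc := hμ.wZ.1.continuous
  have hE1 : ContDiff ℝ 1 E := by
    rw [contDiff_one_iff_fderiv]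
    refine ⟨fun z => (hEd z).differentiableAt, ?_⟩
    have : fderiv ℝ E = fun z => bel (E z * p z) (E z * (μ z * p z + wirtingerZ μ z)) := by
      ext1 z; exact (hEd z).fderiv
    rw [this]
    exact continuous_bel.comp (f := fun z => (E z * p z, E z * (μ z * p z + wirtingerZ μ z)))
      (by fun_prop)
  have hμ1 : ContDiff ℝ 1 μ := hμ.1.of_le (by exact_mod_cast le_top)
  have hw1 : ContDiff ℝ 1 (fun z => bel (E z) (E z * μ z)) := contDiff_bel_comp hE1 (hE1.mul hμ1)
  have hsymm : ∀ z, ∀ x y, fderiv ℝ (fun z => bel (E z) (E z * μ z)) z x y =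
      fderiv ℝ (fun z => bel (E z) (E z * μ z)) z y x := by
    intro z x y
    obtain ⟨D, hD, hD2⟩ := hasFDerivAt_bel_lin (hEd z)
      (hasFDerivAt_bel_mul (hEd z) (hasFDerivAt_bel (hμ.diff z)))
    rw [hD.fderiv, hD2, hD2]
    simp only [bel_apply]
    ring
  obtain ⟨f, hf⟩ := convex_univ.exists_forall_hasFDerivAt_of_fderiv_symmetric isOpen_univ
    (hw1.differentiable (by simp)).differentiableOn (fun z _ => hsymm z)
  have hf' : ∀ z, HasFDerivAt (fun z => f z - f 0) (bel (E z) (E z * μ z)) z :=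
    fun z => (hf z (mem_univ z)).sub_const _
  refine ⟨fun z => f z - f 0, E, ?_, hE1, hf', fun z => Complex.exp_ne_zero _, ?_, by simp⟩
  · rw [show (2 : WithTop ℕ∞) = 1 + 1 by norm_num, contDiff_succ_iff_fderiv]
    refine ⟨fun z => (hf' z).differentiableAt, by simp, ?_⟩
    have : fderiv ℝ (fun z => f z - f 0) = fun z => bel (E z) (E z * μ z) := by
      ext1 z; exact (hf' z).fderiv
    rw [this]; exact hw1
  · have := (Complex.continuous_exp.tendsto 0).comp hσ0
    rw [Complex.exp_zero] at this
    exact this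

lemma local_homeo {f : ℂ → ℂ} {z a b : ℂ} (hf : ContDiffAt ℝ 1 f z) (hd : HasFDerivAt f (bel a b) z)
    (hab : ‖b‖ < ‖a‖) : HasStrictFDerivAt f (belE a b hab : ℂ →L[ℝ] ℂ) z := by
  have := hf.hasStrictFDerivAt (by simp)
  rwa [hd.fderiv, ← coe_belE a b hab] at this

lemma proper_inj_surj {f : ℂ → ℂ} (hc : Continuous f)
    (hloc : ∀ z, ∃ U ∈ 𝓝 z, InjOn f U) (hopen : ∀ z, map f (𝓝 z) = 𝓝 (f z))
    (hprop : Tendsto f (cocompact ℂ) (cocompact ℂ))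
    (hfar : ∃ z, ∀ w, f w = f z → w = z) : Function.Bijective f := by
  have hpm : IsProperMap f := isProperMap_iff_tendsto_cocompact.2 ⟨hc, hprop⟩
  constructor
  · set S : Set ℂ := {z | ∃ w, w ≠ z ∧ f w = f z} with hS
    have hSo : IsOpen S := by
      rw [isOpen_iff_mem_nhds]
      rintro z ⟨w, hwz, hfw⟩
      obtain ⟨V, U, hV, hU, hwV, hzU, hd⟩ := t2_separation hwz
      have h1 : f '' V ∈ 𝓝 (f z) := by
        rw [← hfw, ← hopen w]; exact image_mem_map (hV.mem_nhds hwV)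
      have h2 := hc.continuousAt.preimage_mem_nhds h1
      filter_upwards [h2, hU.mem_nhds hzU] with z' hz' hzU'
      obtain ⟨w', hw', hfw'⟩ := hz'
      exact ⟨w', fun h => disjoint_left.1 hd hw' (h ▸ hzU'), hfw'⟩
    have hSc : IsClosed S := by
      apply IsSeqClosed.isClosed
      intro u z hu huz
      choose w hw hfw using hu
      have hK : IsCompact (f ⁻¹' (insert (f z) (range (fun n => f (u n))))) := by
        apply hpm.isCompact_preimage
        exact ((hc.tendsto z).comp huz).isCompact_insert_range
      obtain ⟨w0, -, φ, hφ, hlim⟩ := hK.tendsto_subseq (x := w) (fun n => by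
        rw [mem_preimage, hfw n]; exact Or.inr ⟨n, rfl⟩)
      have e1 : f w0 = f z := by
        refine tendsto_nhds_unique ((hc.tendsto w0).comp hlim) ?_
        have := ((hc.tendsto z).comp huz).comp hφ.tendsto_atTop
        refine this.congr fun n => ?_
        simp [hfw]
      refine ⟨w0, fun h => ?_, e1⟩
      subst h
      obtain ⟨U, hU, hinj⟩ := hloc w0
      have := (hlim.eventually hU).and ((huz.comp hφ.tendsto_atTop).eventually hU)
      obtain ⟨n, hn1, hn2⟩ := this.exists
      exact hw _ (hinj hn1 hn2 (hfw _))
    have hSe : S = ∅ := by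
      rcases isClopen_iff.1 ⟨hSc, hSo⟩ with h | h
      · exact h
      · obtain ⟨z, hz⟩ := hfar
        have : z ∈ S := h ▸ mem_univ z
        obtain ⟨w, hw, hfw⟩ := this
        exact absurd (hz w hfw) hw
    intro z w h
    by_contra hne
    have : w ∈ S := ⟨z, hne, h⟩
    rw [hSe] at this; exact this
  · have ho : IsOpenMap f := IsOpenMap.of_nhds_le fun z => (hopen z).ge
    have := isClopen_iff.1 ⟨hpm.isClosedMap.isClosed_range, ho.isOpen_range⟩
    rcases this with h | h
    · exact absurd (h ▸ mem_range_self (f := f) 0) (notMem_empty _)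
    · exact range_eq_univ.1 h

end

end

section
open Complex MeasureTheory Metric Set Filter
open scoped ContDiff Topology ComplexConjugate
set_option linter.unnecessarySeqFocus false

noncomputable section

lemma exists_qc {μ : ℂ → ℂ} (hμ : Test μ) {k : ℝ} (hk0 : 0 ≤ k) (hk : k < 1)
    (hb : ∀ z, ‖μ z‖ ≤ k) : ∃ f a : ℂ → ℂ, ContDiff ℝ 2 f ∧ ContDiff ℝ 1 a ∧
      (∀ z, HasFDerivAt f (bel (a z) (a z * μ z)) z) ∧ (∀ z, a z ≠ 0) ∧ f 0 = 0 ∧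
      Function.Bijective f ∧ (∃ L : NNReal, LipschitzWith L f) ∧
      Tendsto f (cocompact ℂ) (cocompact ℂ) := by
  obtain ⟨f, a, hf2, ha1, hfd, ha0, ha, hf0⟩ := exists_primitive hμ hk0 hk hb
  have hc := hf2.continuous
  have hab : ∀ z, ‖a z * μ z‖ < ‖a z‖ := fun z => by
    rw [norm_mul]
    have := norm_pos_iff.2 (ha0 z)
    nlinarith [hb z]
  have hstrict : ∀ z, HasStrictFDerivAt f (belE (a z) (a z * μ z) (hab z) : ℂ →L[ℝ] ℂ) z :=
    fun z => local_homeo (hf2.contDiffAt.of_le (by norm_num)) (hfd z) (hab z)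
  -- the error function
  set e : ℂ → ℂ := fun z => f z - z with he
  have hed : ∀ z, HasFDerivAt e (bel (a z - 1) (a z * μ z)) z := by
    intro z
    have := (hfd z).sub (hasFDerivAt_id (𝕜 := ℝ) z)
    convert! this using 1
    ext v <;> simp <;> ring
  obtain ⟨R0, hR0, hfar⟩ : ∃ R0 > 0, ∀ z, R0 ≤ ‖z‖ → ‖bel (a z - 1) (a z * μ z)‖ ≤ 1/10 := by
    have h1 : ∀ᶠ z in cocompact ℂ, ‖a z - 1‖ < 1/10 := by
      have := ha.eventually (ball_mem_nhds (1:ℂ) (by norm_num : (0:ℝ) < 1/10))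
      filter_upwards [this] with z hz
      rwa [dist_eq_norm] at hz
    have h2 : ∀ᶠ z in cocompact ℂ, μ z = 0 := by
      filter_upwards [hμ.2.compl_mem_cocompact] with z hz
      exact image_eq_zero_of_notMem_tsupport hz
    have h3 := h1.and h2
    rw [← cobounded_eq_cocompact] at h3
    obtain ⟨r, hr⟩ := (hasBasis_cobounded_norm (E := ℂ)).mem_iff.1 h3
    refine ⟨max r 1, by positivity, fun z hz => ?_⟩
    have := hr.2 (show r ≤ ‖z‖ from (le_max_left _ _).trans hz)
    refine (norm_bel_le _ _).trans ?_
    rw [this.2]; simp; linarith [this.1]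
  have hec : Continuous e := hc.sub continuous_id
  obtain ⟨C, hC⟩ := (isCompact_closedBall (0:ℂ) R0).exists_bound_of_continuousOn hec.continuousOn
  have hC0 : 0 ≤ C := (norm_nonneg _).trans (hC 0 (by simp [hR0.le]))
  have hbound : ∀ z, ‖e z‖ ≤ C + ‖z‖ / 10 := by
    intro z
    by_cases hz : ‖z‖ ≤ R0
    · have := hC z (by simpa using hz)
      have := norm_nonneg z
      linarith
    · push Not at hz
      have hz0 : 0 < ‖z‖ := hR0.trans hz
      set z1 : ℂ := ((R0 / ‖z‖ : ℝ) : ℂ) * z with hz1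
      have hz1n : ‖z1‖ = R0 := by
        rw [hz1, norm_mul, Complex.norm_real, Real.norm_of_nonneg (by positivity)]
        field_simp
      have hseg : ∀ x ∈ segment ℝ z1 z, R0 ≤ ‖x‖ := by
        rintro x ⟨s, t, hs, ht, hst, rfl⟩
        have : s • z1 + t • z = ((s * (R0 / ‖z‖) + t : ℝ) : ℂ) * z := by
          rw [hz1]; simp; ring
        rw [this, norm_mul, Complex.norm_real, Real.norm_of_nonneg (by positivity), add_mul]
        have : s * (R0 / ‖z‖) * ‖z‖ = s * R0 := by field_simp
        rw [this]
        nlinarith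
      have h1 := (convex_segment z1 z).norm_image_sub_le_of_norm_hasFDerivWithin_le
        (fun x hx => (hed x).hasFDerivWithinAt) (fun x hx => hfar x (hseg x hx))
        (left_mem_segment ℝ z1 z) (right_mem_segment ℝ z1 z)
      have h2 : ‖z - z1‖ ≤ ‖z‖ := by
        have : z - z1 = ((1 - R0 / ‖z‖ : ℝ) : ℂ) * z := by rw [hz1]; push_cast; ring
        rw [this, norm_mul, Complex.norm_real]
        have h3 : R0 / ‖z‖ ≤ 1 := by rw [div_le_one hz0]; exact hz.le
        have h4 : 0 ≤ R0 / ‖z‖ := by positivity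
        rw [Real.norm_of_nonneg (by linarith)]
        nlinarith
      have h3 := hC z1 (by simp [hz1n])
      have h4 : ‖e z‖ ≤ ‖e z - e z1‖ + ‖e z1‖ := by
        have := norm_add_le (e z - e z1) (e z1); simpa using this
      linarith
  have hprop : Tendsto f (cocompact ℂ) (cocompact ℂ) := by
    rw [← cobounded_eq_cocompact, ← tendsto_norm_atTop_iff_cobounded]
    have h1 : ∀ z, ‖z‖ * (1/2) - C ≤ ‖f z‖ := by
      intro z
      have h2 : ‖z‖ ≤ ‖f z‖ + ‖e z‖ := by
        have := norm_sub_le (f z) (e z); simpa [he] using this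
      linarith [hbound z, norm_nonneg z]
    refine tendsto_atTop_mono h1 ?_
    exact tendsto_atTop_add_const_right _ _ (tendsto_norm_cobounded_atTop.atTop_mul_const (by norm_num))
  have hinjfar : ∀ z w, 2 * R0 + 20 * C + 1 ≤ ‖z‖ → f w = f z → w = z := by
    intro z w hz hw
    have h1 : z - w = e w - e z := by
      simp only [he, hw]; ring
    have h2 : ‖z - w‖ ≤ 2 * C + (‖z‖ + ‖w‖) / 10 := by
      rw [h1]
      refine (norm_sub_le _ _).trans ?_
      linarith [hbound z, hbound w]
    have h3 : ‖w‖ ≤ ‖z‖ + ‖z - w‖ := by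
      have := norm_sub_le z (z - w); simpa using this
    have h4 : ‖z - w‖ < ‖z‖ / 2 := by linarith
    have h5 := (convex_ball z (‖z‖ / 2)).norm_image_sub_le_of_norm_hasFDerivWithin_le
        (C := 1/10) (f := e) (fun x hx => (hed x).hasFDerivWithinAt) (fun x hx => hfar x (by
          rw [mem_ball, dist_eq_norm, norm_sub_rev] at hx
          have : ‖z‖ ≤ ‖x‖ + ‖z - x‖ := by
            have := norm_add_le x (z - x); simpa using this
          linarith))
        (mem_ball_self (by linarith)) (show w ∈ ball z (‖z‖/2) by
          rw [mem_ball, dist_eq_norm, norm_sub_rev]; exact h4)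
    rw [← h1, norm_sub_rev w z] at h5
    have : ‖z - w‖ = 0 := by linarith [norm_nonneg (z - w)]
    rw [norm_eq_zero, sub_eq_zero] at this
    exact this.symm
  have hLip : ∃ L : NNReal, LipschitzWith L f := by
    have hcont : Continuous fun z => bel (a z) (a z * μ z) :=
      continuous_bel.comp (f := fun z => (a z, a z * μ z))
        (by have := ha1.continuous; have := hμ.1.continuous; fun_prop)
    obtain ⟨M, hM⟩ := (isCompact_closedBall (0:ℂ) R0).exists_bound_of_continuousOn hcont.continuousOn
    refine ⟨Real.toNNReal (max M 2), ?_⟩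
    apply lipschitzWith_of_nnnorm_fderiv_le (𝕜 := ℝ) (fun z => (hfd z).differentiableAt)
    intro z
    rw [(hfd z).fderiv, ← NNReal.coe_le_coe, Real.coe_toNNReal _ (by positivity)]
    by_cases hz : ‖z‖ ≤ R0
    · exact (hM z (by simpa using hz)).trans (le_max_left _ _)
    · refine le_trans ?_ (le_max_right _ _)
      have h1 := hfar z (le_of_not_ge hz)
      have h2 : bel (a z) (a z * μ z) = bel (a z - 1) (a z * μ z) + bel 1 0 := by
        rw [bel_add]; simp
      have h3 := norm_bel_le 1 0
      rw [coe_nnnorm, h2]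
      refine (norm_add_le _ _).trans ?_
      simp at h3
      linarith
  refine ⟨f, a, hf2, ha1, hfd, ha0, hf0, ?_, hLip, hprop⟩
  refine proper_inj_surj hc (fun z => ?_) (fun z => (hstrict z).map_nhds_eq_of_equiv) hprop
    ⟨((2 * R0 + 20 * C + 1 : ℝ) : ℂ), fun w hw => hinjfar _ w (by
      rw [Complex.norm_real]; exact le_abs_self _) hw⟩
  have hs := (hstrict z)
  exact ⟨(hs.toOpenPartialHomeomorph f).source,
    (hs.toOpenPartialHomeomorph f).open_source.mem_nhds hs.mem_toOpenPartialHomeomorph_source,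
    (hs.toOpenPartialHomeomorph f).injOn⟩

end

end

section
open Complex MeasureTheory Metric Set Filter
open scoped ContDiff Topology ComplexConjugate
set_option linter.unnecessarySeqFocus false

noncomputable section

/-- reflected coefficient -/
def reflc (μ : ℂ → ℂ) (z : ℂ) : ℂ := conj (μ (conj z)⁻¹) * (z / conj z) ^ 2

lemma reflc_eq_zero {μ : ℂ → ℂ} (hs : tsupport μ ⊆ ball 0 1) {z : ℂ} (hz : ‖z‖ ≤ 1) :
    reflc μ z = 0 := by
  by_cases h0 : z = 0
  · simp [reflc, h0]
  have : μ (conj z)⁻¹ = 0 := by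
    apply image_eq_zero_of_notMem_tsupport
    intro h
    have := hs h
    simp only [mem_ball, dist_zero_right, norm_inv, RCLike.norm_conj] at this
    have h1 : 1 ≤ ‖z‖⁻¹ := (one_le_inv₀ (norm_pos_iff.2 h0)).2 hz
    linarith
  simp [reflc, this]

lemma Test_reflc {μ : ℂ → ℂ} (hμ : Test μ) (hs : tsupport μ ⊆ ball 0 1) (h0 : 0 ∉ tsupport μ) :
    Test (reflc μ) := by
  constructor
  · rw [contDiff_iff_contDiffAt]
    intro z
    by_cases hz : z = 0
    · subst hz
      have : reflc μ =ᶠ[𝓝 0] fun _ => 0 := by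
        filter_upwards [ball_mem_nhds (0:ℂ) one_pos] with z hz
        exact reflc_eq_zero hs (by simpa using (mem_ball.1 hz).le)
      exact contDiffAt_const.congr_of_eventuallyEq this
    · have hcz : conj z ≠ 0 := by simpa using hz
      have hcj : ContDiffAt ℝ ∞ (fun z : ℂ => conj z) z :=
        (contDiff_conj_comp contDiff_id).contDiffAt
      have h1 : ContDiffAt ℝ ∞ (fun z : ℂ => (conj z)⁻¹) z := hcj.inv hcz
      have h2 : ContDiffAt ℝ ∞ (fun z : ℂ => conj (μ (conj z)⁻¹)) z :=
        (contDiff_conj_comp hμ.1).contDiffAt.comp z h1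
      have h3 : ContDiffAt ℝ ∞ (fun z : ℂ => z / conj z) z := by
        simp only [div_eq_mul_inv]; exact contDiffAt_fun_id.mul h1
      exact h2.mul (h3.pow 2)
  · obtain ⟨r, hr, hball⟩ := Metric.isOpen_iff.1 (isClosed_tsupport μ).isOpen_compl 0 h0
    refine HasCompactSupport.intro (isCompact_closedBall (0:ℂ) r⁻¹) fun z hz => ?_
    simp only [mem_closedBall, dist_zero_right, not_le] at hz
    have : μ (conj z)⁻¹ = 0 := by
      apply image_eq_zero_of_notMem_tsupport
      apply hball
      simp only [mem_ball, dist_zero_right, norm_inv, RCLike.norm_conj]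
      exact inv_lt_of_inv_lt₀ hr hz
    simp [reflc, this]

lemma reflc_symm {μ : ℂ → ℂ} {z : ℂ} (hz : z ≠ 0) :
    conj (μ (conj z)⁻¹ + reflc μ (conj z)⁻¹) * (z / conj z) ^ 2 = μ z + reflc μ z := by
  have hcz : conj z ≠ 0 := by simpa using hz
  unfold reflc
  simp only [map_add, map_mul, map_inv₀, Complex.conj_conj, inv_inv, map_pow, map_div₀]
  field_simp
  ring

lemma norm_reflc_le {μ : ℂ → ℂ} {k : ℝ} (hk0 : 0 ≤ k) (hb : ∀ z, ‖μ z‖ ≤ k) (z : ℂ) :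
    ‖reflc μ z‖ ≤ k := by
  unfold reflc
  rw [norm_mul, RCLike.norm_conj, norm_pow, norm_div, RCLike.norm_conj]
  have h1 : (‖z‖ / ‖z‖) ^ 2 ≤ 1 := pow_le_one₀ (by positivity) (div_self_le_one _)
  nlinarith [hb (conj z)⁻¹, norm_nonneg (μ (conj z)⁻¹)]

lemma holo_quot {P f g : ℂ → ℂ} {w a b c : ℂ} (hP : HasFDerivAt P (bel c (c * b)) (g w))
    (hf : HasStrictFDerivAt f (bel a (a * b)) (g w)) (ha : a ≠ 0) (hb : ‖b‖ < 1)
    (hg : ContinuousAt g w) (hfg : ∀ᶠ y in 𝓝 w, f (g y) = y) : HasDerivAt (P ∘ g) (c / a) w := by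
  have hab : ‖a * b‖ < ‖a‖ := by
    rw [norm_mul]; have := norm_pos_iff.2 ha; nlinarith
  rw [← coe_belE _ _ hab] at hf
  have hgd := hf.hasFDerivAt.of_local_left_inverse hg hfg
  have hc := hP.comp w hgd
  have : (bel c (c * b)).comp ((belE a (a * b) hab).symm : ℂ →L[ℝ] ℂ) =
      ContinuousLinearMap.mul ℝ ℂ (c / a) := by
    apply ContinuousLinearMap.ext
    intro v
    obtain ⟨u, rfl⟩ := (belE a (a * b) hab).surjective v
    have e : belE a (a * b) hab u = bel a (a * b) u := by rw [← coe_belE _ _ hab]; rfl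
    rw [ContinuousLinearMap.comp_apply, ContinuousLinearEquiv.coe_coe,
      ContinuousLinearEquiv.symm_apply_apply, e]
    simp only [bel_apply, ContinuousLinearMap.mul_apply']; field_simp
  rw [this] at hc
  have h2 : HasFDerivAt (𝕜 := ℂ) (P ∘ g) (ContinuousLinearMap.toSpanSingleton ℂ (c / a)) w := by
    refine hasFDerivAt_of_restrictScalars ℝ hc ?_
    ext v <;> simp [mul_comm]
  have := h2.hasDerivAt
  simpa using this

lemma const_of_bdd {Q : ℂ → ℂ} (hd : ∀ w ≠ 0, DifferentiableAt ℂ Q w) {C : ℝ}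
    (hb : ∀ w ≠ 0, ‖Q w‖ ≤ C) : ∀ w ≠ 0, Q w = Q 1 := by
  have h1 := Complex.differentiableOn_update_limUnder_of_bddAbove (f := Q) (c := 0) (s := univ)
    univ_mem (fun w hw => (hd w (by simpa using hw)).differentiableWithinAt)
    ⟨C, by rintro _ ⟨w, hw, rfl⟩; exact hb w (by simpa using hw)⟩
  rw [differentiableOn_univ] at h1
  set Q' := Function.update Q 0 (limUnder (𝓝[≠] 0) Q) with hQ'
  have e : ∀ w ≠ 0, Q' w = Q w := fun w hw => Function.update_of_ne hw _ _
  have hbd : Bornology.IsBounded (range Q') := by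
    refine (Metric.isBounded_closedBall (x := (0:ℂ)) (r := max C ‖Q' 0‖)).subset ?_
    rintro _ ⟨w, rfl⟩
    rw [mem_closedBall, dist_zero_right]
    by_cases hw : w = 0
    · rw [hw]; exact le_max_right _ _
    · rw [e w hw]; exact (hb w hw).trans (le_max_left _ _)
  intro w hw
  rw [← e w hw, ← e 1 one_ne_zero]
  exact h1.apply_eq_apply_of_bounded hbd _ _

lemma exists_disc {μ : ℂ → ℂ} (hμ : Test μ) (hs : tsupport μ ⊆ ball 0 1) (h0 : 0 ∉ tsupport μ)
    {k : ℝ} (hk0 : 0 ≤ k) (hk : k < 1) (hb : ∀ z, ‖μ z‖ ≤ k) :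
    ∃ F G a : ℂ → ℂ, ContDiff ℝ 2 F ∧ ContDiff ℝ 2 G ∧ (∀ z, G (F z) = z) ∧ (∀ z, F (G z) = z) ∧
      (∀ z, ‖z‖ < 1 → ‖F z‖ < 1) ∧ (∀ z, ‖z‖ = 1 → ‖F z‖ = 1) ∧ (∀ z, 1 < ‖z‖ → 1 < ‖F z‖) ∧
      Continuous a ∧ (∀ z, a z ≠ 0) ∧ ∀ z, ‖z‖ ≤ 1 → HasFDerivAt F (bel (a z) (a z * μ z)) z := by
  set ν : ℂ → ℂ := fun z => μ z + reflc μ z with hν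
  have hνT : Test ν := ⟨hμ.1.add (Test_reflc hμ hs h0).1, hμ.2.add (Test_reflc hμ hs h0).2⟩
  have hνb : ∀ z, ‖ν z‖ ≤ k := by
    intro z
    by_cases hz : ‖z‖ ≤ 1
    · simp only [hν, reflc_eq_zero hs hz, add_zero]; exact hb z
    · have : μ z = 0 := by
        apply image_eq_zero_of_notMem_tsupport
        intro h; have := hs h; rw [mem_ball, dist_zero_right] at this; linarith
      simp only [hν, this, zero_add]; exact norm_reflc_le hk0 hb z
  obtain ⟨f, a, hf2, ha1, hfd, ha0, hf0, hbij, ⟨L, hL⟩, hprop⟩ := exists_qc hνT hk0 hk hνb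
  have hνlt : ∀ z, ‖ν z‖ < 1 := fun z => (hνb z).trans_lt hk
  have hstrict : ∀ z, HasStrictFDerivAt f (bel (a z) (a z * ν z)) z := by
    intro z
    have := (hf2.contDiffAt (x := z)).hasStrictFDerivAt (by simp)
    rwa [(hfd z).fderiv] at this
  have hab : ∀ z, ‖a z * ν z‖ < ‖a z‖ := fun z => by
    rw [norm_mul]
    have := norm_pos_iff.2 (ha0 z)
    nlinarith [hνlt z]
  set e := Equiv.ofBijective f hbij with he
  set g : ℂ → ℂ := fun w => e.symm w with hg
  have hgf : ∀ z, g (f z) = z := fun z => e.symm_apply_apply z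
  have hfg : ∀ z, f (g z) = z := fun z => e.apply_symm_apply z
  have hpm : IsProperMap f := isProperMap_iff_tendsto_cocompact.2 ⟨hf2.continuous, hprop⟩
  have hhomeo : IsHomeomorph f :=
    isHomeomorph_iff_continuous_isClosedMap_bijective.2 ⟨hf2.continuous, hpm.isClosedMap, hbij⟩
  set H : ℂ ≃ₜ ℂ := hhomeo.homeomorph f with hH
  have hHg : ∀ z, H.symm z = g z := by
    intro z; apply hbij.1; rw [hfg]; exact H.apply_symm_apply z
  have hgH : g = H.symm := funext fun z => (hHg z).symm
  have hgc : Continuous g := hgH ▸ H.symm.continuous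
  have hg2 : ContDiff ℝ 2 g := by
    rw [contDiff_iff_contDiffAt]
    intro w
    have hd : HasFDerivAt f (belE (a (g w)) (a (g w) * ν (g w)) (hab _) : ℂ →L[ℝ] ℂ) (g w) := by
      rw [coe_belE]; exact hfd (g w)
    have := H.toOpenPartialHomeomorph.contDiffAt_symm (n := 2) (𝕜 := ℝ) (a := w) (by simp)
      (f₀' := belE (a (g w)) (a (g w) * ν (g w)) (hab _)) (by
        change HasFDerivAt f _ (H.symm w)
        rw [hHg]; exact hd) (by
        change ContDiffAt ℝ 2 f (H.symm w)
        exact hf2.contDiffAt)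
    rw [hgH]; exact this
  -- the reflected product
  set P : ℂ → ℂ := fun z => f z * conj (f (conj z)⁻¹) with hP
  have hPd : ∀ z ≠ 0, ∃ c, HasFDerivAt P (bel c (c * ν z)) z := by
    intro z hz
    have hcz : conj z ≠ 0 := by simpa using hz
    have hinv : HasFDerivAt (fun z : ℂ => (conj z)⁻¹) (bel 0 (-(conj z ^ 2)⁻¹)) z := by
      have h1 := ((hasDerivAt_inv hcz).hasFDerivAt.restrictScalars ℝ).comp z
        ((Complex.conjCLE : ℂ →L[ℝ] ℂ).hasFDerivAt)
      convert! h1 using 1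
      ext v <;> simp <;> ring
    have h2 := (hfd (conj z)⁻¹).comp z hinv
    rw [bel_comp] at h2
    have h3 := ((Complex.conjCLE : ℂ →L[ℝ] ℂ).hasFDerivAt).comp z h2
    set w := (conj z)⁻¹ with hw
    have h4 : HasFDerivAt (fun z => conj (f (conj z)⁻¹)) (bel (-conj (a w) * (z ^ 2)⁻¹)
        ((-conj (a w) * (z ^ 2)⁻¹) * ν z)) z := by
      have e3 : ν z = conj (ν w) * (z / conj z) ^ 2 := (reflc_symm (μ := μ) hz).symm
      rw [e3]
      convert! h3 using 1
      ext v
      all_goals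
        simp only [ContinuousLinearMap.comp_apply, bel_apply, ContinuousLinearEquiv.coe_coe,
          Complex.conjCLE_apply, map_add, map_mul, map_neg, map_inv₀, map_pow, Complex.conj_conj,
          map_zero, mul_zero, zero_add, add_zero, map_one, conj_I]
        field_simp
        ring
    have h5 := hasFDerivAt_bel_mul (hfd z) h4
    refine ⟨f z * (-conj (a w) * (z ^ 2)⁻¹) + conj (f (conj z)⁻¹) * a z, ?_⟩
    convert! h5 using 1
    congr 1; ring
  have hg0 : g 0 = 0 := by have := hgf 0; rwa [hf0] at this
  have hgne : ∀ w ≠ 0, g w ≠ 0 := fun w hw h => hw (by rw [← hfg w, h, hf0])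
  have hPb : ∀ z ≠ 0, ‖P z‖ ≤ L * L := by
    intro z hz
    have h1 : ∀ x, ‖f x‖ ≤ L * ‖x‖ := fun x => by
      have := hL.norm_sub_le x 0; simpa [hf0] using this
    rw [hP, norm_mul, RCLike.norm_conj]
    have h2 := h1 z
    have h3 := h1 (conj z)⁻¹
    rw [norm_inv, RCLike.norm_conj] at h3
    calc ‖f z‖ * ‖f (conj z)⁻¹‖ ≤ (L * ‖z‖) * (L * ‖z‖⁻¹) := by gcongr
      _ = L * L := by have := norm_pos_iff.2 hz; field_simp
  have hQ := const_of_bdd (Q := P ∘ g) (fun w hw => by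
      obtain ⟨c, hc⟩ := hPd (g w) (hgne w hw)
      exact (holo_quot hc (hstrict _) (ha0 _) (hνlt _) hgc.continuousAt
        (Eventually.of_forall hfg)).differentiableAt) (C := L * L) (fun w hw => hPb _ (hgne w hw))
  have hfne : ∀ z ≠ 0, f z ≠ 0 := fun z hz h => hz (hbij.1 (h.trans hf0.symm))
  have hPc : ∀ z ≠ 0, P z = P 1 := by
    intro z hz
    have h1 := hQ (f z) (hfne z hz)
    have h2 := hQ (f 1) (hfne 1 one_ne_zero)
    simp only [Function.comp_apply, hgf] at h1 h2
    rw [h1, h2]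
  set ρ := ‖f 1‖ with hρ
  have hρ0 : 0 < ρ := norm_pos_iff.2 (hfne 1 one_ne_zero)
  have hP1 : P 1 = (ρ : ℂ) ^ 2 := by
    simp only [hP, map_one, inv_one]; rw [Complex.mul_conj, Complex.normSq_eq_norm_sq]; push_cast; rfl
  have hPn : ∀ z ≠ 0, ‖f z‖ * ‖f (conj z)⁻¹‖ = ρ ^ 2 := by
    intro z hz
    have := congrArg norm ((hPc z hz).trans hP1)
    simpa [hP, abs_of_pos hρ0] using this
  have hinv1 : ∀ z : ℂ, ‖z‖ = 1 → (conj z)⁻¹ = z := by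
    intro z hz
    have : z * conj z = 1 := by rw [Complex.mul_conj, Complex.normSq_eq_norm_sq, hz]; simp
    exact (eq_inv_of_mul_eq_one_left this).symm
  have hcirc : ∀ z, ‖z‖ = 1 → ‖f z‖ = ρ := by
    intro z hz
    have h1 := hPn z (by rintro rfl; simp at hz)
    rw [hinv1 z hz] at h1
    nlinarith [norm_nonneg (f z)]
  have hne : ∀ z, ‖z‖ < 1 → ‖f z‖ ≠ ρ := by
    intro z hz h
    have hz0 : z ≠ 0 := by rintro rfl; rw [hf0, norm_zero] at h; linarith
    have h1 := (hPc z hz0).trans hP1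
    have h2 : f z * conj (f z) = (ρ : ℂ) ^ 2 := by
      rw [Complex.mul_conj, Complex.normSq_eq_norm_sq, h]; push_cast; rfl
    have h3 : conj (f (conj z)⁻¹) = conj (f z) := mul_left_cancel₀ (hfne z hz0) (h1.trans h2.symm)
    have h4 : (conj z)⁻¹ = z := hbij.1 ((starRingEnd ℂ).injective h3)
    have h5 := congrArg norm h4
    rw [norm_inv, RCLike.norm_conj] at h5
    have := norm_pos_iff.2 hz0
    rw [inv_eq_iff_eq_inv] at h5
    have h6 : ‖z‖ * ‖z‖ = 1 := by nth_rw 1 [h5]; exact inv_mul_cancel₀ this.ne'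
    nlinarith
  have hin : ∀ z, ‖z‖ < 1 → ‖f z‖ < ρ := by
    intro z hz
    by_contra hcon
    have hpc : IsPreconnected (ball (0:ℂ) 1) := (convex_ball _ _).isPreconnected
    have := hpc.intermediate_value (mem_ball_self one_pos) (show z ∈ ball (0:ℂ) 1 by simpa using hz)
      (hf2.continuous.norm.continuousOn (s := ball (0:ℂ) 1))
    obtain ⟨x, hx, hx2⟩ := this ⟨(by simp [hf0, hρ0.le] : ‖f 0‖ ≤ ρ), not_lt.1 hcon⟩
    exact hne x (by simpa using hx) hx2
  have hout : ∀ z, 1 < ‖z‖ → ρ < ‖f z‖ := by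
    intro z hz
    have hz0 : z ≠ 0 := by rintro rfl; simp at hz; linarith
    have h1 := hPn z hz0
    have h2 := hin (conj z)⁻¹ (by rw [norm_inv, RCLike.norm_conj]; exact inv_lt_one_of_one_lt₀ hz)
    have h3 : 0 < ‖f (conj z)⁻¹‖ := norm_pos_iff.2 (hfne _ (by simpa using hz0))
    nlinarith
  have hρc : (ρ : ℂ) ≠ 0 := by exact_mod_cast hρ0.ne'
  have hn : ∀ z, ‖(ρ:ℂ)⁻¹ * f z‖ = ‖f z‖ / ρ := by
    intro z; rw [norm_mul, norm_inv, Complex.norm_real, Real.norm_of_nonneg hρ0.le]; ring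
  refine ⟨fun z => (ρ:ℂ)⁻¹ * f z, fun w => g (ρ * w), fun z => (ρ:ℂ)⁻¹ * a z, contDiff_const.mul hf2,
    hg2.comp (contDiff_const.mul contDiff_id), ?_, ?_, ?_, ?_, ?_, ?_, ?_, ?_⟩
  · intro z; simp only [mul_inv_cancel_left₀ hρc, hgf]
  · intro z; simp only [hfg, inv_mul_cancel_left₀ hρc]
  · intro z hz; rw [hn, div_lt_one hρ0]; exact hin z hz
  · intro z hz; rw [hn, hcirc z hz, div_self hρ0.ne']
  · intro z hz; rw [hn, one_lt_div hρ0]; exact hout z hz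
  · exact continuous_const.mul ha1.continuous
  · intro z; exact mul_ne_zero (inv_ne_zero hρc) (ha0 z)
  · intro z hz
    have : ν z = μ z := by simp only [hν, reflc_eq_zero hs hz, add_zero]
    have h1 := (hfd z).const_mul (ρ:ℂ)⁻¹
    rw [this] at h1
    convert! h1 using 1
    ext v <;> simp <;> ring

end

end

section
open Complex MeasureTheory Metric Set Filter
open scoped ContDiff Topology ComplexConjugate
set_option linter.unnecessarySeqFocus false

noncomputable section

/-- A smooth quasiconformal self-map of the closed disc, with its inverse. -/
structure DM (μ F G : ℂ → ℂ) : Prop where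
  fb : ∀ z, ‖z‖ < 1 → ‖F z‖ < 1
  fc : ∀ z, ‖z‖ ≤ 1 → ‖F z‖ ≤ 1
  gb : ∀ z, ‖z‖ < 1 → ‖G z‖ < 1
  gc : ∀ z, ‖z‖ ≤ 1 → ‖G z‖ ≤ 1
  gf : ∀ z, ‖z‖ ≤ 1 → G (F z) = z
  fg : ∀ z, ‖z‖ ≤ 1 → F (G z) = z
  fs : ∀ z, ‖z‖ ≤ 1 → ContDiffAt ℝ 2 F z
  gs : ∀ z, ‖z‖ ≤ 1 → ContDiffAt ℝ 2 G z
  der : ∀ z, ‖z‖ ≤ 1 → ∃ a, a ≠ 0 ∧ HasFDerivAt F (bel a (a * μ z)) z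

lemma DM.comp {μ F G M N : ℂ → ℂ} (h : DM μ F G) (m : DM 0 M N) :
    DM μ (fun z => M (F z)) (fun z => G (N z)) where
  fb z hz := m.fb _ (h.fb z hz)
  fc z hz := m.fc _ (h.fc z hz)
  gb z hz := h.gb _ (m.gb z hz)
  gc z hz := h.gc _ (m.gc z hz)
  gf z hz := by rw [m.gf _ (h.fc z hz), h.gf z hz]
  fg z hz := by rw [h.fg _ (m.gc z hz), m.fg z hz]
  fs z hz := (m.fs _ (h.fc z hz)).comp z (h.fs z hz)
  gs z hz := (h.gs _ (m.gc z hz)).comp z (m.gs z hz)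
  der z hz := by
    obtain ⟨a, ha, hd⟩ := h.der z hz
    obtain ⟨b, hb, hd'⟩ := m.der _ (h.fc z hz)
    refine ⟨b * a, mul_ne_zero hb ha, ?_⟩
    have := hd'.comp z hd
    rw [bel_comp] at this
    convert! this using 2 <;> simp
    ring

lemma DM.circ {μ F G : ℂ → ℂ} (h : DM μ F G) {z : ℂ} (hz : ‖z‖ = 1) : ‖F z‖ = 1 := by
  refine le_antisymm (h.fc z hz.le) ?_
  by_contra hc
  have := h.gb _ (not_le.1 hc)
  rw [h.gf z hz.le] at this
  linarith

lemma DM.circG {μ F G : ℂ → ℂ} (h : DM μ F G) {z : ℂ} (hz : ‖z‖ = 1) : ‖G z‖ = 1 := by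
  refine le_antisymm (h.gc z hz.le) ?_
  by_contra hc
  have := h.fb _ (not_le.1 hc)
  rw [h.fg z hz.le] at this
  linarith

lemma hasFDerivAt_bel_of_deriv {f : ℂ → ℂ} {a z : ℂ} (h : HasDerivAt f a z) :
    HasFDerivAt f (bel a (a * (0 : ℂ → ℂ) z)) z := by
  have := h.hasFDerivAt.restrictScalars ℝ
  convert! this using 1
  ext v <;> simp [mul_comm]

lemma DM_rot {c : ℂ} (hc : ‖c‖ = 1) : DM 0 (fun z => c * z) (fun z => c⁻¹ * z) := by
  have c0 : c ≠ 0 := by rintro rfl; simp at hc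
  refine ⟨fun z hz => ?_, fun z hz => ?_, fun z hz => ?_, fun z hz => ?_, fun z hz => ?_, fun z hz => ?_,
    fun z hz => ?_, fun z hz => ?_, fun z hz => ⟨c, c0, ?_⟩⟩
  · simpa [hc] using hz
  · simpa [hc] using hz
  · simpa [hc] using hz
  · simpa [hc] using hz
  · field_simp
  · field_simp
  · exact contDiffAt_const.mul contDiffAt_fun_id
  · exact contDiffAt_const.mul contDiffAt_fun_id
  · apply hasFDerivAt_bel_of_deriv
    simpa using (hasDerivAt_id z).const_mul c

def mobN (α δ : ℝ) (z : ℂ) : ℂ := α * I * (1 + z) + (δ - I) * (1 - z)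
def mobD (α δ : ℝ) (z : ℂ) : ℂ := α * I * (1 + z) + (δ + I) * (1 - z)
def mob (α δ : ℝ) (z : ℂ) : ℂ := mobN α δ z / mobD α δ z

lemma mob_id (α δ : ℝ) (z : ℂ) :
    ‖mobD α δ z‖ ^ 2 - ‖mobN α δ z‖ ^ 2 = 4 * α * (1 - ‖z‖ ^ 2) := by
  rw [← Complex.normSq_eq_norm_sq, ← Complex.normSq_eq_norm_sq, ← Complex.normSq_eq_norm_sq]
  simp only [mobD, mobN, Complex.normSq_apply]
  simp
  ring

lemma mobD_ne {α δ : ℝ} (hα : 0 < α) {z : ℂ} (hz : ‖z‖ ≤ 1) : mobD α δ z ≠ 0 := by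
  intro h
  have h1 := mob_id α δ z
  rw [h, norm_zero] at h1
  have h2 : 0 ≤ 4 * α * (1 - ‖z‖ ^ 2) := by
    have : ‖z‖ ^ 2 ≤ 1 := pow_le_one₀ (norm_nonneg _) hz
    have : 0 ≤ 1 - ‖z‖ ^ 2 := by linarith
    positivity
  have h3 : mobN α δ z = 0 := by
    rw [← norm_eq_zero]; nlinarith [norm_nonneg (mobN α δ z)]
  have h4 : mobD α δ z - mobN α δ z = 2 * I * (1 - z) := by simp only [mobD, mobN]; ring
  rw [h, h3] at h4
  have h5 : (1 - z) = 0 := by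
    have : 2 * I * (1 - z) = 0 := by rw [← h4]; ring
    simpa using this
  have h6 : z = 1 := by rw [sub_eq_zero] at h5; exact h5.symm
  rw [h6] at h
  simp [mobD, hα.ne'] at h
  
lemma mob_one {α : ℝ} (hα : 0 < α) (δ : ℝ) : mob α δ 1 = 1 := by
  have : mobN α δ 1 = mobD α δ 1 := by simp [mobN, mobD]
  rw [mob, this, div_self (mobD_ne hα (by simp))]

lemma mob_lt {α δ : ℝ} (hα : 0 < α) {z : ℂ} (hz : ‖z‖ < 1) : ‖mob α δ z‖ < 1 := by
  have hD := norm_pos_iff.2 (mobD_ne (δ := δ) hα hz.le)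
  rw [mob, norm_div, div_lt_one hD]
  have h1 := mob_id α δ z
  have : ‖z‖ ^ 2 < 1 := pow_lt_one₀ (norm_nonneg _) hz two_ne_zero
  have : 0 < 4 * α * (1 - ‖z‖ ^ 2) := by
    have : 0 < 1 - ‖z‖ ^ 2 := by linarith
    positivity
  exact lt_of_pow_lt_pow_left₀ 2 hD.le (by linarith)

lemma mob_le {α δ : ℝ} (hα : 0 < α) {z : ℂ} (hz : ‖z‖ ≤ 1) : ‖mob α δ z‖ ≤ 1 := by
  have hD := norm_pos_iff.2 (mobD_ne (δ := δ) hα hz)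
  rw [mob, norm_div, div_le_one hD]
  have h1 := mob_id α δ z
  have : ‖z‖ ^ 2 ≤ 1 := pow_le_one₀ (norm_nonneg _) hz
  have : 0 ≤ 4 * α * (1 - ‖z‖ ^ 2) := by
    have : 0 ≤ 1 - ‖z‖ ^ 2 := by linarith
    positivity
  exact le_of_pow_le_pow_left₀ two_ne_zero hD.le (by linarith)

lemma mob_inv {α δ : ℝ} (hα : 0 < α) {z : ℂ} (hz : ‖z‖ ≤ 1) :
    mob α⁻¹ (-δ / α) (mob α δ z) = z := by
  have hD := mobD_ne (δ := δ) hα hz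
  have hαc : (α : ℂ) ≠ 0 := by exact_mod_cast hα.ne'
  have h1 : mobN α⁻¹ (-δ / α) (mob α δ z) = -4 * z / mobD α δ z := by
    rw [eq_div_iff hD]
    simp only [mobN, mob]
    push_cast
    field_simp
    simp only [mobN, mobD]
    ring_nf
    simp only [I_sq, I_pow_three]
    ring
  have h2 : mobD α⁻¹ (-δ / α) (mob α δ z) = -4 / mobD α δ z := by
    rw [eq_div_iff hD]
    rw [mobD, mob]
    push_cast
    field_simp
    simp only [mobN, mobD]
    ring_nf
    simp only [I_sq, I_pow_three]
    ring
  rw [mob, h1, h2]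
  field_simp

lemma mob_der {α δ : ℝ} (hα : 0 < α) {z : ℂ} (hz : ‖z‖ ≤ 1) :
    HasDerivAt (mob α δ) (-4 * α / mobD α δ z ^ 2) z := by
  have hN : HasDerivAt (mobN α δ) (α * I - (δ - I)) z := by
    have := (((hasDerivAt_id z).const_add 1).const_mul (α * I : ℂ)).add
      (((hasDerivAt_id z).const_sub 1).const_mul (δ - I : ℂ))
    convert! this using 1
    simp; ring
  have hD : HasDerivAt (mobD α δ) (α * I - (δ + I)) z := by
    have := (((hasDerivAt_id z).const_add 1).const_mul (α * I : ℂ)).add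
      (((hasDerivAt_id z).const_sub 1).const_mul (δ + I : ℂ))
    convert! this using 1
    simp; ring
  have := hN.div hD (mobD_ne hα hz)
  convert! this using 1
  congr 1
  simp only [mobN, mobD]
  ring_nf
  simp only [I_sq]
  ring

lemma mob_contDiff {α δ : ℝ} (hα : 0 < α) {z : ℂ} (hz : ‖z‖ ≤ 1) :
    ContDiffAt ℝ 2 (mob α δ) z := by
  have hN : ContDiffAt ℂ 2 (mobN α δ) z := by unfold mobN; fun_prop
  have hD : ContDiffAt ℂ 2 (mobD α δ) z := by unfold mobD; fun_prop
  exact (hN.div hD (mobD_ne hα hz)).restrict_scalars ℝ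

lemma DM_mob {α δ : ℝ} (hα : 0 < α) : DM 0 (mob α δ) (mob α⁻¹ (-δ / α)) := by
  have hα' : 0 < α⁻¹ := inv_pos.2 hα
  refine ⟨fun z hz => mob_lt hα hz, fun z hz => mob_le hα hz, fun z hz => mob_lt hα' hz,
    fun z hz => mob_le hα' hz, fun z hz => mob_inv hα hz, fun z hz => ?_,
    fun z hz => mob_contDiff hα hz, fun z hz => mob_contDiff hα' hz, fun z hz =>
      ⟨-4 * α / mobD α δ z ^ 2, ?_, hasFDerivAt_bel_of_deriv (mob_der hα hz)⟩⟩
  · have := mob_inv (δ := -δ / α) hα' hz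
    have e : -(-δ / α) / α⁻¹ = δ := by field_simp
    rwa [inv_inv, e] at this
  · have hαc : (α : ℂ) ≠ 0 := by exact_mod_cast hα.ne'
    exact div_ne_zero (by simpa using hαc) (pow_ne_zero _ (mobD_ne hα hz))

lemma DM.orient {μ F G : ℂ → ℂ} (h : DM μ F G) (hμ : μ 1 = 0) (h1 : F 1 = 1) (hm : F (-1) = -1) :
    0 < (F I).im := by
  obtain ⟨a, ha, hd⟩ := h.der 1 (by simp)
  set c : ℝ → ℂ := fun θ => cexp (θ * I) with hc
  have hcn : ∀ θ, ‖c θ‖ = 1 := fun θ => Complex.norm_exp_ofReal_mul_I θ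
  have hFc : ∀ θ, ‖F (c θ)‖ = 1 := fun θ => h.circ (hcn θ)
  have c0 : c 0 = 1 := by simp [hc]
  have hcd : HasDerivAt c I 0 := by
    have := ((Complex.ofRealCLM.hasDerivAt (x := (0:ℝ))).mul_const I).cexp
    simpa [hc] using this
  have hFd : HasDerivAt (fun θ => F (c θ)) (a * I) 0 := by
    have hd' : HasFDerivAt F (bel a (a * μ 1)) (c 0) := by rw [c0]; exact hd
    have := hd'.comp_hasDerivAt (0:ℝ) hcd
    simpa [hμ, Function.comp_def] using this
  have hre := (Complex.reCLM.hasFDerivAt (x := F (c 0))).comp_hasDerivAt (0:ℝ) hFd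
  have him := (Complex.imCLM.hasFDerivAt (x := F (c 0))).comp_hasDerivAt (0:ℝ) hFd
  have hmax : IsLocalMax (Complex.reCLM ∘ fun θ => F (c θ)) 0 := by
    refine Eventually.of_forall fun θ => ?_
    simp only [Function.comp, Complex.reCLM_apply, c0, h1, one_re]
    exact (Complex.re_le_norm _).trans (hFc θ).le
  have him0 := hmax.hasDerivAt_eq_zero hre
  simp at him0
  -- radial derivative
  have hrad : HasDerivAt (fun t : ℝ => (F (t : ℂ)).re) a.re 1 := by
    have hd' : HasFDerivAt F (bel a (a * μ 1)) ((1:ℝ):ℂ) := by simpa using hd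
    have := hd'.comp_hasDerivAt (1:ℝ) (Complex.ofRealCLM.hasDerivAt (x := (1:ℝ)))
    have := (Complex.reCLM.hasFDerivAt (x := F ((1:ℝ):ℂ))).comp_hasDerivAt (1:ℝ) this
    simpa [hμ, Function.comp_def] using this
  have hre0 : 0 ≤ a.re := by
    have hs := (hasDerivAt_iff_tendsto_slope.1 hrad)
    have hs' := hs.mono_left (nhdsWithin_mono (1:ℝ) (show Iio (1:ℝ) ⊆ {1}ᶜ from fun t ht => (ne_of_lt ht)))
    refine ge_of_tendsto hs' ?_
    have : Ioo (-1:ℝ) 1 ∈ 𝓝[<] (1:ℝ) := Ioo_mem_nhdsLT (by norm_num)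
    filter_upwards [this] with t ht
    rw [slope_def_field]
    apply div_nonneg_of_nonpos
    · simp only [ofReal_one, h1, one_re]
      have := (Complex.re_le_norm (F t)).trans (h.fc t (by simp [abs_le]; constructor <;> linarith [ht.1, ht.2]))
      linarith
    · linarith [ht.2]
  have hpos : 0 < a.re := by
    refine lt_of_le_of_ne hre0 fun h0 => ha ?_
    apply Complex.ext <;> simp [him0, ← h0]
  have himd : (Complex.imCLM (a * I)) = a.re := by simp
  rw [himd] at him
  have hev : ∀ᶠ θ in 𝓝[>] (0:ℝ), 0 < (F (c θ)).im := by
    have hs := (hasDerivAt_iff_tendsto_slope.1 him)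
    have hs' := hs.mono_left (nhdsWithin_mono (0:ℝ) (show Ioi (0:ℝ) ⊆ {0}ᶜ from fun t ht => (ne_of_gt ht)))
    filter_upwards [hs'.eventually (lt_mem_nhds hpos), self_mem_nhdsWithin] with θ hθ hθ0
    rw [slope_def_field] at hθ
    simp only [Function.comp, Complex.imCLM_apply, c0, h1, one_im, sub_zero] at hθ
    have : (F (c θ)).im = (F (c θ)).im / θ * θ := by
      have h9 : θ ≠ 0 := ne_of_gt (mem_Ioi.1 hθ0)
      field_simp
    rw [this]; exact mul_pos hθ hθ0
  have : Ioo (0:ℝ) (Real.pi/2) ∈ 𝓝[>] (0:ℝ) := Ioo_mem_nhdsGT (by positivity)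
  obtain ⟨θ₀, hθ₀, hθm⟩ := (hev.and this).exists
  by_contra hcon
  have hI : c (Real.pi / 2) = I := by
    simp only [hc]; push_cast; exact Complex.exp_pi_div_two_mul_I
  have hcont : ContinuousOn (fun θ => (F (c θ)).im) (Icc θ₀ (Real.pi/2)) := by
    intro θ _
    have h2 : ContinuousAt F (c θ) := (h.fs _ (hcn θ).le).continuousAt
    have h3 : ContinuousAt c θ := by simp only [hc]; fun_prop
    have h4 : ContinuousAt (fun θ => F (c θ)) θ := ContinuousAt.comp (f := c) (g := F) h2 h3
    exact (Complex.continuous_im.continuousAt.comp h4).continuousWithinAt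
  obtain ⟨θ, hθ, hθ0⟩ := intermediate_value_Icc' hθm.2.le hcont
    (show (0:ℝ) ∈ Icc _ _ from ⟨by rw [hI]; exact not_lt.1 hcon, hθ₀.le⟩)
  have hθ0' : (F (c θ)).im = 0 := hθ0
  have hsin : 0 < (c θ).im := by
    simp only [hc, Complex.exp_ofReal_mul_I_im]
    exact Real.sin_pos_of_pos_of_lt_pi (by linarith [hθ.1, hθm.1]) (by linarith [hθ.2, Real.pi_pos])
  have hn : (F (c θ)).re ^ 2 = 1 := by
    have := hFc θ
    have h5 : Complex.normSq (F (c θ)) = 1 := by rw [Complex.normSq_eq_norm_sq, this]; norm_num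
    rw [Complex.normSq_apply, hθ0'] at h5; nlinarith
  rcases sq_eq_one_iff.1 hn with h6 | h6
  · have : F (c θ) = F 1 := by rw [h1]; apply Complex.ext <;> simp [h6, hθ0']
    have := congrArg G this
    rw [h.gf _ (hcn θ).le, h.gf 1 (by simp)] at this
    rw [this] at hsin; simp at hsin
  · have : F (c θ) = F (-1) := by rw [hm]; apply Complex.ext <;> simp [h6, hθ0']
    have := congrArg G this
    rw [h.gf _ (hcn θ).le, h.gf (-1) (by simp)] at this
    rw [this] at hsin; simp at hsin


lemma circ_re {z : ℂ} (hz : ‖z‖ = 1) : z.re ^ 2 + z.im ^ 2 = 1 := by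
  have h5 : Complex.normSq z = 1 := by rw [Complex.normSq_eq_norm_sq, hz]; norm_num
  rw [Complex.normSq_apply] at h5; linarith

lemma circ_re_lt {z : ℂ} (hz : ‖z‖ = 1) (h1 : z ≠ 1) : z.re < 1 := by
  have h := circ_re hz
  have : z.re ≤ 1 := (Complex.re_le_norm _).trans hz.le
  refine lt_of_le_of_ne this fun h2 => h1 ?_
  rw [h2] at h
  have : z.im = 0 := by nlinarith
  apply Complex.ext <;> simp [h2, this]

lemma mob_neg_one {z : ℂ} (hz : ‖z‖ = 1) (h1 : z ≠ 1) :
    mob 1 (z.im / (1 - z.re)) z = -1 := by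
  have hD := mobD_ne (α := 1) (δ := z.im / (1 - z.re)) one_pos hz.le
  have h2 := circ_re_lt hz h1
  have h3 := circ_re hz
  have h4 : 1 - z.re ≠ 0 := by linarith
  have ht : z.im / (1 - z.re) * (1 - z.re) = z.im := by field_simp
  generalize z.im / (1 - z.re) = t at *
  have ht2 : t * z.im = 1 + z.re := by
    apply mul_right_cancel₀ h4
    linear_combination z.im * ht + h3
  rw [mob, div_eq_iff hD]
  apply Complex.ext
  · simp [mobN, mobD]; linarith
  · simp [mobN, mobD]; linarith

lemma mob_I {z : ℂ} (hz : ‖z‖ = 1) (h1 : 0 < z.im) :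
    mob ((1 - z.re) / z.im) 0 z = I := by
  have hz1 : z ≠ 1 := by rintro rfl; simp at h1
  have h2 := circ_re_lt hz hz1
  have hD := mobD_ne (α := (1 - z.re) / z.im) (δ := 0) (by apply div_pos <;> linarith) hz.le
  have h3 := circ_re hz
  have h4 : 1 - z.re ≠ 0 := by linarith
  rw [mob, div_eq_iff hD]
  apply Complex.ext
  · simp [mobN, mobD]; field_simp; ring_nf; try nlinarith
  · simp [mobN, mobD]; field_simp; ring_nf; try nlinarith

lemma mob_zero_neg_one {α : ℝ} (hα : 0 < α) : mob α 0 (-1) = -1 := by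
  have hD := mobD_ne (α := α) (δ := 0) hα (z := -1) (by simp)
  rw [mob, div_eq_iff hD]
  simp [mobN, mobD]

/-- Normalised smooth solution. -/
structure Nice (μ F G : ℂ → ℂ) : Prop extends DM μ F G where
  f1 : F 1 = 1
  fm : F (-1) = -1
  fI : F I = I

lemma exists_nice {μ : ℂ → ℂ} (hμ : Test μ) (hs : tsupport μ ⊆ ball 0 1) (h0 : 0 ∉ tsupport μ)
    {k : ℝ} (hk0 : 0 ≤ k) (hk : k < 1) (hb : ∀ z, ‖μ z‖ ≤ k) : ∃ F G, Nice μ F G := by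
  obtain ⟨F, G, a, hF, hG, hGF, hFG, hin, hcirc, hout, hac, ha0, hd⟩ := exists_disc hμ hs h0 hk0 hk hb
  have hcl : ∀ z, ‖z‖ ≤ 1 → ‖F z‖ ≤ 1 := fun z hz => by
    rcases hz.lt_or_eq with h | h
    · exact (hin z h).le
    · exact (hcirc z h).le
  have d0 : DM μ F G := by
    refine ⟨hin, hcl, fun z hz => ?_, fun z hz => ?_, fun z _ => hGF z, fun z _ => hFG z,
      fun z _ => hF.contDiffAt, fun z _ => hG.contDiffAt, fun z hz => ⟨a z, ha0 z, hd z hz⟩⟩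
    · by_contra hcon
      rcases (not_lt.1 hcon).lt_or_eq with h | h
      · have := hout _ h; rw [hFG] at this; linarith
      · have := hcirc _ h.symm; rw [hFG] at this; linarith
    · by_contra hcon
      have := hout _ (not_le.1 hcon); rw [hFG] at this; linarith
  have hμ1 : μ 1 = 0 := by
    apply image_eq_zero_of_notMem_tsupport
    intro h; have := hs h; simp at this
  have inj : ∀ {F G : ℂ → ℂ}, DM μ F G → F 1 = 1 → F (-1) ≠ 1 := by
    intro F G d h1 h
    have := congrArg G (h.trans h1.symm)
    rw [d.gf _ (by simp), d.gf _ (by simp)] at this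
    norm_num at this
  have hF1 : ‖F 1‖ = 1 := hcirc 1 (by simp)
  have hF10 : F 1 ≠ 0 := by intro h; rw [h] at hF1; simp at hF1
  have d1 := d0.comp (DM_rot (c := (F 1)⁻¹) (by rw [norm_inv, hF1, inv_one]))
  set F1 : ℂ → ℂ := fun z => (F 1)⁻¹ * F z with hF1d
  have e1 : F1 1 = 1 := inv_mul_cancel₀ hF10
  have n1 : ‖F1 (-1)‖ = 1 := d1.circ (by simp)
  set δ := (F1 (-1)).im / (1 - (F1 (-1)).re) with hδ
  have d2 := d1.comp (DM_mob (α := 1) (δ := δ) one_pos)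
  set F2 : ℂ → ℂ := fun z => mob 1 δ (F1 z) with hF2
  have e2 : F2 1 = 1 := by simp only [hF2, e1]; exact mob_one one_pos _
  have e2' : F2 (-1) = -1 := mob_neg_one n1 (inj d1 e1)
  have him := d2.orient hμ1 e2 e2'
  have n2 : ‖F2 I‖ = 1 := d2.circ (by simp)
  set α := (1 - (F2 I).re) / (F2 I).im with hα
  have hα0 : 0 < α := by
    apply div_pos _ him
    have := circ_re_lt n2 (fun h => by rw [h] at him; simp at him)
    linarith
  have d3 := d2.comp (DM_mob (α := α) (δ := 0) hα0)
  exact ⟨_, _, d3, by simp only [e2]; exact mob_one hα0 0,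
    by simp only [e2']; exact mob_zero_neg_one hα0, mob_I n2 him⟩

end

end

section
open Complex MeasureTheory Metric Set Filter
open scoped ContDiff Topology ComplexConjugate
set_option linter.unnecessarySeqFocus false

noncomputable section

lemma osc_le {v v' : ℝ → ℂ} {a b M : ℝ} (hab : a ≤ b) (hba : b - a ≤ 2 * Real.pi)
    (hd : ∀ x ∈ Icc a b, HasDerivAt v (v' x) x) (hc : ContinuousOn v' (Icc a b)) (hM : 0 < M)
    (hi : ∫ x in a..b, ‖v' x‖ ^ 2 ≤ M) : ‖v b - v a‖ ≤ Real.sqrt M * ((1 + 2 * Real.pi) / 2) := by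
  rw [← uIcc_of_le hab] at hd hc
  have h1 := intervalIntegral.integral_eq_sub_of_hasDerivAt hd hc.intervalIntegrable
  rw [← h1]
  set s := Real.sqrt M with hs
  have hs0 : 0 < s := Real.sqrt_pos.2 hM
  have hss : s * s = M := Real.mul_self_sqrt hM.le
  have hn2 : IntervalIntegrable (fun x => ‖v' x‖ ^ 2) volume a b := (hc.norm.pow 2).intervalIntegrable
  calc ‖∫ x in a..b, v' x‖ ≤ ∫ x in a..b, ‖v' x‖ :=
        intervalIntegral.norm_integral_le_integral_norm hab
    _ ≤ ∫ x in a..b, ((2 * s)⁻¹ * ‖v' x‖ ^ 2 + s / 2) := by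
        apply intervalIntegral.integral_mono_on hab hc.norm.intervalIntegrable
        · exact (hn2.const_mul _).add intervalIntegrable_const
        · intro x _
          have : (2 * s)⁻¹ * ‖v' x‖ ^ 2 + s / 2 - ‖v' x‖ = (2 * s)⁻¹ * (‖v' x‖ - s) ^ 2 := by
            field_simp; ring
          have h3 : 0 ≤ (2 * s)⁻¹ * (‖v' x‖ - s) ^ 2 := by positivity
          linarith
    _ = (2 * s)⁻¹ * (∫ x in a..b, ‖v' x‖ ^ 2) + s / 2 * (b - a) := by
        rw [intervalIntegral.integral_add (hn2.const_mul _) intervalIntegrable_const,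
          intervalIntegral.integral_const_mul, intervalIntegral.integral_const]
        simp; ring
    _ ≤ (2 * s)⁻¹ * M + s / 2 * (2 * Real.pi) := by gcongr
    _ = s * ((1 + 2 * Real.pi) / 2) := by rw [← hss]; field_simp

lemma exists_unit (z : ℂ) : ∃ e : ℂ, ‖e‖ = 1 ∧ z = ‖z‖ * e := by
  by_cases h : z = 0
  · exact ⟨1, by simp, by simp [h]⟩
  · have : (‖z‖ : ℂ) ≠ 0 := by simpa using h
    refine ⟨z / ‖z‖, by simp [h], by field_simp⟩

lemma mp_rot {e : ℂ} (he : ‖e‖ = 1) (z0 : ℂ) :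
    MeasurePreserving (fun p : ℂ => z0 - e * p) volume volume := by
  have h1 : MeasurePreserving (fun p : ℂ => e * p) volume volume :=
    (rotation ⟨e, by rw [Submonoid.unitSphere]; simpa using he⟩).measurePreserving
  exact (Measure.measurePreserving_sub_left volume z0).comp h1

lemma polar_radius {u : ℂ → ENNReal} (hu : Measurable u) {A : ℝ} (hA : 0 < A)
    (hE : ∫⁻ z, u z ≤ ENNReal.ofReal A) {δ : ℝ} (hδ : 0 < δ) (hδ1 : δ < 1) :
    ∃ r ∈ Ioo δ (Real.sqrt δ), ENNReal.ofReal (r ^ 2) *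
      ∫⁻ θ in Ioo (-Real.pi) Real.pi, u (Complex.polarCoord.symm (r, θ)) ≤
        ENNReal.ofReal (4 * A / Real.log δ⁻¹) := by
  by_contra! hcon
  have hlog : 0 < Real.log δ⁻¹ := Real.log_pos ((one_lt_inv₀ hδ).2 hδ1)
  have hsq : δ < Real.sqrt δ := by
    apply Real.lt_sqrt_of_sq_lt; nlinarith
  rw [← Complex.lintegral_comp_polarCoord_symm] at hE
  have hmeas : Measurable fun p : ℝ × ℝ => ENNReal.ofReal p.1 • u (Complex.polarCoord.symm p) := by
    have : Measurable fun p : ℝ × ℝ => Complex.polarCoord.symm p := by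
      simp only [Complex.polarCoord_symm_apply]; fun_prop
    exact (ENNReal.measurable_ofReal.comp measurable_fst).smul (hu.comp this)
  have hE2 : ∫⁻ r in Ioo δ (Real.sqrt δ), ∫⁻ θ in Ioo (-Real.pi) Real.pi,
      ENNReal.ofReal r • u (Complex.polarCoord.symm (r, θ)) ≤ ENNReal.ofReal A := by
    refine le_trans ?_ hE
    rw [polarCoord_target, Measure.volume_eq_prod, ← Measure.prod_restrict,
      lintegral_prod _ hmeas.aemeasurable]
    exact lintegral_mono' (Measure.restrict_mono (fun r hr => hδ.trans hr.1) le_rfl) le_rfl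
  have hlow : ∫⁻ r in Ioo δ (Real.sqrt δ), ENNReal.ofReal (4 * A / Real.log δ⁻¹ * r⁻¹) ≤
      ENNReal.ofReal A := by
    refine le_trans (setLIntegral_mono' measurableSet_Ioo fun r hr => ?_) hE2
    have hr0 : 0 < r := hδ.trans hr.1
    have h := (hcon r hr).le
    simp only [smul_eq_mul]
    rw [lintegral_const_mul]
    · have h2 : ENNReal.ofReal r = ENNReal.ofReal (r⁻¹) * ENNReal.ofReal (r ^ 2) := by
        rw [← ENNReal.ofReal_mul (by positivity)]; congr 1; field_simp
      rw [h2, mul_assoc, mul_comm (4 * A / _), ENNReal.ofReal_mul (by positivity)]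
      gcongr
    · have : Measurable fun θ : ℝ => Complex.polarCoord.symm (r, θ) := by
        simp only [Complex.polarCoord_symm_apply]; fun_prop
      exact hu.comp this
  have hInt0 : ∫ r in δ..Real.sqrt δ, 4 * A / Real.log δ⁻¹ * r⁻¹ = 2 * A := by
    rw [intervalIntegral.integral_const_mul, integral_inv_of_pos hδ (hδ.trans hsq)]
    have : Real.log (Real.sqrt δ / δ) = Real.log δ⁻¹ / 2 := by
      rw [Real.log_div (hδ.trans hsq).ne' hδ.ne', Real.log_sqrt hδ.le, Real.log_inv]; ring
    rw [this]; generalize Real.log δ⁻¹ = l at *; field_simp; ring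
  rw [← ofReal_integral_eq_lintegral_ofReal] at hlow
  · rw [← integral_Ioc_eq_integral_Ioo, ← intervalIntegral.integral_of_le hsq.le, hInt0] at hlow
    rw [ENNReal.ofReal_le_ofReal_iff hA.le] at hlow
    linarith
  · have : ContinuousOn (fun r : ℝ => 4 * A / Real.log δ⁻¹ * r⁻¹) (Icc δ (Real.sqrt δ)) := by
      apply continuousOn_const.mul
      exact continuousOn_id.inv₀ (fun x hx => (hδ.trans_le hx.1).ne')
    exact (this.integrableOn_Icc).mono_set Ioo_subset_Icc_self
  · refine (ae_restrict_iff' measurableSet_Ioo).2 (Eventually.of_forall fun r hr => ?_)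
    have : 0 < r := hδ.trans hr.1
    simp only [Pi.zero_apply]; positivity

lemma cos_between {a b θ : ℝ} (ha : -Real.pi ≤ a) (hb : b ≤ Real.pi) (h1 : a ≤ θ) (h2 : θ ≤ b) :
    Real.cos a ≤ Real.cos θ ∨ Real.cos b ≤ Real.cos θ := by
  rcases le_total 0 θ with h | h
  · right; exact Real.cos_le_cos_of_nonneg_of_le_pi h hb h2
  · left
    rw [← Real.cos_neg a, ← Real.cos_neg θ]
    exact Real.cos_le_cos_of_nonneg_of_le_pi (by linarith) (by linarith) (by linarith)

lemma normsq_arc {t r θ : ℝ} {e : ℂ} (he : ‖e‖ = 1) :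
    ‖(t:ℂ) * e - e * (r * cexp (θ * I))‖ ^ 2 = t ^ 2 + r ^ 2 - 2 * t * r * Real.cos θ := by
  have : (t:ℂ) * e - e * (r * cexp (θ * I)) = e * (t - r * cexp (θ * I)) := by ring
  rw [this, norm_mul, he, one_mul, ← Complex.normSq_eq_norm_sq, Complex.normSq_apply]
  simp [Complex.exp_ofReal_mul_I_re, Complex.exp_ofReal_mul_I_im]
  nlinarith [Real.sin_sq_add_cos_sq θ]

lemma courant {φ : ℂ → ℂ} (hs : ∀ z, ‖z‖ ≤ 1 → ContDiffAt ℝ 1 φ z) {A : ℝ} (hA : 0 < A)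
    (hE : ∫⁻ z in closedBall 0 1, ENNReal.ofReal (‖fderiv ℝ φ z‖ ^ 2) ≤ ENNReal.ofReal A)
    {z0 : ℂ} {δ : ℝ} (hδ : 0 < δ) (hδ1 : δ < 1) :
    ∃ r ∈ Ioo δ (Real.sqrt δ), ∀ x y, ‖x‖ ≤ 1 → ‖y‖ ≤ 1 → ‖x - z0‖ = r → ‖y - z0‖ = r →
      ‖φ x - φ y‖ ≤ Real.sqrt (4 * A / Real.log δ⁻¹) * ((1 + 2 * Real.pi) / 2) := by
  obtain ⟨e, he, hz0⟩ := exists_unit z0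
  have e0 : e ≠ 0 := by rintro rfl; simp at he
  set t := ‖z0‖ with ht
  have ht0 : 0 ≤ t := norm_nonneg _
  set T : ℂ → ℂ := fun p => z0 - e * p with hT
  set U : ℂ → ENNReal := (closedBall (0:ℂ) 1).indicator
    fun z => ENNReal.ofReal (‖fderiv ℝ φ z‖ ^ 2) with hU
  have hUm : Measurable U := by
    apply Measurable.indicator _ measurableSet_closedBall
    exact ENNReal.measurable_ofReal.comp ((measurable_fderiv ℝ φ).norm.pow_const 2)
  have hUE : ∫⁻ p, U (T p) ≤ ENNReal.ofReal A := by
    rw [(mp_rot he z0).lintegral_comp hUm, hU, lintegral_indicator measurableSet_closedBall]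
    exact hE
  obtain ⟨r, hr, hrE⟩ := polar_radius (hUm.comp (mp_rot he z0).measurable) hA hUE hδ hδ1
  refine ⟨r, hr, ?_⟩
  have hr0 : 0 < r := hδ.trans hr.1
  have hlog : 0 < Real.log δ⁻¹ := Real.log_pos ((one_lt_inv₀ hδ).2 hδ1)
  set M := 4 * A / Real.log δ⁻¹ with hM
  have hM0 : 0 < M := by positivity
  set p : ℝ → ℂ := fun θ => T (r * cexp (θ * I)) with hp
  have hpol : ∀ θ, Complex.polarCoord.symm (r, θ) = r * cexp (θ * I) := by
    intro θ; rw [Complex.polarCoord_symm_apply, Complex.exp_mul_I]; push_cast; ring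
  have hpn : ∀ θ, ‖p θ‖ ^ 2 = t ^ 2 + r ^ 2 - 2 * t * r * Real.cos θ := by
    intro θ; rw [← normsq_arc he]; simp only [hp, hT]; rw [← hz0]
  have main : ∀ a b, -Real.pi ≤ a → b ≤ Real.pi → a ≤ b → ‖p a‖ ≤ 1 → ‖p b‖ ≤ 1 →
      ‖φ (p b) - φ (p a)‖ ≤ Real.sqrt M * ((1 + 2 * Real.pi) / 2) := by
    intro a b ha hb hab hpa hpb
    have hin : ∀ θ ∈ Icc a b, ‖p θ‖ ≤ 1 := by
      intro θ hθ
      have h2 : ∀ θ, ‖p θ‖ ≤ 1 ↔ t ^ 2 + r ^ 2 - 2 * t * r * Real.cos θ ≤ 1 := by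
        intro θ; rw [← hpn θ, sq_le_one_iff₀ (norm_nonneg _)]
      rw [h2] at *
      have htr : 0 ≤ 2 * t * r := by positivity
      rcases cos_between ha hb hθ.1 hθ.2 with h | h
      · nlinarith [mul_le_mul_of_nonneg_left h htr]
      · nlinarith [mul_le_mul_of_nonneg_left h htr]
    have hpd : ∀ θ : ℝ, HasDerivAt p (-(e * (r * (cexp (θ * I) * I)))) θ := by
      intro θ
      have h1 := (((Complex.ofRealCLM.hasDerivAt (x := θ)).mul_const I).cexp.const_mul (r:ℂ))
      have h2 := (h1.const_mul e).const_sub z0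
      simpa using h2
    have hpc : Continuous p := by
      simp only [hp, hT]; fun_prop
    have hfc : ContinuousOn (fun θ => fderiv ℝ φ (p θ)) (Icc a b) := by
      intro θ hθ
      have h1 : ContinuousAt (fderiv ℝ φ) (p θ) :=
        ((hs _ (hin θ hθ)).fderiv_right (m := 0) (by simp)).continuousAt
      exact (ContinuousAt.comp (f := p) (g := fderiv ℝ φ) h1 hpc.continuousAt).continuousWithinAt
    set v' : ℝ → ℂ := fun θ => fderiv ℝ φ (p θ) (-(e * (r * (cexp (θ * I) * I)))) with hv'
    have hv'c : ContinuousOn v' (Icc a b) := by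
      apply hfc.clm_apply
      fun_prop
    have hv'n : ∀ θ, ‖v' θ‖ ≤ r * ‖fderiv ℝ φ (p θ)‖ := by
      intro θ
      refine (ContinuousLinearMap.le_opNorm _ _).trans ?_
      rw [norm_neg, norm_mul, norm_mul, norm_mul, he, Complex.norm_exp_ofReal_mul_I,
        Complex.norm_real, Real.norm_of_nonneg hr0.le]
      simp [mul_comm]
    refine osc_le hab (by linarith) (v := fun θ => φ (p θ)) (v' := v') ?_ hv'c hM0 ?_
    · intro θ hθ
      have h1 : HasFDerivAt φ (fderiv ℝ φ (p θ)) (p θ) :=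
        ((hs _ (hin θ hθ)).differentiableAt (by simp)).hasFDerivAt
      exact h1.comp_hasDerivAt θ (hpd θ)
    · rw [intervalIntegral.integral_of_le hab, integral_Ioc_eq_integral_Ioo]
      rw [← ENNReal.ofReal_le_ofReal_iff hM0.le, ofReal_integral_eq_lintegral_ofReal]
      · refine le_trans ?_ hrE
        rw [← lintegral_const_mul]
        · refine le_trans (setLIntegral_mono' measurableSet_Ioo fun θ hθ => ?_)
            (lintegral_mono' (Measure.restrict_mono (s := Ioo a b)
              (Ioo_subset_Ioo ha hb) le_rfl) le_rfl)
          have h4 : p θ ∈ closedBall (0:ℂ) 1 := by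
            simpa using hin θ ⟨hθ.1.le, hθ.2.le⟩
          have h5 : U (T (Complex.polarCoord.symm (r, θ))) =
              ENNReal.ofReal (‖fderiv ℝ φ (p θ)‖ ^ 2) := by
            rw [hpol]; exact indicator_of_mem h4 _
          change _ ≤ ENNReal.ofReal (r ^ 2) * U (T (Complex.polarCoord.symm (r, θ)))
          rw [h5, ← ENNReal.ofReal_mul (by positivity), ← mul_pow]
          exact ENNReal.ofReal_le_ofReal (pow_le_pow_left₀ (norm_nonneg _) (hv'n θ) 2)
        · have : Measurable fun θ : ℝ => Complex.polarCoord.symm (r, θ) := by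
            simp only [Complex.polarCoord_symm_apply]; fun_prop
          exact (hUm.comp (mp_rot he z0).measurable).comp this
      · exact ((hv'c.norm.pow 2).integrableOn_Icc).mono_set Ioo_subset_Icc_self
      · exact Eventually.of_forall fun θ => by simp only [Pi.zero_apply]; positivity
  have hpar : ∀ x, ‖x - z0‖ = r → ∃ θ, -Real.pi ≤ θ ∧ θ ≤ Real.pi ∧ x = p θ := by
    intro x hx
    refine ⟨Complex.arg ((z0 - x) / e), (Complex.neg_pi_lt_arg _).le, Complex.arg_le_pi _, ?_⟩
    have h1 : ‖(z0 - x) / e‖ = r := by rw [norm_div, he, div_one, norm_sub_rev, hx]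
    have h2 := Complex.norm_mul_exp_arg_mul_I ((z0 - x) / e)
    rw [h1] at h2
    simp only [hp, hT, h2]
    field_simp; ring
  intro x y hx hy hxr hyr
  obtain ⟨a, ha1, ha2, rfl⟩ := hpar x hxr
  obtain ⟨b, hb1, hb2, rfl⟩ := hpar y hyr
  rcases le_total a b with h | h
  · rw [norm_sub_rev]; exact main a b ha1 hb2 h hx hy
  · exact main b a hb1 ha2 h hy hx

end

end

section
open Complex MeasureTheory Metric Set Filter
open scoped ContDiff Topology ComplexConjugate
set_option linter.unnecessarySeqFocus false

noncomputable section

lemma energy {φ : ℂ → ℂ} {K : ℝ} (hK : 0 ≤ K) (hd : ∀ z, ‖z‖ < 1 → DifferentiableAt ℝ φ z)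
    (hb : ∀ z, ‖z‖ < 1 → ‖φ z‖ < 1) (hinj : InjOn φ (ball 0 1))
    (hdist : ∀ z, ‖z‖ < 1 → ‖fderiv ℝ φ z‖ ^ 2 ≤ K * |(fderiv ℝ φ z).det|) :
    ∫⁻ z in closedBall 0 1, ENNReal.ofReal (‖fderiv ℝ φ z‖ ^ 2) ≤ ENNReal.ofReal (K * Real.pi) := by
  have hae : (closedBall (0:ℂ) 1 : Set ℂ) =ᵐ[volume] ball 0 1 := by
    have h := Measure.addHaar_sphere (volume : Measure ℂ) 0 1
    rw [← ball_union_sphere]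
    exact union_ae_eq_left_of_ae_eq_empty (ae_eq_empty.2 h)
  rw [setLIntegral_congr hae]
  calc ∫⁻ z in ball 0 1, ENNReal.ofReal (‖fderiv ℝ φ z‖ ^ 2)
      ≤ ∫⁻ z in ball 0 1, ENNReal.ofReal K * ENNReal.ofReal |(fderiv ℝ φ z).det| := by
        refine setLIntegral_mono' measurableSet_ball fun z hz => ?_
        rw [← ENNReal.ofReal_mul hK]
        exact ENNReal.ofReal_le_ofReal (hdist z (by simpa using hz))
    _ = ENNReal.ofReal K * volume (φ '' ball 0 1) := by
        rw [lintegral_const_mul' _ _ ENNReal.ofReal_ne_top]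
        rw [lintegral_abs_det_fderiv_eq_addHaar_image volume measurableSet_ball
          (fun z hz => (hd z (by simpa using hz)).hasFDerivAt.hasFDerivWithinAt) hinj]
    _ ≤ ENNReal.ofReal K * volume (ball (0:ℂ) 1) := by
        gcongr
        rintro _ ⟨z, hz, rfl⟩
        simpa using hb z (by simpa using hz)
    _ = ENNReal.ofReal (K * Real.pi) := by
        rw [Complex.volume_ball, ENNReal.ofReal_mul hK]
        simp
        congr 1
        rw [ENNReal.ofReal_eq_coe_nnreal Real.pi_pos.le]; rfl

lemma dist_bel {a b : ℂ} {k : ℝ} (hk0 : 0 ≤ k) (hk : k < 1) (hb : ‖b‖ ≤ k) :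
    ‖bel a (a * b)‖ ^ 2 ≤ (1 + k) / (1 - k) * |(bel a (a * b)).det| := by
  rw [det_bel]
  have h1 := norm_bel_le a (a * b)
  have h2 : ‖bel a (a * b)‖ ^ 2 ≤ (‖a‖ + ‖a * b‖) ^ 2 := pow_le_pow_left₀ (norm_nonneg _) h1 2
  refine h2.trans ((?_ : _ ≤ (1 + k) / (1 - k) * (‖a‖ ^ 2 - ‖a * b‖ ^ 2)).trans
    (mul_le_mul_of_nonneg_left (le_abs_self _) (div_nonneg (by linarith) (by linarith))))
  rw [norm_mul, div_mul_eq_mul_div, le_div_iff₀ (by linarith)]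
  have h3 : 0 ≤ ‖a‖ ^ 2 * (1 + ‖b‖) * (k - ‖b‖) := by
    have : 0 ≤ k - ‖b‖ := by linarith
    positivity
  nlinarith

lemma dist_bel_inv {a b : ℂ} {k : ℝ} (ha : a ≠ 0) (hk0 : 0 ≤ k) (hk : k < 1) (hb : ‖b‖ ≤ k) {L : ℂ →L[ℝ] ℂ}
    (hL : (bel a (a * b)).comp L = ContinuousLinearMap.id ℝ ℂ) :
    ‖L‖ ^ 2 ≤ (1 + k) / (1 - k) * |L.det| := by
  have han := norm_pos_iff.2 ha
  have hpos : 0 < ‖a‖ - ‖a * b‖ := by rw [norm_mul]; nlinarith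
  have h1 : ‖L‖ ≤ (‖a‖ - ‖a * b‖)⁻¹ := by
    refine ContinuousLinearMap.opNorm_le_bound _ (by positivity) fun v => ?_
    have h2 := norm_bel_apply_ge a (a * b) (L v)
    have h3 : bel a (a * b) (L v) = v := by
      have := congrArg (fun T : ℂ →L[ℝ] ℂ => T v) hL; simpa using this
    rw [h3] at h2
    rw [inv_mul_eq_div, le_div_iff₀ hpos]; linarith
  have h2 : (‖a‖ ^ 2 - ‖a * b‖ ^ 2) * L.det = 1 := by
    rw [← det_bel]
    have := congrArg (fun T : ℂ →L[ℝ] ℂ => LinearMap.det (T : ℂ →ₗ[ℝ] ℂ)) hL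
    simp only [ContinuousLinearMap.toLinearMap_comp, LinearMap.det_comp] at this
    refine this.trans ?_
    simp
  have hJ : 0 < ‖a‖ ^ 2 - ‖a * b‖ ^ 2 := by
    have : ‖a‖ ^ 2 - ‖a * b‖ ^ 2 = (‖a‖ - ‖a * b‖) * (‖a‖ + ‖a * b‖) := by ring
    rw [this]; positivity
  have h3 : L.det = (‖a‖ ^ 2 - ‖a * b‖ ^ 2)⁻¹ := eq_inv_of_mul_eq_one_right h2
  rw [h3, abs_of_pos (inv_pos.2 hJ)]
  refine (pow_le_pow_left₀ (norm_nonneg _) h1 2).trans ?_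
  have h4 : ‖a‖ ^ 2 - ‖a * b‖ ^ 2 = (‖a‖ - ‖a * b‖) * (‖a‖ + ‖a * b‖) := by ring
  have h5 : 0 < ‖a‖ + ‖a * b‖ := by positivity
  have hk' : 0 < 1 - k := by linarith
  rw [h4, ← one_div, ← one_div, div_pow, div_mul_div_comm, one_pow, mul_one, div_le_div_iff₀ (by positivity) (by positivity)]
  have h6 : ‖a * b‖ ≤ k * ‖a‖ := by rw [norm_mul]; nlinarith
  have h7 : (1 - k) * (‖a‖ + ‖a * b‖) ≤ (1 + k) * (‖a‖ - ‖a * b‖) := by linarith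
  calc 1 * ((1 - k) * ((‖a‖ - ‖a * b‖) * (‖a‖ + ‖a * b‖)))
      = (‖a‖ - ‖a * b‖) * ((1 - k) * (‖a‖ + ‖a * b‖)) := by ring
    _ ≤ (‖a‖ - ‖a * b‖) * ((1 + k) * (‖a‖ - ‖a * b‖)) := by gcongr
    _ = _ := by ring

lemma DM.distF {μ F G : ℂ → ℂ} (h : DM μ F G) {k : ℝ} (hk0 : 0 ≤ k) (hk : k < 1)
    (hb : ∀ z, ‖μ z‖ ≤ k) (z : ℂ) (hz : ‖z‖ ≤ 1) :
    ‖fderiv ℝ F z‖ ^ 2 ≤ (1 + k) / (1 - k) * |(fderiv ℝ F z).det| := by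
  obtain ⟨a, ha, hd⟩ := h.der z hz
  rw [hd.fderiv]; exact dist_bel hk0 hk (hb z)

lemma DM.distG {μ F G : ℂ → ℂ} (h : DM μ F G) {k : ℝ} (hk0 : 0 ≤ k) (hk : k < 1)
    (hb : ∀ z, ‖μ z‖ ≤ k) (z : ℂ) (hz : ‖z‖ < 1) :
    ‖fderiv ℝ G z‖ ^ 2 ≤ (1 + k) / (1 - k) * |(fderiv ℝ G z).det| := by
  obtain ⟨a, ha, hd⟩ := h.der (G z) (h.gc z hz.le)
  have hG : HasFDerivAt G (fderiv ℝ G z) z :=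
    ((h.gs z hz.le).differentiableAt (by simp)).hasFDerivAt
  refine dist_bel_inv ha hk0 hk (hb (G z)) ?_
  have hc := hd.comp z hG
  have hid : HasFDerivAt (F ∘ G) (ContinuousLinearMap.id ℝ ℂ) z := by
    refine (hasFDerivAt_id z).congr_of_eventuallyEq ?_
    filter_upwards [isOpen_ball.mem_nhds (show z ∈ ball (0:ℂ) 1 by simpa using hz)] with w hw
    exact h.fg w (by simpa using (mem_ball.1 hw).le)
  exact hc.unique hid

/-! connectedness of the closed disc minus a ball -/

lemma arc_preconn {w : ℂ} (η : ℝ) :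
    IsPreconnected {z : ℂ | ‖z‖ = 1 ∧ η < ‖z - w‖} := by
  obtain ⟨e, he, hw⟩ := exists_unit w
  set t := ‖w‖ with ht
  have ht0 : 0 ≤ t := norm_nonneg _
  have e0 : e ≠ 0 := by rintro rfl; simp at he
  set p : ℝ → ℂ := fun θ => -(e * cexp (θ * I)) with hp
  have hpn : ∀ θ, ‖p θ - w‖ ^ 2 = 1 + t ^ 2 + 2 * t * Real.cos θ := by
    intro θ
    have := normsq_arc (t := t) (r := -1) (θ := θ) he
    rw [← norm_neg] at this
    have e1 : p θ - w = -((t:ℂ) * e - e * (((-1 : ℝ) : ℂ) * cexp (θ * I))) := by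
      rw [hw]; simp only [hp]; push_cast; ring
    rw [e1, this]; ring
  have hset : {z : ℂ | ‖z‖ = 1 ∧ η < ‖z - w‖} =
      p '' {θ | -Real.pi ≤ θ ∧ θ ≤ Real.pi ∧ η < ‖p θ - w‖} := by
    ext z
    constructor
    · rintro ⟨h1, h2⟩
      have h3 : p (Complex.arg (-z / e)) = z := by
        have h4 := Complex.norm_mul_exp_arg_mul_I (-z / e)
        have h5 : ‖-z / e‖ = 1 := by rw [norm_div, norm_neg, h1, he, div_one]
        rw [h5] at h4
        simp only [ofReal_one, one_mul] at h4
        simp only [hp, h4]; field_simp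
      exact ⟨_, ⟨(Complex.neg_pi_lt_arg _).le, Complex.arg_le_pi _, by rw [h3]; exact h2⟩, h3⟩
    · rintro ⟨θ, ⟨_, _, h3⟩, rfl⟩
      exact ⟨by simp [hp, he, Complex.norm_exp_ofReal_mul_I], h3⟩
  rw [hset]
  refine IsPreconnected.image (OrdConnected.isPreconnected ⟨?_⟩) p
    (by simp only [hp]; exact Continuous.continuousOn (by fun_prop))
  rintro a ⟨ha1, ha2, ha3⟩ b ⟨hb1, hb2, hb3⟩ θ ⟨h1, h2⟩
  refine ⟨by linarith, by linarith, ?_⟩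
  have key : ∀ x, Real.cos x ≤ Real.cos θ → ‖p x - w‖ ≤ ‖p θ - w‖ := by
    intro x hx
    apply le_of_pow_le_pow_left₀ two_ne_zero (norm_nonneg _)
    rw [hpn, hpn]
    have : 2 * t * Real.cos x ≤ 2 * t * Real.cos θ := mul_le_mul_of_nonneg_left hx (by positivity)
    linarith
  rcases cos_between ha1 hb2 h1 h2 with h | h
  · exact ha3.trans_le (key a h)
  · exact hb3.trans_le (key b h)

lemma disc_minus_preconn {w : ℂ} (hw : ‖w‖ ≤ 1) {η : ℝ} (hη : 0 ≤ η) :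
    IsPreconnected {z : ℂ | ‖z‖ ≤ 1 ∧ η < ‖z - w‖} := by
  have hpush : ∀ z, ‖z‖ ≤ 1 → η < ‖z - w‖ → ∃ y, ‖y‖ = 1 ∧ η < ‖y - w‖ ∧
      segment ℝ z y ⊆ {z : ℂ | ‖z‖ ≤ 1 ∧ η < ‖z - w‖} := by
    intro z hz hzη
    have hzw : 0 < ‖z - w‖ := hη.trans_lt hzη
    set s1 : ℝ := 1 + 2 / ‖z - w‖ with hs1
    have hs : (1:ℝ) ≤ s1 := by
      have : 0 < 2 / ‖z - w‖ := by positivity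
      linarith
    have hc : Continuous fun s : ℝ => ‖w + s * (z - w)‖ := by fun_prop
    obtain ⟨s, hs2, hs3⟩ := intermediate_value_Icc hs (hc.continuousOn (s := Icc 1 s1))
      (show (1:ℝ) ∈ Icc _ _ from ⟨by simpa using hz, by
        have h1 : ‖(s1 : ℂ) * (z - w)‖ = ‖z - w‖ + 2 := by
          rw [norm_mul, Complex.norm_real, Real.norm_of_nonneg (by linarith), hs1]; field_simp
        have h2 : ‖(s1 : ℂ) * (z - w)‖ ≤ ‖w + s1 * (z - w)‖ + ‖w‖ := by
          have := norm_sub_le (w + s1 * (z - w)) w; simpa using this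
        linarith⟩)
    have hs3 : ‖w + s * (z - w)‖ = 1 := hs3
    have hfar : ∀ s : ℝ, 1 ≤ s → η < ‖w + s * (z - w) - w‖ := by
      intro s hs
      rw [add_sub_cancel_left, norm_mul, Complex.norm_real, Real.norm_of_nonneg (by linarith)]
      nlinarith
    refine ⟨w + s * (z - w), hs3, hfar s hs2.1, ?_⟩
    rintro _ ⟨a, b, ha, hb, hab, rfl⟩
    have e1 : a • z + b • (w + (s:ℂ) * (z - w)) = w + ((a + b * s : ℝ) : ℂ) * (z - w) := by
      have : (a:ℂ) = 1 - b := by rw [← ofReal_one, ← hab]; push_cast; ring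
      simp only [real_smul]; push_cast; rw [this]; ring
    refine ⟨?_, ?_⟩
    · refine (norm_add_le _ _).trans ?_
      rw [norm_smul, norm_smul, hs3, Real.norm_of_nonneg ha, Real.norm_of_nonneg hb]
      nlinarith
    · rw [e1]; apply hfar; nlinarith [hs2.1]
  by_cases hne : ({z : ℂ | ‖z‖ = 1 ∧ η < ‖z - w‖} : Set ℂ).Nonempty
  · obtain ⟨x, hx⟩ := hne
    apply isPreconnected_of_forall x
    rintro z ⟨hz1, hz2⟩
    obtain ⟨y, hy1, hy2, hseg⟩ := hpush z hz1 hz2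
    refine ⟨segment ℝ z y ∪ {z : ℂ | ‖z‖ = 1 ∧ η < ‖z - w‖}, union_subset hseg fun u hu => ⟨hu.1.le, hu.2⟩,
      Or.inr hx, Or.inl (left_mem_segment ℝ z y), ?_⟩
    exact IsPreconnected.union y (right_mem_segment ℝ z y) ⟨hy1, hy2⟩
      (convex_segment z y).isPreconnected (arc_preconn η)
  · rintro u v - - - ⟨z, ⟨hz1, hz2⟩, -⟩
    obtain ⟨y, hy1, hy2, -⟩ := hpush z hz1 hz2
    exact absurd ⟨y, hy1, hy2⟩ hne

lemma three_far {c : ℂ} {s : ℝ} (hs : s ≤ 1 / 2) {p q : ℂ} (hpq : 1 < ‖p - q‖) (hp : ‖p - c‖ ≤ s) :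
    s < ‖q - c‖ := by
  have : ‖p - q‖ ≤ ‖p - c‖ + ‖q - c‖ := by
    have := norm_sub_le (p - c) (q - c); simpa using this
  linarith

lemma capture {φ ψ : ℂ → ℂ} (hφ : ∀ z, ‖z‖ ≤ 1 → ‖φ z‖ ≤ 1) (hψ : ∀ z, ‖z‖ ≤ 1 → ‖ψ z‖ ≤ 1)
    (hψc : ∀ z, ‖z‖ ≤ 1 → ContinuousAt ψ z) (hφψ : ∀ z, ‖z‖ ≤ 1 → φ (ψ z) = z)
    (hψφ : ∀ z, ‖z‖ ≤ 1 → ψ (φ z) = z)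
    (h1 : φ 1 = 1) (hm : φ (-1) = -1) (hI : φ I = I) {z0 w : ℂ} {r η : ℝ}
    (hr1 : r ≤ 1 / 2) (hη : 0 ≤ η) (hη1 : η ≤ 1 / 2) (hw : ‖w‖ ≤ 1)
    (harc : ∀ x, ‖x‖ ≤ 1 → ‖x - z0‖ = r → ‖φ x - w‖ ≤ η) :
    ∀ x, ‖x‖ ≤ 1 → ‖x - z0‖ < r → ‖φ x - w‖ ≤ η := by
  set S := {z : ℂ | ‖z‖ ≤ 1 ∧ η < ‖z - w‖} with hS
  have hpre : IsPreconnected (ψ '' S) := (disc_minus_preconn hw hη).image ψ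
    fun z hz => (hψc z hz.1).continuousWithinAt
  have hmem : ∀ x, ‖x‖ ≤ 1 → η < ‖φ x - w‖ → x ∈ ψ '' S :=
    fun x hx h => ⟨φ x, ⟨hφ x hx, h⟩, hψφ x hx⟩
  have hmem' : ∀ x ∈ ψ '' S, ‖x‖ ≤ 1 ∧ η < ‖φ x - w‖ := by
    rintro _ ⟨y, hy, rfl⟩; exact ⟨hψ y hy.1, by rw [hφψ y hy.1]; exact hy.2⟩
  -- a fixed point outside
  have hp : ∃ p : ℂ, ‖p‖ ≤ 1 ∧ φ p = p ∧ r < ‖p - z0‖ ∧ η < ‖p - w‖ := by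
    have n1 : (1:ℝ) < ‖(1:ℂ) - (-1)‖ := by norm_num
    have sq : ∀ z : ℂ, z.re ^ 2 + z.im ^ 2 = 2 → 1 < ‖z‖ := by
      intro z hz
      have h : ‖z‖ ^ 2 = 2 := by
        rw [← Complex.normSq_eq_norm_sq, Complex.normSq_apply]; linarith
      nlinarith [norm_nonneg z]
    have n2 : (1:ℝ) < ‖(1:ℂ) - I‖ := sq _ (by simp; norm_num)
    have n3 : (1:ℝ) < ‖(-1:ℂ) - I‖ := sq _ (by simp; norm_num)
    have n1' : (1:ℝ) < ‖(-1:ℂ) - 1‖ := by norm_num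
    have n2' : (1:ℝ) < ‖I - 1‖ := by rw [norm_sub_rev]; exact n2
    have n3' : (1:ℝ) < ‖I - (-1)‖ := by rw [norm_sub_rev]; exact n3
    by_cases a1 : r < ‖(1:ℂ) - z0‖ ∧ η < ‖(1:ℂ) - w‖
    · exact ⟨1, by simp, h1, a1⟩
    by_cases a2 : r < ‖(-1:ℂ) - z0‖ ∧ η < ‖(-1:ℂ) - w‖
    · exact ⟨-1, by simp, hm, a2⟩
    refine ⟨I, by simp, hI, ?_⟩
    rw [not_and_or, not_lt, not_lt] at a1 a2
    rcases a1 with a1 | a1 <;> rcases a2 with a2 | a2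
    · exact absurd (three_far hr1 n1 a1) (not_lt.2 a2)
    · exact ⟨three_far hr1 n2 a1, three_far hη1 n3 a2⟩
    · exact ⟨three_far hr1 n3 a2, three_far hη1 n2 a1⟩
    · exact absurd (three_far hη1 n1 a1) (not_lt.2 a2)
  obtain ⟨p, hp1, hp2, hp3, hp4⟩ := hp
  intro x hx hxr
  by_contra hcon
  have hx' := hmem x hx (not_le.1 hcon)
  have hp' := hmem p hp1 (by rw [hp2]; exact hp4)
  have hc : ContinuousOn (fun z : ℂ => ‖z - z0‖) (ψ '' S) := by fun_prop
  obtain ⟨y, hy, hyr⟩ := hpre.intermediate_value hx' hp' hc ⟨hxr.le, hp3.le⟩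
  have := hmem' y hy
  linarith [harc y this.1 hyr]

lemma equicont_aux {A : ℝ} (hA : 0 < A) {ε : ℝ} (hε : 0 < ε) : ∃ δ > 0, ∀ φ ψ : ℂ → ℂ,
    (∀ z, ‖z‖ ≤ 1 → ‖φ z‖ ≤ 1) → (∀ z, ‖z‖ ≤ 1 → ‖ψ z‖ ≤ 1) →
    (∀ z, ‖z‖ ≤ 1 → ContinuousAt ψ z) → (∀ z, ‖z‖ ≤ 1 → φ (ψ z) = z) →
    (∀ z, ‖z‖ ≤ 1 → ψ (φ z) = z) → φ 1 = 1 → φ (-1) = -1 → φ I = I →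
    (∀ z, ‖z‖ ≤ 1 → ContDiffAt ℝ 1 φ z) →
    (∫⁻ z in closedBall 0 1, ENNReal.ofReal (‖fderiv ℝ φ z‖ ^ 2) ≤ ENNReal.ofReal A) →
    ∀ x y, ‖x‖ ≤ 1 → ‖y‖ ≤ 1 → ‖x - y‖ < δ → ‖φ x - φ y‖ ≤ ε := by
  set η := min (ε / 2) (1 / 2) with hη
  have hη0 : 0 < η := by positivity
  have hlim : Tendsto (fun δ : ℝ => Real.sqrt (4 * A / Real.log δ⁻¹) * ((1 + 2 * Real.pi) / 2)) (𝓝[>] 0) (𝓝 0) := by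
    have h1 : Tendsto (fun δ : ℝ => Real.log δ⁻¹) (𝓝[>] 0) atTop :=
      Real.tendsto_log_atTop.comp tendsto_inv_nhdsGT_zero
    have h2 := (h1.const_div_atTop (4 * A)).sqrt
    simpa using h2.mul_const ((1 + 2 * Real.pi) / 2)
  have hlim2 : Tendsto (fun δ : ℝ => Real.sqrt δ) (𝓝[>] 0) (𝓝 0) := by
    have := (Real.continuous_sqrt.tendsto 0).mono_left (nhdsWithin_le_nhds (s := Ioi 0)); simpa using this
  have hmem : Ioo (0:ℝ) 1 ∈ 𝓝[>] (0:ℝ) := Ioo_mem_nhdsGT one_pos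
  obtain ⟨δ, ⟨hδ1, hδ2⟩, hδ3⟩ := ((hlim.eventually (ge_mem_nhds hη0)).and
    (hlim2.eventually (ge_mem_nhds (show (0:ℝ) < 1/2 by norm_num))) |>.and hmem).exists
  refine ⟨δ, hδ3.1, ?_⟩
  intro φ ψ hφ hψ hψc hφψ hψφ h1 hm hI hs hE x y hx hy hxy
  obtain ⟨r, hr, hosc⟩ := courant hs hA hE (z0 := y) hδ3.1 hδ3.2
  have hr2 : r ≤ 1 / 2 := hr.2.le.trans hδ2
  have hr0 : 0 < r := hδ3.1.trans hr.1
  -- a point on the arc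
  obtain ⟨e, he, hye⟩ := exists_unit y
  have hx0 : ∃ x0 : ℂ, ‖x0‖ ≤ 1 ∧ ‖x0 - y‖ = r := by
    refine ⟨y - r * e, ?_, ?_⟩
    · have : y - r * e = ((‖y‖ - r : ℝ) : ℂ) * e := by
        conv_lhs => rw [hye]
        push_cast; ring
      rw [this, norm_mul, he, mul_one, Complex.norm_real, Real.norm_eq_abs, abs_le]
      constructor <;> linarith [norm_nonneg y]
    · simp [he, hr0.le]
  obtain ⟨x0, hx01, hx02⟩ := hx0
  have hcap := capture hφ hψ hψc hφψ hψφ h1 hm hI hr2 hη0.le (min_le_right _ _) (hφ x0 hx01)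
    (z0 := y) (fun x hx hxr => (hosc x x0 hx hx01 hxr hx02).trans hδ1)
  have hc1 := hcap x hx (hxy.trans hr.1)
  have hc2 := hcap y hy (by simpa using hr0)
  have : ‖φ x - φ y‖ ≤ ‖φ x - φ x0‖ + ‖φ y - φ x0‖ := by
    have := norm_sub_le (φ x - φ x0) (φ y - φ x0); simpa using this
  have : η ≤ ε / 2 := min_le_left _ _
  linarith

lemma Nice.energyF {μ F G : ℂ → ℂ} (h : Nice μ F G) {k : ℝ} (hk0 : 0 ≤ k) (hk : k < 1)
    (hb : ∀ z, ‖μ z‖ ≤ k) : ∫⁻ z in closedBall 0 1, ENNReal.ofReal (‖fderiv ℝ F z‖ ^ 2) ≤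
      ENNReal.ofReal ((1 + k) / (1 - k) * Real.pi) :=
  energy (div_nonneg (by linarith) (by linarith)) (fun z hz => (h.fs z hz.le).differentiableAt (by simp))
    h.fb (fun x hx y hy hxy => by
      rw [← h.gf x (by simpa using (mem_ball.1 hx).le), hxy, h.gf y (by simpa using (mem_ball.1 hy).le)])
    (fun z hz => h.distF hk0 hk hb z hz.le)

lemma Nice.energyG {μ F G : ℂ → ℂ} (h : Nice μ F G) {k : ℝ} (hk0 : 0 ≤ k) (hk : k < 1)
    (hb : ∀ z, ‖μ z‖ ≤ k) : ∫⁻ z in closedBall 0 1, ENNReal.ofReal (‖fderiv ℝ G z‖ ^ 2) ≤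
      ENNReal.ofReal ((1 + k) / (1 - k) * Real.pi) :=
  energy (div_nonneg (by linarith) (by linarith)) (fun z hz => (h.gs z hz.le).differentiableAt (by simp))
    h.gb (fun x hx y hy hxy => by
      rw [← h.fg x (by simpa using (mem_ball.1 hx).le), hxy, h.fg y (by simpa using (mem_ball.1 hy).le)])
    (fun z hz => h.distG hk0 hk hb z hz)

lemma equicont {k : ℝ} (hk0 : 0 ≤ k) (hk : k < 1) {ε : ℝ} (hε : 0 < ε) : ∃ δ > 0, ∀ μ F G : ℂ → ℂ,
    (∀ z, ‖μ z‖ ≤ k) → Nice μ F G → ∀ x y, ‖x‖ ≤ 1 → ‖y‖ ≤ 1 → ‖x - y‖ < δ →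
      ‖F x - F y‖ ≤ ε ∧ ‖G x - G y‖ ≤ ε := by
  have hA : 0 < (1 + k) / (1 - k) * Real.pi :=
    mul_pos (div_pos (by linarith) (by linarith)) Real.pi_pos
  obtain ⟨δ, hδ, H⟩ := equicont_aux hA hε
  refine ⟨δ, hδ, fun μ F G hμ h x y hx hy hxy => ⟨?_, ?_⟩⟩
  · exact H F G h.fc h.gc (fun z hz => (h.gs z hz).continuousAt) h.fg h.gf h.f1 h.fm h.fI
      (fun z hz => (h.fs z hz).of_le (by norm_num)) (h.energyF hk0 hk hμ) x y hx hy hxy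
  · have g1 : G 1 = 1 := by have := h.gf 1 (by simp); rwa [h.f1] at this
    have gm : G (-1) = -1 := by have := h.gf (-1) (by simp); rwa [h.fm] at this
    have gI : G I = I := by have := h.gf I (by simp); rwa [h.fI] at this
    exact H G F h.gc h.fc (fun z hz => (h.fs z hz).continuousAt) h.gf h.fg g1 gm gI
      (fun z hz => (h.gs z hz).of_le (by norm_num)) (h.energyG hk0 hk hμ) x y hx hy hxy

end

end

section
open Complex MeasureTheory Metric Set Filter
open scoped ContDiff Topology ComplexConjugate Convolution
set_option linter.unnecessarySeqFocus false

noncomputable section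

def rad (n : ℕ) : ℝ := 1 / ((n : ℝ) + 1)

lemma rad_pos (n : ℕ) : 0 < rad n := Nat.one_div_pos_of_nat

lemma rad_tendsto : Tendsto rad atTop (𝓝 0) := tendsto_one_div_add_atTop_nhds_zero_nat

def bp (n : ℕ) : ContDiffBump (0 : ℂ) :=
  ⟨rad n / 2, rad n, half_pos (rad_pos n), half_lt_self (rad_pos n)⟩

/-- mollification kernel -/
def mker (n : ℕ) : ℂ → ℝ := (bp n).normed volume

def moll (n : ℕ) (f : ℂ → ℂ) : ℂ → ℂ := mker n ⋆[ContinuousLinearMap.lsmul ℝ ℝ, volume] f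

lemma moll_apply (n : ℕ) (f : ℂ → ℂ) (x : ℂ) : moll n f x = ∫ t, (mker n t : ℂ) * f (x - t) := by
  simp [moll, convolution_def]

lemma moll_apply' (n : ℕ) (f : ℂ → ℂ) (x : ℂ) : moll n f x = ∫ t, (mker n (x - t) : ℂ) * f t := by
  simp [moll, convolution_eq_swap]

lemma mker_nonneg (n : ℕ) (x : ℂ) : 0 ≤ mker n x := (bp n).nonneg_normed x

lemma mker_integral (n : ℕ) : ∫ t, mker n t = 1 := (bp n).integral_normed

lemma mker_integrable (n : ℕ) : Integrable (mker n) := (bp n).integrable_normed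

lemma mker_contDiff (n : ℕ) : ContDiff ℝ ∞ (mker n) := (bp n).contDiff_normed

lemma mker_compact (n : ℕ) : HasCompactSupport (mker n) := (bp n).hasCompactSupport_normed

lemma mker_tsupport (n : ℕ) : tsupport (mker n) = closedBall 0 (rad n) := (bp n).tsupport_normed_eq

lemma mker_eq_zero {n : ℕ} {x : ℂ} (h : rad n ≤ ‖x‖) : mker n x = 0 := by
  have : x ∉ Function.support (mker n) := by
    rw [mker, ContDiffBump.support_normed_eq]; simpa [bp] using h
  simpa using this

lemma moll_contDiff (n : ℕ) {f : ℂ → ℂ} (hf : LocallyIntegrable f) : ContDiff ℝ ∞ (moll n f) :=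
  (mker_compact n).contDiff_convolution_left _ (mker_contDiff n) hf

lemma moll_norm_le (n : ℕ) {f : ℂ → ℂ} {C : ℝ} (hC : ∀ x, ‖f x‖ ≤ C) (x : ℂ) : ‖moll n f x‖ ≤ C := by
  rw [moll_apply]
  have : C = ∫ t, mker n t * C := by rw [integral_mul_const, mker_integral, one_mul]
  rw [this]
  refine norm_integral_le_of_norm_le ((mker_integrable n).mul_const C) (Eventually.of_forall fun t => ?_)
  rw [norm_mul, Complex.norm_real, Real.norm_of_nonneg (mker_nonneg n t)]
  exact mul_le_mul_of_nonneg_left (hC _) (mker_nonneg n t)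

lemma moll_ae {f : ℂ → ℂ} (hf : LocallyIntegrable f) :
    ∀ᵐ x, Tendsto (fun n => moll n f x) atTop (𝓝 (f x)) := by
  refine ContDiffBump.ae_convolution_tendsto_right_of_locallyIntegrable (φ := bp) (K := 2)
    rad_tendsto (Eventually.of_forall fun n => ?_) hf
  simp only [bp]; linarith

/-- cutoff functions -/
def cutO (n : ℕ) : ContDiffBump (0 : ℂ) :=
  ⟨1 - 2 * rad (n + 2), 1 - rad (n + 2), by
    have : rad (n + 2) ≤ 1 / 3 := by
      unfold rad; apply one_div_le_one_div_of_le (by norm_num); push_cast; linarith [(Nat.cast_nonneg n : (0:ℝ) ≤ n)]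
    linarith, by linarith [rad_pos (n + 2)]⟩

def cutI (n : ℕ) : ContDiffBump (0 : ℂ) :=
  ⟨rad n, 2 * rad n, rad_pos n, by linarith [rad_pos n]⟩

def cut (n : ℕ) (z : ℂ) : ℝ := cutO n z * (1 - cutI n z)

lemma cut_mem (n : ℕ) (z : ℂ) : 0 ≤ cut n z ∧ cut n z ≤ 1 := by
  have h1 := (cutO n).nonneg (x := z); have h2 := (cutO n).le_one (x := z)
  have h3 := (cutI n).nonneg (x := z); have h4 := (cutI n).le_one (x := z)
  constructor
  · exact mul_nonneg h1 (by linarith)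
  · unfold cut; nlinarith

lemma cut_tendsto {z : ℂ} (h0 : z ≠ 0) (h1 : ‖z‖ < 1) : ∀ᶠ n in atTop, cut n z = 1 := by
  have e1 : ∀ᶠ n in atTop, 2 * rad (n + 2) < 1 - ‖z‖ := by
    have := ((tendsto_add_atTop_iff_nat 2).2 rad_tendsto).const_mul 2
    simp only [mul_zero] at this
    exact this.eventually (gt_mem_nhds (by linarith))
  have e2 : ∀ᶠ n in atTop, 2 * rad n < ‖z‖ := by
    have := rad_tendsto.const_mul 2
    simp only [mul_zero] at this
    exact this.eventually (gt_mem_nhds (norm_pos_iff.2 h0))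
  filter_upwards [e1, e2] with n h2 h3
  have : cutO n z = 1 := (cutO n).one_of_mem_closedBall (by simp [cutO]; linarith)
  have h5 : cutI n z = 0 := (cutI n).zero_of_le_dist (by simp [cutI]; linarith)
  rw [cut, this, h5]; norm_num

lemma exists_approx {μ : ℂ → ℂ} (hm : Measurable μ) {k : ℝ} (hb : ∀ z, ‖μ z‖ ≤ k) :
    ∃ m : ℕ → ℂ → ℂ, (∀ n, Test (m n)) ∧ (∀ n, tsupport (m n) ⊆ ball 0 1) ∧ (∀ n, 0 ∉ tsupport (m n)) ∧
      (∀ n z, ‖m n z‖ ≤ k) ∧ ∀ᵐ z, z ∈ ball (0:ℂ) 1 → Tendsto (fun n => m n z) atTop (𝓝 (μ z)) := by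
  have hli : LocallyIntegrable μ := by
    have : LocallyIntegrable (fun _ : ℂ => k) := locallyIntegrable_const k
    exact this.mono hm.aestronglyMeasurable
      (Eventually.of_forall fun z => (hb z).trans (le_abs_self k))
  have hcd : ∀ n, ContDiff ℝ ∞ (fun z => (cut n z : ℂ)) := by
    intro n
    exact Complex.ofRealCLM.contDiff.comp ((cutO n).contDiff.mul (contDiff_const.sub (cutI n).contDiff))
  set m : ℕ → ℂ → ℂ := fun n z => (cut n z : ℂ) * moll n μ z with hmd
  have hsupp : ∀ n, tsupport (m n) ⊆ closedBall 0 (1 - rad (n + 2)) := by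
    intro n
    apply closure_minimal _ isClosed_closedBall
    intro z hz
    by_contra hcon
    apply hz
    have : cutO n z = 0 := (cutO n).zero_of_le_dist (by
      simp only [mem_closedBall, not_le] at hcon; exact hcon.le)
    simp [hmd, cut, this]
  refine ⟨m, fun n => ⟨(hcd n).mul (moll_contDiff n hli), ?_⟩, fun n => (hsupp n).trans ?_, fun n => ?_,
    fun n z => ?_, ?_⟩
  · exact (isCompact_closedBall _ _).of_isClosed_subset (isClosed_tsupport _) (hsupp n)
  · exact closedBall_subset_ball (by linarith [rad_pos (n + 2)])
  · rw [notMem_tsupport_iff_eventuallyEq]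
    filter_upwards [ball_mem_nhds (0:ℂ) (rad_pos n)] with z hz
    have : cutI n z = 1 := (cutI n).one_of_mem_closedBall (ball_subset_closedBall hz)
    simp [hmd, cut, this]
  · have h1 := cut_mem n z
    have h2 := moll_norm_le n hb z
    simp only [hmd, norm_mul, Complex.norm_real, Real.norm_of_nonneg h1.1]
    nlinarith [norm_nonneg (moll n μ z)]
  · have h0 : ∀ᵐ z : ℂ, z ≠ 0 := by simp [ae_iff]
    filter_upwards [moll_ae hli, h0] with z hz hz0 hzb
    refine hz.congr' ?_
    filter_upwards [cut_tendsto hz0 (by simpa using hzb)] with n hn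
    simp [hmd, hn]

end

end

section
open Complex MeasureTheory Metric Set Filter
open scoped ContDiff Topology ComplexConjugate
set_option linter.unnecessarySeqFocus false

noncomputable section

lemma weak_lim {ν : Measure ℂ} (U : Ultrafilter ℕ) {a : ℕ → ℂ → ℂ} (ha : ∀ n, MemLp (a n) 2 ν) {C : ℝ}
    (hC : ∀ n, n2 ν (a n) ≤ C) :
    ∃ g : ℂ → ℂ, MemLp g 2 ν ∧ ∀ v, MemLp v 2 ν →
      Tendsto (fun n => ∫ z, a n z * v z ∂ν) U (𝓝 (∫ z, g z * v z ∂ν)) := by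
  have hca : ∀ n, MemLp (fun z => conj (a n z)) 2 ν := fun n => by
    refine (ha n).of_le (Complex.continuous_conj.comp_aestronglyMeasurable (ha n).1)
      (Eventually.of_forall fun z => by simp)
  set e : ℕ → Lp ℂ 2 ν := fun n => (hca n).toLp _ with he
  have hnorm : ∀ n, ‖e n‖ ≤ C := by
    intro n
    refine le_trans (le_of_eq ?_) (hC n)
    rw [he]; simp only [Lp.norm_toLp]
    unfold n2
    congr 1
    exact eLpNorm_congr_norm_ae (Eventually.of_forall fun z => by simp)
  set l : ℕ → WeakDual ℂ (Lp ℂ 2 ν) := fun n =>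
    StrongDual.toWeakDual (InnerProductSpace.toDual ℂ (Lp ℂ 2 ν) (e n)) with hl
  have hcomp := WeakDual.isCompact_closedBall (0 : StrongDual ℂ (Lp ℂ 2 ν)) C
  obtain ⟨L, -, hL⟩ := hcomp.ultrafilter_le_nhds (U.map l) (by
    rw [le_principal_iff]
    refine Filter.Eventually.of_forall (f := (U : Filter ℕ)) fun n => ?_
    simp only [mem_preimage, mem_closedBall, dist_zero_right]
    have : ‖(InnerProductSpace.toDual ℂ (Lp ℂ 2 ν) (e n))‖ ≤ C := by
      rw [LinearIsometryEquiv.norm_map]; exact hnorm n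
    exact this)
  set u : Lp ℂ 2 ν := (InnerProductSpace.toDual ℂ (Lp ℂ 2 ν)).symm (WeakDual.toStrongDual L) with hu
  have key : ∀ (w : ℂ → ℂ) (hw : MemLp w 2 ν) (v : ℂ → ℂ) (hv : MemLp v 2 ν),
      inner ℂ (hw.toLp w) (hv.toLp v) = ∫ z, conj (w z) * v z ∂ν := by
    intro w hw v hv
    rw [L2.inner_def]
    refine integral_congr_ae ?_
    filter_upwards [hw.coeFn_toLp, hv.coeFn_toLp] with z h1 h2
    rw [h1, h2]; simp [mul_comm]
  refine ⟨fun z => conj (u z), ?_, fun v hv => ?_⟩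
  · have := Lp.memLp u
    exact this.of_le (Complex.continuous_conj.comp_aestronglyMeasurable this.1)
      (Eventually.of_forall fun z => by simp)
  have h1 : Tendsto l U (𝓝 L) := hL
  have h2 : Tendsto (fun n => l n (hv.toLp v)) U (𝓝 (L (hv.toLp v))) :=
    ((WeakDual.eval_continuous (hv.toLp v)).tendsto L).comp h1
  have h3 : ∀ n, l n (hv.toLp v) = ∫ z, a n z * v z ∂ν := by
    intro n
    have : l n (hv.toLp v) = inner ℂ (e n) (hv.toLp v) := rfl
    rw [this, he, key]; simp
  have h4 : L (hv.toLp v) = ∫ z, conj (u z) * v z ∂ν := by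
    have h5 : L (hv.toLp v) = inner ℂ u (hv.toLp v) := by
      rw [hu, InnerProductSpace.toDual_symm_apply]; rfl
    rw [h5]
    have := key u (Lp.memLp u) v hv
    rw [Lp.toLp_coeFn] at this
    exact this
  rw [← h4]
  exact h2.congr h3

lemma ultra_unif (U : Ultrafilter ℕ) {f : ℕ → ℂ → ℂ} (hb : ∀ n z, ‖z‖ ≤ 1 → ‖f n z‖ ≤ 1)
    (he : ∀ ε > 0, ∃ δ > 0, ∀ n x y, ‖x‖ ≤ 1 → ‖y‖ ≤ 1 → ‖x - y‖ < δ → ‖f n x - f n y‖ ≤ ε) :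
    ∃ F : ℂ → ℂ, TendstoUniformlyOn f F U (closedBall 0 1) := by
  have h1 : ∀ z : ℂ, ∃ w : ℂ, ‖z‖ ≤ 1 → Tendsto (fun n => f n z) U (𝓝 w) := by
    intro z
    by_cases hz : ‖z‖ ≤ 1
    · obtain ⟨w, -, hw⟩ := (isCompact_closedBall (0:ℂ) 1).ultrafilter_le_nhds (U.map fun n => f n z) (by
        rw [le_principal_iff]
        exact Filter.Eventually.of_forall (f := (U : Filter ℕ)) fun n => by simpa using hb n z hz)
      exact ⟨w, fun _ => hw⟩
    · exact ⟨0, fun h => absurd h hz⟩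
  choose F hF using h1
  refine ⟨F, ?_⟩
  rw [Metric.tendstoUniformlyOn_iff]
  intro ε hε
  obtain ⟨δ, hδ, h⟩ := he (ε / 4) (by linarith)
  obtain ⟨t, hts, htf, hcov⟩ := (isCompact_closedBall (0:ℂ) 1).finite_cover_balls hδ
  have ev : ∀ᶠ n in (U : Filter ℕ), ∀ y ∈ t, dist (F y) (f n y) < ε / 4 := by
    rw [Filter.eventually_all_finite htf]
    intro y hy
    have := hF y (by simpa using hts hy)
    have := (Metric.tendsto_nhds.1 this) (ε / 4) (by linarith)
    filter_upwards [this] with n hn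
    rw [dist_comm]; exact hn
  filter_upwards [ev] with n hn x hx
  have hx1 : ‖x‖ ≤ 1 := by simpa using hx
  obtain ⟨y, hy, hxy⟩ := mem_iUnion₂.1 (hcov hx)
  have hy1 : ‖y‖ ≤ 1 := by simpa using hts hy
  rw [mem_ball, dist_eq_norm] at hxy
  have c1 : dist (F x) (F y) ≤ ε / 4 := by
    have := ((hF x hx1).sub (hF y hy1)).norm
    rw [dist_eq_norm]
    exact le_of_tendsto this (Eventually.of_forall fun m => h m x y hx1 hy1 hxy)
  have c2 : dist (f n y) (f n x) ≤ ε / 4 := by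
    rw [dist_comm, dist_eq_norm]; exact h n x y hx1 hy1 hxy
  have := dist_triangle (F x) (F y) (f n x)
  have := dist_triangle (F y) (f n y) (f n x)
  linarith [hn y hy]

/-- approximating data -/
structure Appr (k : ℝ) (U : Ultrafilter ℕ) (μ : ℂ → ℂ) (m f g : ℕ → ℂ → ℂ) (F G : ℂ → ℂ) : Prop where
  test : ∀ n, Test (m n)
  bd : ∀ n z, ‖m n z‖ ≤ k
  ae : ∀ᵐ z, z ∈ ball (0:ℂ) 1 → Tendsto (fun n => m n z) atTop (𝓝 (μ z))
  nice : ∀ n, Nice (m n) (f n) (g n)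
  uf : TendstoUniformlyOn f F U (closedBall 0 1)
  ug : TendstoUniformlyOn g G U (closedBall 0 1)
  cf : ContinuousOn F (closedBall 0 1)
  cg : ContinuousOn G (closedBall 0 1)
  bf : ∀ z, ‖z‖ ≤ 1 → ‖F z‖ ≤ 1
  bg : ∀ z, ‖z‖ ≤ 1 → ‖G z‖ ≤ 1
  fg : ∀ z, ‖z‖ ≤ 1 → F (G z) = z
  gf : ∀ z, ‖z‖ ≤ 1 → G (F z) = z
  bf' : ∀ z, ‖z‖ < 1 → ‖F z‖ < 1
  bg' : ∀ z, ‖z‖ < 1 → ‖G z‖ < 1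
  f1 : F 1 = 1
  fm : F (-1) = -1
  fI : F I = I

lemma exists_appr {μ : ℂ → ℂ} (hm : Measurable μ) {k : ℝ} (hb : ∀ z, ‖μ z‖ ≤ k) (hk0 : 0 ≤ k) (hk : k < 1) :
    ∃ (U : Ultrafilter ℕ) (m f g : ℕ → ℂ → ℂ) (F G : ℂ → ℂ), (U : Filter ℕ) ≤ atTop ∧
      Appr k U μ m f g F G := by
  obtain ⟨m, h1, h2, h3, h4, h5⟩ := exists_approx hm hb
  choose f g hfg using fun n => exists_nice (h1 n) (h2 n) (h3 n) hk0 hk (h4 n)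
  set U : Ultrafilter ℕ := hyperfilter ℕ
  have hU : (U : Filter ℕ) ≤ atTop := by
    have := hyperfilter_le_cofinite (α := ℕ)
    rwa [Nat.cofinite_eq_atTop] at this
  have ne : NeBot (U : Filter ℕ) := U.neBot
  have eqf : ∀ ε > 0, ∃ δ > 0, ∀ n x y, ‖x‖ ≤ 1 → ‖y‖ ≤ 1 → ‖x - y‖ < δ → ‖f n x - f n y‖ ≤ ε := by
    intro ε hε
    obtain ⟨δ, hδ, h⟩ := equicont hk0 hk hε
    exact ⟨δ, hδ, fun n x y hx hy hxy => (h _ _ _ (h4 n) (hfg n) x y hx hy hxy).1⟩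
  have eqg : ∀ ε > 0, ∃ δ > 0, ∀ n x y, ‖x‖ ≤ 1 → ‖y‖ ≤ 1 → ‖x - y‖ < δ → ‖g n x - g n y‖ ≤ ε := by
    intro ε hε
    obtain ⟨δ, hδ, h⟩ := equicont hk0 hk hε
    exact ⟨δ, hδ, fun n x y hx hy hxy => (h _ _ _ (h4 n) (hfg n) x y hx hy hxy).2⟩
  obtain ⟨F, uf⟩ := ultra_unif U (fun n => (hfg n).fc) eqf
  obtain ⟨G, ug⟩ := ultra_unif U (fun n => (hfg n).gc) eqg
  have pf : ∀ z, ‖z‖ ≤ 1 → Tendsto (fun n => f n z) U (𝓝 (F z)) := fun z hz =>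
    uf.tendsto_at (by simpa using hz)
  have pg : ∀ z, ‖z‖ ≤ 1 → Tendsto (fun n => g n z) U (𝓝 (G z)) := fun z hz =>
    ug.tendsto_at (by simpa using hz)
  have bf : ∀ z, ‖z‖ ≤ 1 → ‖F z‖ ≤ 1 := fun z hz =>
    le_of_tendsto (pf z hz).norm (Eventually.of_forall fun n => (hfg n).fc z hz)
  have bg : ∀ z, ‖z‖ ≤ 1 → ‖G z‖ ≤ 1 := fun z hz =>
    le_of_tendsto (pg z hz).norm (Eventually.of_forall fun n => (hfg n).gc z hz)
  have cf : ContinuousOn F (closedBall 0 1) := uf.continuousOn (Frequently.of_forall fun n z hz =>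
    ((hfg n).fs z (by simpa using hz)).continuousAt.continuousWithinAt)
  have cg : ContinuousOn G (closedBall 0 1) := ug.continuousOn (Frequently.of_forall fun n z hz =>
    ((hfg n).gs z (by simpa using hz)).continuousAt.continuousWithinAt)
  have comp : ∀ (a b : ℕ → ℂ → ℂ) (A B : ℂ → ℂ), TendstoUniformlyOn a A U (closedBall 0 1) →
      ContinuousOn A (closedBall 0 1) → (∀ z, ‖z‖ ≤ 1 → ‖B z‖ ≤ 1) → (∀ n z, ‖z‖ ≤ 1 → ‖b n z‖ ≤ 1) →
      (∀ z, ‖z‖ ≤ 1 → Tendsto (fun n => b n z) U (𝓝 (B z))) →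
      (∀ n z, ‖z‖ ≤ 1 → a n (b n z) = z) → ∀ z, ‖z‖ ≤ 1 → A (B z) = z := by
    intro a b A B ua cA hB hbn pb hab z hz
    have t1 : Tendsto (fun n => b n z) U (𝓝[closedBall 0 1] (B z)) :=
      tendsto_nhdsWithin_iff.2 ⟨pb z hz, Eventually.of_forall fun n => by simpa using hbn n z hz⟩
    have t2 := ua.tendsto_comp (cA (B z) (by simpa using hB z hz)) t1
    simp only [hab _ z hz] at t2
    exact tendsto_nhds_unique t2 tendsto_const_nhds
  have FG := comp f g F G uf cf bg (fun n => (hfg n).gc) pg (fun n => (hfg n).fg)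
  have GF := comp g f G F ug cg bf (fun n => (hfg n).fc) pf (fun n => (hfg n).gf)
  have circ : ∀ z, ‖z‖ = 1 → ‖F z‖ = 1 := fun z hz =>
    tendsto_nhds_unique (pf z hz.le).norm (by
      simp only [fun n => (hfg n).circ hz]; exact tendsto_const_nhds)
  have circG : ∀ z, ‖z‖ = 1 → ‖G z‖ = 1 := fun z hz =>
    tendsto_nhds_unique (pg z hz.le).norm (by
      simp only [fun n => (hfg n).circG hz]; exact tendsto_const_nhds)
  have fix : ∀ z, ‖z‖ = 1 → (∀ n, f n z = z) → F z = z := fun z hz h =>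
    tendsto_nhds_unique (pf z hz.le) (by simp only [h]; exact tendsto_const_nhds)
  refine ⟨U, m, f, g, F, G, hU, ⟨h1, h4, h5, hfg, uf, ug, cf, cg, bf, bg, FG, GF, ?_, ?_, ?_, ?_, ?_⟩⟩
  · intro z hz
    refine lt_of_le_of_ne (bf z hz.le) fun h => ?_
    have := circG _ h
    rw [GF z hz.le] at this; linarith
  · intro z hz
    refine lt_of_le_of_ne (bg z hz.le) fun h => ?_
    have := circ _ h
    rw [FG z hz.le] at this; linarith
  · exact fix 1 (by simp) fun n => (hfg n).f1
  · exact fix (-1) (by simp) fun n => (hfg n).fm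
  · exact fix I (by simp) fun n => (hfg n).fI

end

end

section
open Complex MeasureTheory Metric Set Filter
open scoped ContDiff Topology ComplexConjugate
set_option linter.unnecessarySeqFocus false

noncomputable section

lemma int_fderiv_zero {P : ℂ → ℂ} (hP : ContDiff ℝ 1 P) (hc : HasCompactSupport P) (v : ℂ) :
    ∫ z, fderiv ℝ P z v = 0 := by
  have hcont : Continuous fun z => fderiv ℝ P z v := (hP.continuous_fderiv (by norm_num)).clm_apply continuous_const
  have hcs : HasCompactSupport fun z => fderiv ℝ P z v := hc.fderiv_apply ℝ v
  have := integral_bilinear_hasLineDerivAt_right_eq_neg_left_of_integrable (μ := volume)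
    (f := fun _ : ℂ => (1:ℂ)) (f' := fun _ => 0) (g := P) (g' := fun z => fderiv ℝ P z v) (v := v)
    (B := ContinuousLinearMap.mul ℝ ℂ) (by simp) (by simpa using hcont.integrable_of_hasCompactSupport hcs)
    (by simpa using hP.continuous.integrable_of_hasCompactSupport hc)
    (fun x _ => by simpa using (hasFDerivAt_const (1:ℂ) x).hasLineDerivAt (𝕜 := ℝ) v)
    (fun x _ => ((hP.differentiable (by norm_num)) x).hasFDerivAt.hasLineDerivAt v)
  simpa using this

lemma int_wZ_zero {P : ℂ → ℂ} (hP : ContDiff ℝ 1 P) (hc : HasCompactSupport P) :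
    ∫ z, wirtingerZ P z = 0 ∧ ∫ z, wirtingerZBar P z = 0 := by
  have hi : ∀ v, Integrable fun z => fderiv ℝ P z v := fun v =>
    Continuous.integrable_of_hasCompactSupport
      ((hP.continuous_fderiv (by norm_num)).clm_apply continuous_const) (hc.fderiv_apply ℝ v)
  unfold wirtingerZ wirtingerZBar
  constructor
  · rw [integral_div, integral_sub (hi 1) ((hi I).const_mul I), integral_const_mul,
      int_fderiv_zero hP hc, int_fderiv_zero hP hc]; simp
  · rw [integral_div, integral_add (hi 1) ((hi I).const_mul I), integral_const_mul,
      int_fderiv_zero hP hc, int_fderiv_zero hP hc]; simp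

lemma contDiff_mul_supp {f φ : ℂ → ℂ} {A : Set ℂ} {n : WithTop ℕ∞} (hf : ∀ z ∈ A, ContDiffAt ℝ n f z) (hφ : ∀ z ∈ A, ContDiffAt ℝ n φ z)
    (hs : tsupport φ ⊆ A) : ContDiff ℝ n fun z => f z * φ z := by
  rw [contDiff_iff_contDiffAt]
  intro z
  by_cases hz : z ∈ tsupport φ
  · exact (hf z (hs hz)).mul (hφ z (hs hz))
  · have : (fun z => f z * φ z) =ᶠ[𝓝 z] fun _ => 0 := by
      filter_upwards [notMem_tsupport_iff_eventuallyEq.1 hz] with w hw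
      simp [hw]
    exact contDiffAt_const.congr_of_eventuallyEq this

lemma ibp_C1 {f φ : ℂ → ℂ} {A : Set ℂ} (hf : ∀ z ∈ A, ContDiffAt ℝ 1 f z) (hφ : ContDiff ℝ 1 φ)
    (hc : HasCompactSupport φ) (hs : tsupport φ ⊆ A) :
    (∫ z in A, f z * wirtingerZ φ z) = -∫ z in A, wirtingerZ f z * φ z ∧
    (∫ z in A, f z * wirtingerZBar φ z) = -∫ z in A, wirtingerZBar f z * φ z := by
  have hP : ContDiff ℝ 1 fun z => f z * φ z := contDiff_mul_supp hf (fun z _ => hφ.contDiffAt) hs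
  have hPc : HasCompactSupport fun z => f z * φ z := hc.mul_left
  have z1 : ∀ z ∉ A, φ z = 0 := fun z hz => image_eq_zero_of_notMem_tsupport fun h => hz (hs h)
  have z2 : ∀ z ∉ A, wirtingerZ φ z = 0 := fun z hz =>
    image_eq_zero_of_notMem_tsupport fun h => hz (hs (tsupport_wZ φ h))
  have z3 : ∀ z ∉ A, wirtingerZBar φ z = 0 := fun z hz =>
    image_eq_zero_of_notMem_tsupport fun h => hz (hs (tsupport_wZBar φ h))
  have hd : ∀ z ∈ A, DifferentiableAt ℝ f z := fun z hz => (hf z hz).differentiableAt (by norm_num)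
  have hcA : ContDiff ℝ 0 fun z => f z * wirtingerZ φ z :=
    contDiff_mul_supp (fun z hz => (hf z hz).of_le (by norm_num))
      (fun z _ => (contDiff_wZ hφ (by norm_num)).contDiffAt) ((tsupport_wZ φ).trans hs)
  have hcB : ContDiff ℝ 0 fun z => f z * wirtingerZBar φ z :=
    contDiff_mul_supp (fun z hz => (hf z hz).of_le (by norm_num))
      (fun z _ => (contDiff_wZBar hφ (by norm_num)).contDiffAt) ((tsupport_wZBar φ).trans hs)
  have e1 : ∀ z, wirtingerZ f z * φ z = wirtingerZ (fun z => f z * φ z) z - f z * wirtingerZ φ z := by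
    intro z
    by_cases hz : z ∈ A
    · rw [wZ_mul (hd z hz) (hφ.differentiable (by norm_num) z)]; ring
    · rw [z1 z hz, z2 z hz, image_eq_zero_of_notMem_tsupport fun h => hz (hs (tsupport_mul_subset_right (tsupport_wZ _ h)))]
      simp
  have e2 : ∀ z, wirtingerZBar f z * φ z = wirtingerZBar (fun z => f z * φ z) z - f z * wirtingerZBar φ z := by
    intro z
    by_cases hz : z ∈ A
    · rw [wZBar_mul (hd z hz) (hφ.differentiable (by norm_num) z)]; ring
    · rw [z1 z hz, z3 z hz, image_eq_zero_of_notMem_tsupport fun h => hz (hs (tsupport_mul_subset_right (tsupport_wZBar _ h)))]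
      simp
  have s1 : HasCompactSupport (wirtingerZ φ) := hc.mono' (subset_closure.trans (tsupport_wZ φ))
  have s2 : HasCompactSupport (wirtingerZBar φ) := hc.mono' (subset_closure.trans (tsupport_wZBar φ))
  have s3 : HasCompactSupport (wirtingerZ fun z => f z * φ z) := hPc.mono' (subset_closure.trans (tsupport_wZ _))
  have s4 : HasCompactSupport (wirtingerZBar fun z => f z * φ z) := hPc.mono' (subset_closure.trans (tsupport_wZBar _))
  have i1 := hcA.continuous.integrable_of_hasCompactSupport (μ := volume) (s1.mul_left)
  have i2 := hcB.continuous.integrable_of_hasCompactSupport (μ := volume) (s2.mul_left)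
  have i3 := (contDiff_wZ hP (m := 0) (by norm_num)).continuous.integrable_of_hasCompactSupport (μ := volume) s3
  have i4 := (contDiff_wZBar hP (m := 0) (by norm_num)).continuous.integrable_of_hasCompactSupport (μ := volume) s4
  rw [setIntegral_eq_integral_of_forall_compl_eq_zero (fun z hz => by rw [z2 z hz, mul_zero]),
    setIntegral_eq_integral_of_forall_compl_eq_zero (fun z hz => by rw [z1 z hz, mul_zero]),
    setIntegral_eq_integral_of_forall_compl_eq_zero (fun z hz => by rw [z3 z hz, mul_zero]),
    setIntegral_eq_integral_of_forall_compl_eq_zero (fun z hz => by rw [z1 z hz, mul_zero])]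
  simp only [e1, e2]
  rw [integral_sub i3 i1, integral_sub i4 i2, (int_wZ_zero hP hPc).1, (int_wZ_zero hP hPc).2]
  simp

lemma norm_wZ_le (f : ℂ → ℂ) (z : ℂ) : ‖wirtingerZ f z‖ ≤ ‖fderiv ℝ f z‖ := by
  unfold wirtingerZ
  have h1 : ‖fderiv ℝ f z 1‖ ≤ ‖fderiv ℝ f z‖ := by simpa using (fderiv ℝ f z).le_opNorm 1
  have h2 : ‖fderiv ℝ f z I‖ ≤ ‖fderiv ℝ f z‖ := by simpa using (fderiv ℝ f z).le_opNorm I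
  have h3 := norm_sub_le (fderiv ℝ f z 1) (I * fderiv ℝ f z I)
  rw [norm_mul, norm_I, one_mul] at h3
  rw [norm_div, Complex.norm_ofNat]; linarith

lemma measurable_wZ (f : ℂ → ℂ) : Measurable (wirtingerZ f) := by
  unfold wirtingerZ
  have h := fun v => measurable_fderiv_apply_const ℝ f v
  fun_prop (disch := exact h _)

lemma Nice.memLp {μ F G : ℂ → ℂ} (h : Nice μ F G) {k : ℝ} (hk0 : 0 ≤ k) (hk : k < 1)
    (hb : ∀ z, ‖μ z‖ ≤ k) : MemLp (wirtingerZ F) 2 (volume.restrict (ball 0 1)) ∧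
      n2 (volume.restrict (ball 0 1)) (wirtingerZ F) ≤ Real.sqrt ((1 + k) / (1 - k) * Real.pi) := by
  have hE := h.energyF hk0 hk hb
  have h0 : 0 ≤ (1 + k) / (1 - k) * Real.pi := by
    have : 0 ≤ (1 + k) / (1 - k) := div_nonneg (by linarith) (by linarith)
    positivity
  have h1 : ∫⁻ z in ball 0 1, ‖wirtingerZ F z‖ₑ ^ 2 ≤ ENNReal.ofReal ((1 + k) / (1 - k) * Real.pi) := by
    refine le_trans ?_ hE
    refine le_trans (lintegral_mono fun z => ?_) (lintegral_mono_set ball_subset_closedBall)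
    rw [← ofReal_norm, ← ENNReal.ofReal_pow (norm_nonneg _)]
    exact ENNReal.ofReal_le_ofReal (by gcongr; exact norm_wZ_le F z)
  have h2 : eLpNorm (wirtingerZ F) 2 (volume.restrict (ball 0 1)) ≤ ENNReal.ofReal (Real.sqrt ((1 + k) / (1 - k) * Real.pi)) := by
    rw [eLpNorm_eq_lintegral_rpow_enorm_toReal (by norm_num) (by norm_num)]
    simp only [ENNReal.toReal_ofNat, ENNReal.rpow_ofNat]
    rw [Real.sqrt_eq_rpow, ← ENNReal.ofReal_rpow_of_nonneg h0 (by norm_num)]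
    exact ENNReal.rpow_le_rpow h1 (by norm_num)
  refine ⟨⟨(measurable_wZ F).aestronglyMeasurable, h2.trans_lt ENNReal.ofReal_lt_top⟩, ?_⟩
  exact ENNReal.toReal_le_of_le_ofReal (Real.sqrt_nonneg _) h2

end

end

section
open Complex MeasureTheory Metric Set Filter
open scoped ContDiff Topology ComplexConjugate
set_option linter.unnecessarySeqFocus false

noncomputable section

lemma unif_int {l : Filter ℕ} {f : ℕ → ℂ → ℂ} {F ψ : ℂ → ℂ} (hu : TendstoUniformlyOn f F l (ball 0 1))
    (hf : ∀ n, ContinuousOn (f n) (ball 0 1)) (hF : ContinuousOn F (ball 0 1)) {C : ℝ}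
    (bf : ∀ n, ∀ z ∈ ball (0:ℂ) 1, ‖f n z‖ ≤ C) (bF : ∀ z ∈ ball (0:ℂ) 1, ‖F z‖ ≤ C)
    (hψ : IntegrableOn ψ (ball 0 1)) :
    Tendsto (fun n => ∫ z in ball 0 1, f n z * ψ z) l (𝓝 (∫ z in ball 0 1, F z * ψ z)) := by
  have ii : ∀ {h : ℂ → ℂ}, ContinuousOn h (ball 0 1) → (∀ z ∈ ball (0:ℂ) 1, ‖h z‖ ≤ C) →
      IntegrableOn (fun z => h z * ψ z) (ball 0 1) := by
    intro h hc hb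
    refine Integrable.bdd_mul (c := C) hψ (hc.aestronglyMeasurable measurableSet_ball) ?_
    exact (ae_restrict_iff' measurableSet_ball).2 (Eventually.of_forall hb)
  rw [Metric.tendsto_nhds]
  intro ε hε
  rw [Metric.tendstoUniformlyOn_iff] at hu
  set M := ∫ z in ball 0 1, ‖ψ z‖ with hM
  have hM0 : 0 ≤ M := integral_nonneg fun _ => norm_nonneg _
  filter_upwards [hu (ε / (M + 1)) (by positivity)] with n hn
  rw [dist_eq_norm, ← integral_sub (ii (hf n) (bf n)) (ii hF bF)]
  have : ‖∫ z in ball 0 1, (f n z * ψ z - F z * ψ z)‖ ≤ ∫ z in ball 0 1, ε / (M + 1) * ‖ψ z‖ := by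
    refine norm_integral_le_of_norm_le (hψ.norm.const_mul _) ?_
    refine (ae_restrict_iff' measurableSet_ball).2 (Eventually.of_forall fun z hz => ?_)
    rw [← sub_mul, norm_mul]
    have := hn z hz
    rw [dist_comm, dist_eq_norm] at this
    gcongr
  rw [integral_const_mul] at this
  refine this.trans_lt ?_
  rw [← hM, div_mul_eq_mul_div, div_lt_iff₀ (by positivity)]
  nlinarith

lemma dct_n2 {ν : Measure ℂ} {m : ℕ → ℂ → ℂ} {μ v : ℂ → ℂ} {k : ℝ} (hv : MemLp v 2 ν) (hm : ∀ n, Measurable (m n))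
    (hμ : Measurable μ) (bm : ∀ n z, ‖m n z‖ ≤ k) (bμ : ∀ z, ‖μ z‖ ≤ k)
    (hae : ∀ᵐ z ∂ν, Tendsto (fun n => m n z) atTop (𝓝 (μ z))) :
    (∀ n, MemLp (fun z => (m n z - μ z) * v z) 2 ν) ∧
    Tendsto (fun n => n2 ν (fun z => (m n z - μ z) * v z)) atTop (𝓝 0) := by
  have hb : ∀ n z, ‖m n z - μ z‖ ≤ 2 * k := fun n z =>
    (norm_sub_le _ _).trans (by linarith [bm n z, bμ z])
  have hL : ∀ n, MemLp (fun z => (m n z - μ z) * v z) 2 ν := fun n => by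
    refine hv.of_le_mul (c := 2 * k) (((hm n).sub hμ).aestronglyMeasurable.mul hv.1)
      (Eventually.of_forall fun z => ?_)
    rw [norm_mul]; gcongr; exact hb n z
  refine ⟨hL, ?_⟩
  have h1 : Tendsto (fun n => ∫ z, ‖(m n z - μ z) * v z‖ ^ 2 ∂ν) atTop (𝓝 (∫ z, (0:ℝ) ∂ν)) := by
    refine tendsto_integral_of_dominated_convergence (fun z => (2 * k) ^ 2 * ‖v z‖ ^ 2)
      (fun n => (memLp_sq_integrable (hL n)).1) ((memLp_sq_integrable hv).const_mul _)
      (fun n => Eventually.of_forall fun z => ?_) ?_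
    · rw [norm_mul, mul_pow, Real.norm_of_nonneg (by positivity)]
      gcongr; exact hb n z
    · filter_upwards [hae] with z hz
      have : Tendsto (fun n => (m n z - μ z) * v z) atTop (𝓝 0) := by
        have := (hz.sub_const (μ z)).mul_const (v z)
        simpa using this
      simpa using this.norm.pow 2
  rw [integral_zero] at h1
  have h2 := h1.sqrt
  rw [Real.sqrt_zero] at h2
  refine h2.congr fun n => ?_
  rw [← n2_sq (hL n), Real.sqrt_sq (n2_nonneg _ _)]

lemma cs_tendsto {ν : Measure ℂ} {a w : ℕ → ℂ → ℂ} {C : ℝ} (ha : ∀ n, MemLp (a n) 2 ν) (hC : ∀ n, n2 ν (a n) ≤ C)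
    (hw : ∀ n, MemLp (w n) 2 ν) (h0 : Tendsto (fun n => n2 ν (w n)) atTop (𝓝 0)) :
    Tendsto (fun n => ∫ z, a n z * w n z ∂ν) atTop (𝓝 0) := by
  refine squeeze_zero_norm (fun n => ?_) (by simpa using h0.const_mul C)
  refine (norm_integral_le_integral_norm _).trans ?_
  simp only [norm_mul]
  exact (cs_integral (ha n) (hw n)).trans (mul_le_mul_of_nonneg_right (hC n) (n2_nonneg _ _))

lemma Nice.wZBar {μ F G : ℂ → ℂ} (h : Nice μ F G) {z : ℂ} (hz : ‖z‖ ≤ 1) :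
    wirtingerZBar F z = μ z * wirtingerZ F z := by
  obtain ⟨a, -, ha⟩ := h.der z hz
  rw [wirtingerZ_of_hasFDerivAt ha, wirtingerZBar_of_hasFDerivAt ha, mul_comm]

lemma Appr.weak {k : ℝ} {U : Ultrafilter ℕ} {μ : ℂ → ℂ} {m f g : ℕ → ℂ → ℂ} {F G : ℂ → ℂ}
    (h : Appr k U μ m f g F G) (hU : (U : Filter ℕ) ≤ atTop) (hμ : Measurable μ) (bμ : ∀ z, ‖μ z‖ ≤ k)
    (hk0 : 0 ≤ k) (hk : k < 1) :
    ∃ p : ℂ → ℂ, MemLp p 2 (volume.restrict (ball 0 1)) ∧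
      HasDistribWirtingerDerivs (ball 0 1) F p (fun z => μ z * p z) := by
  set ν := (volume : Measure ℂ).restrict (ball 0 1) with hν
  have fin : IsFiniteMeasure ν := ⟨by rw [hν]; simpa using measure_ball_lt_top⟩
  have hL := fun n => (h.nice n).memLp hk0 hk (h.bd n)
  obtain ⟨p, hp, hlim⟩ := weak_lim U (fun n => (hL n).1) (fun n => (hL n).2)
  have hpμ : MemLp (fun z => μ z * p z) 2 ν := by
    refine hp.of_le_mul (c := k) (hμ.aestronglyMeasurable.mul hp.1) (Eventually.of_forall fun z => ?_)
    rw [norm_mul]; gcongr; exact bμ z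
  refine ⟨p, hp, ?_, ?_, ?_⟩
  · exact IntegrableOn.locallyIntegrableOn (hp.integrable (by norm_num))
  · exact IntegrableOn.locallyIntegrableOn (hpμ.integrable (by norm_num))
  intro φ hφ hc hs
  have hT : Test φ := ⟨hφ, hc⟩
  have hφ2 : MemLp φ 2 ν := (hT.memLp 2).restrict _
  have hφμ : MemLp (fun z => μ z * φ z) 2 ν := by
    refine hφ2.of_le_mul (c := k) (hμ.aestronglyMeasurable.mul hφ2.1) (Eventually.of_forall fun z => ?_)
    rw [norm_mul]; gcongr; exact bμ z
  have bsub : ball (0:ℂ) 1 ⊆ closedBall 0 1 := ball_subset_closedBall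
  have hlt : ∀ z ∈ ball (0:ℂ) 1, ‖z‖ ≤ 1 := fun z hz => by simpa using bsub hz
  have T : ∀ ψ : ℂ → ℂ, Test ψ → Tendsto (fun n => ∫ z in ball 0 1, f n z * ψ z) U (𝓝 (∫ z in ball 0 1, F z * ψ z)) :=
    fun ψ hψ => unif_int (h.uf.mono bsub)
      (fun n z hz => ((h.nice n).fs z (hlt z hz)).continuousAt.continuousWithinAt)
      (h.cf.mono bsub) (fun n z hz => (h.nice n).fc z (hlt z hz)) (fun z hz => h.bf z (hlt z hz))
      (hψ.1.continuous.integrable_of_hasCompactSupport hψ.2).integrableOn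
  have ibp := fun n => ibp_C1 (f := f n) (φ := φ) (A := ball 0 1)
    (fun z hz => ((h.nice n).fs z (hlt z hz)).of_le (by norm_num)) (hφ.of_le (by exact_mod_cast le_top)) hc hs
  constructor
  · refine tendsto_nhds_unique ((T _ hT.wZ).congr fun n => (ibp n).1) ?_
    exact (hlim φ hφ2).neg
  · refine tendsto_nhds_unique ((T _ hT.wZBar).congr fun n => (ibp n).2) ?_
    refine Tendsto.neg ?_
    have hae : ∀ᵐ z ∂ν, Tendsto (fun n => m n z) atTop (𝓝 (μ z)) :=
      (ae_restrict_iff' measurableSet_ball).2 h.ae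
    have hD := dct_n2 hφ2 (fun n => (h.test n).1.continuous.measurable) hμ h.bd bμ hae
    have t1 := (cs_tendsto (fun n => (hL n).1) (fun n => (hL n).2) hD.1 hD.2).mono_left hU
    have t2 := (hlim _ hφμ).add t1
    rw [add_zero] at t2
    have e : ∫ z, μ z * p z * φ z ∂ν = ∫ z, p z * (μ z * φ z) ∂ν := by
      congr 1; ext z; ring
    rw [e]
    refine t2.congr fun n => ?_
    rw [← integral_add (memLp_mul_integrable (hL n).1 hφμ) (memLp_mul_integrable (hL n).1 (hD.1 n))]
    refine setIntegral_congr_fun measurableSet_ball fun z hz => ?_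
    show _ = wirtingerZBar (f n) z * φ z
    rw [(h.nice n).wZBar (hlt z hz)]; ring

end

end

section
open Complex MeasureTheory Metric Set Filter
open scoped ContDiff Topology ComplexConjugate
set_option linter.unnecessarySeqFocus false

noncomputable section

/-- a continuous map of the closed disc close to the identity on the boundary has a zero -/
lemma degree {u : ℂ → ℂ} {s : ℝ} (hs : 0 < s) (hc : ContinuousOn u (closedBall 0 s))
    (h : ∀ y, ‖y‖ = s → ‖u y - y‖ < s) : ∃ y, ‖y‖ ≤ s ∧ u y = 0 := by
  by_contra! hne
  set P : ℂ → ℂ := fun y => ((s / max s ‖y‖ : ℝ) : ℂ) * y with hP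
  have hmx : ∀ y : ℂ, 0 < max s ‖y‖ := fun y => lt_max_of_lt_left hs
  have hPc : Continuous P := by
    refine Continuous.mul (continuous_ofReal.comp ?_) continuous_id
    exact continuous_const.div (continuous_const.max continuous_norm) fun y => (hmx y).ne'
  have hPb : ∀ y, ‖P y‖ ≤ s := by
    intro y
    simp only [hP, norm_mul, Complex.norm_real]
    rw [Real.norm_of_nonneg (div_nonneg hs.le (hmx y).le), div_mul_eq_mul_div, div_le_iff₀ (hmx y)]
    exact mul_le_mul_of_nonneg_left (le_max_right _ _) hs.le
  have hPi : ∀ y, ‖y‖ = s → P y = y := by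
    intro y hy
    simp [hP, hy, hs.ne']
  have hsc : IsSimplyConnected (univ : Set ℂ) := by
    have : ContractibleSpace (univ : Set ℂ) := convex_univ.contractibleSpace univ_nonempty
    exact SimplyConnectedSpace.ofContractible _
  obtain ⟨l, hlc, hl⟩ := Complex.exists_continuousOn_eqOn_exp_comp hsc isOpen_univ
    (g := fun y => u (P y)) (by
      rw [← continuousOn_univ] at hPc
      exact hc.comp hPc fun y _ => by simpa using hPb y) (by
      rintro ⟨y, -, hy⟩
      exact hne _ (hPb y) hy)
  rw [continuousOn_univ] at hlc
  set p : ℝ → ℂ := fun θ => s * cexp (θ * I) with hp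
  have hpc : Continuous p := by simp only [hp]; fun_prop
  have hpn : ∀ θ, ‖p θ‖ = s := fun θ => by
    simp [hp, Complex.norm_exp_ofReal_mul_I, abs_of_pos hs]
  have hp0 : ∀ θ, p θ ≠ 0 := fun θ h0 => by have := hpn θ; rw [h0, norm_zero] at this; linarith
  have hucont : Continuous fun θ => u (p θ) := by
    rw [← continuousOn_univ] at hpc ⊢
    exact hc.comp hpc fun θ _ => by simpa using (hpn θ).le
  have hslit : ∀ θ, u (p θ) / p θ ∈ slitPlane := by
    intro θ
    left
    have h1 : ‖u (p θ) / p θ - 1‖ < 1 := by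
      rw [div_sub_one (hp0 θ), norm_div, hpn, div_lt_one hs]; exact h _ (hpn θ)
    have h2 := (abs_re_le_norm (u (p θ) / p θ - 1)).trans_lt h1
    rw [abs_lt] at h2
    simp only [sub_re, one_re] at h2
    linarith
  set q : ℝ → ℝ := fun θ => (l (p θ) - Complex.log (u (p θ) / p θ)).im - θ with hq
  have hqc : Continuous q := by
    refine Continuous.sub (continuous_im.comp ((hlc.comp hpc).sub ?_)) continuous_id
    exact Continuous.clog (hucont.div hpc hp0) hslit
  have hqi : ∀ θ, ∃ n : ℤ, q θ = n * (2 * Real.pi) := by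
    intro θ
    have e1 : cexp (l (p θ)) = u (p θ) := by
      have := hl (mem_univ (p θ))
      simpa [hPi _ (hpn θ)] using this
    have e2 : cexp (l (p θ) - Complex.log (u (p θ) / p θ)) = cexp (Real.log s + θ * I) := by
      rw [Complex.exp_sub, e1, Complex.exp_log (slitPlane_ne_zero (hslit θ)), Complex.exp_add,
        ← Complex.ofReal_exp, Real.exp_log hs]
      have : u (p θ) ≠ 0 := hne _ (hpn θ).le
      field_simp [hp0 θ]
      rfl
    obtain ⟨n, hn⟩ := Complex.exp_eq_exp_iff_exists_int.1 e2
    refine ⟨n, ?_⟩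
    have := congrArg Complex.im hn
    simp only [hq]
    rw [this]
    simp
  have hper : q (2 * Real.pi) = q 0 - 2 * Real.pi := by
    have : p (2 * Real.pi) = p 0 := by simp [hp, Complex.exp_two_pi_mul_I]
    simp only [hq, this]; ring
  obtain ⟨n0, hn0⟩ := hqi 0
  have hpi := Real.pi_pos
  obtain ⟨θ, -, hθ⟩ : q 0 - Real.pi ∈ q '' (Icc 0 (2 * Real.pi)) := by
    refine intermediate_value_Icc' (by positivity) hqc.continuousOn ⟨?_, ?_⟩
    · rw [hper]; linarith
    · linarith
  obtain ⟨n, hn⟩ := hqi θ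
  rw [hn, hn0] at hθ
  have h3 : (2 * ((n0:ℝ) - n)) = 1 := by
    have : Real.pi * (2 * ((n0:ℝ) - n)) = Real.pi * 1 := by linarith
    exact mul_left_cancel₀ hpi.ne' this
  have h4 : 2 * (n0 - n) = 1 := by exact_mod_cast h3
  omega

lemma circle_osc {v : ℂ → ℂ} (hv : ContDiff ℝ 1 v) {A R : ℝ} (hR : 0 < R) (hA : 0 < A)
    (hE : ∫⁻ z in closedBall 0 R, ENNReal.ofReal ‖fderiv ℝ v z‖ ≤ ENNReal.ofReal A) :
    ∃ s ∈ Ioo (R / 2) R, ∀ x y, ‖x‖ = s → ‖y‖ = s → ‖v x - v y‖ ≤ 4 * A / R := by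
  set U : ℂ → ENNReal := (closedBall (0:ℂ) R).indicator fun z => ENNReal.ofReal ‖fderiv ℝ v z‖ with hU
  have hUm : Measurable U :=
    Measurable.indicator (ENNReal.measurable_ofReal.comp (measurable_fderiv ℝ v).norm) measurableSet_closedBall
  have hpolm : ∀ r : ℝ, Measurable fun θ : ℝ => Complex.polarCoord.symm (r, θ) := fun r => by
    simp only [Complex.polarCoord_symm_apply]; fun_prop
  have hUp : ∀ r : ℝ, Measurable fun θ : ℝ => U (Complex.polarCoord.symm (r, θ)) := fun r => hUm.comp (hpolm r)
  obtain ⟨s, hs, hsE⟩ : ∃ s ∈ Ioo (R / 2) R, ENNReal.ofReal s *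
      ∫⁻ θ in Ioo (-Real.pi) Real.pi, U (Complex.polarCoord.symm (s, θ)) ≤ ENNReal.ofReal (4 * A / R) := by
    by_contra! hcon
    rw [← lintegral_indicator measurableSet_closedBall, ← hU, ← Complex.lintegral_comp_polarCoord_symm] at hE
    have hmeas : Measurable fun p : ℝ × ℝ => ENNReal.ofReal p.1 • U (Complex.polarCoord.symm p) := by
      have : Measurable fun p : ℝ × ℝ => Complex.polarCoord.symm p := by
        simp only [Complex.polarCoord_symm_apply]; fun_prop
      exact (ENNReal.measurable_ofReal.comp measurable_fst).smul (hUm.comp this)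
    have hE2 : ∫⁻ r in Ioo (R / 2) R, ∫⁻ θ in Ioo (-Real.pi) Real.pi,
        ENNReal.ofReal r • U (Complex.polarCoord.symm (r, θ)) ≤ ENNReal.ofReal A := by
      refine le_trans ?_ hE
      rw [polarCoord_target, Measure.volume_eq_prod, ← Measure.prod_restrict,
        lintegral_prod _ hmeas.aemeasurable]
      exact lintegral_mono' (Measure.restrict_mono (fun r hr => (half_pos hR).trans hr.1) le_rfl) le_rfl
    have hlow : ∫⁻ r in Ioo (R / 2) R, ENNReal.ofReal (4 * A / R) ≤ ENNReal.ofReal A := by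
      refine le_trans (setLIntegral_mono' measurableSet_Ioo fun r hr => ?_) hE2
      simp only [smul_eq_mul]
      rw [lintegral_const_mul _ (hUp r)]
      exact (hcon r hr).le
    rw [setLIntegral_const, Real.volume_Ioo, ← ENNReal.ofReal_mul (by positivity),
      ENNReal.ofReal_le_ofReal_iff hA.le] at hlow
    have : 4 * A / R * (R - R / 2) = 2 * A := by field_simp; ring
    linarith
  refine ⟨s, hs, ?_⟩
  have hs0 : 0 < s := (half_pos hR).trans hs.1
  set p : ℝ → ℂ := fun θ => s * cexp (θ * I) with hp
  have hpol : ∀ θ, Complex.polarCoord.symm (s, θ) = p θ := by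
    intro θ; simp only [hp]; rw [Complex.polarCoord_symm_apply, Complex.exp_mul_I]; push_cast; ring
  have hpn : ∀ θ, ‖p θ‖ = s := fun θ => by
    simp [hp, Complex.norm_exp_ofReal_mul_I, abs_of_pos hs0]
  have hpc : Continuous p := by simp only [hp]; fun_prop
  have hpd : ∀ θ : ℝ, HasDerivAt p (s * (cexp (θ * I) * I)) θ := by
    intro θ
    have h1 := (((Complex.ofRealCLM.hasDerivAt (x := θ)).mul_const I).cexp.const_mul (s:ℂ))
    simpa using h1
  set v' : ℝ → ℂ := fun θ => fderiv ℝ v (p θ) (s * (cexp (θ * I) * I)) with hv'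
  have hv'c : Continuous v' :=
    ((hv.continuous_fderiv (by norm_num)).comp hpc).clm_apply (by fun_prop)
  have hv'n : ∀ θ, ‖v' θ‖ ≤ s * ‖fderiv ℝ v (p θ)‖ := by
    intro θ
    refine (ContinuousLinearMap.le_opNorm _ _).trans ?_
    rw [norm_mul, norm_mul, Complex.norm_exp_ofReal_mul_I, Complex.norm_real, Real.norm_of_nonneg hs0.le]
    simp [mul_comm]
  have main : ∀ a b, -Real.pi ≤ a → b ≤ Real.pi → a ≤ b → ‖v (p b) - v (p a)‖ ≤ 4 * A / R := by
    intro a b ha hb hab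
    have h1 := intervalIntegral.integral_eq_sub_of_hasDerivAt (a := a) (b := b) (f := fun θ => v (p θ)) (f' := v')
      (fun θ _ => ((hv.differentiable (by norm_num)) (p θ)).hasFDerivAt.comp_hasDerivAt θ (hpd θ))
      (hv'c.intervalIntegrable _ _)
    rw [← h1]
    refine (intervalIntegral.norm_integral_le_integral_norm hab).trans ?_
    rw [intervalIntegral.integral_of_le hab, integral_Ioc_eq_integral_Ioo]
    rw [← ENNReal.ofReal_le_ofReal_iff (by positivity), ofReal_integral_eq_lintegral_ofReal]
    · refine le_trans ?_ hsE
      rw [← lintegral_const_mul _ (hUp s)]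
      refine le_trans (setLIntegral_mono' measurableSet_Ioo fun θ hθ => ?_)
        (lintegral_mono' (Measure.restrict_mono (s := Ioo a b) (Ioo_subset_Ioo ha hb) le_rfl) le_rfl)
      have h5 : U (Complex.polarCoord.symm (s, θ)) = ENNReal.ofReal ‖fderiv ℝ v (p θ)‖ := by
        rw [hpol]; exact indicator_of_mem (by simpa [hpn] using hs.2.le) _
      rw [h5, ← ENNReal.ofReal_mul hs0.le]
      exact ENNReal.ofReal_le_ofReal (hv'n θ)
    · exact (hv'c.norm.continuousOn.integrableOn_Icc).mono_set Ioo_subset_Icc_self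
    · exact Eventually.of_forall fun θ => norm_nonneg _
  have hpar : ∀ x : ℂ, ‖x‖ = s → ∃ θ, -Real.pi ≤ θ ∧ θ ≤ Real.pi ∧ x = p θ := by
    intro x hx
    refine ⟨Complex.arg x, (Complex.neg_pi_lt_arg _).le, Complex.arg_le_pi _, ?_⟩
    have h2 := Complex.norm_mul_exp_arg_mul_I x
    rw [hx] at h2
    exact h2.symm
  intro x y hxr hyr
  obtain ⟨a, ha1, ha2, rfl⟩ := hpar x hxr
  obtain ⟨b, hb1, hb2, rfl⟩ := hpar y hyr
  rcases le_total a b with h | h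
  · rw [norm_sub_rev]; exact main a b ha1 hb2 h
  · exact main b a hb1 ha2 h

end

end

section
open Complex MeasureTheory Metric Set Filter
open scoped ContDiff Topology ComplexConjugate Convolution
set_option linter.unnecessarySeqFocus false

noncomputable section

/-- weak derivatives, global integrals -/
def WD (A : Set ℂ) (f g h : ℂ → ℂ) : Prop := ∀ φ, Test φ → tsupport φ ⊆ A →
  (∫ z, f z * wirtingerZ φ z) = -∫ z, g z * φ z ∧ (∫ z, f z * wirtingerZBar φ z) = -∫ z, h z * φ z

lemma moll_fderiv (n : ℕ) {f : ℂ → ℂ} (hf : LocallyIntegrable f) (y v : ℂ) :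
    fderiv ℝ (moll n f) y v = ∫ t, f t * ((fderiv ℝ (mker n) (y - t) v : ℝ) : ℂ) := by
  have h0 : moll n f = f ⋆[(ContinuousLinearMap.lsmul ℝ ℝ : ℝ →L[ℝ] ℂ →L[ℝ] ℂ).flip, volume] mker n := by
    rw [moll, ← convolution_flip]
  have h1 := (mker_compact n).hasFDerivAt_convolution_right
    (L := (ContinuousLinearMap.lsmul ℝ ℝ : ℝ →L[ℝ] ℂ →L[ℝ] ℂ).flip) hf ((mker_contDiff n).of_le (by exact_mod_cast le_top)) y
  rw [h0, h1.fderiv, convolution_precompR_apply _ hf ((mker_compact n).fderiv ℝ)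
    ((mker_contDiff n).continuous_fderiv (by simp)), convolution_def]
  simp [mul_comm]

lemma test_ker (n : ℕ) (y : ℂ) : Test (fun t => (mker n (y - t) : ℂ)) ∧
    tsupport (fun t => (mker n (y - t) : ℂ)) ⊆ closedBall y (rad n) := by
  have h1 : tsupport (fun t => (mker n (y - t) : ℂ)) ⊆ closedBall y (rad n) := by
    apply closure_minimal _ isClosed_closedBall
    intro t ht
    by_contra hcon
    apply ht
    rw [mem_closedBall, not_le, dist_comm, dist_eq_norm] at hcon
    simp [mker_eq_zero hcon.le]
  refine ⟨⟨?_, ?_⟩, h1⟩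
  · exact Complex.ofRealCLM.contDiff.comp ((mker_contDiff n).comp (contDiff_const.sub contDiff_id))
  · exact (isCompact_closedBall _ _).of_isClosed_subset (isClosed_tsupport _) h1

lemma fderiv_ker (n : ℕ) (y t v : ℂ) :
    fderiv ℝ (fun t => (mker n (y - t) : ℂ)) t v = -((fderiv ℝ (mker n) (y - t) v : ℝ) : ℂ) := by
  have h1 : HasFDerivAt (mker n) (fderiv ℝ (mker n) (y - t)) (y - t) :=
    ((mker_contDiff n).differentiable (by simp) _).hasFDerivAt
  have h2 := h1.comp t ((hasFDerivAt_id (𝕜 := ℝ) t).const_sub y)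
  have h3 := (Complex.ofRealCLM.hasFDerivAt (x := mker n (y - t))).comp t h2
  have h4 : HasFDerivAt (fun t => (mker n (y - t) : ℂ)) _ t := h3
  rw [h4.fderiv]
  simp

lemma moll_wd {A : Set ℂ} {f g h : ℂ → ℂ} (hw : WD A f g h) (hf : LocallyIntegrable f)
    {n : ℕ} {y : ℂ} (hy : closedBall y (rad n) ⊆ A) :
    HasFDerivAt (moll n f) (bel (moll n g y) (moll n h y)) y := by
  have hd : DifferentiableAt ℝ (moll n f) y := (moll_contDiff n hf).differentiable (by simp) y
  have hi : ∀ v, Integrable fun t => f t * ((fderiv ℝ (mker n) (y - t) v : ℝ) : ℂ) := by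
    intro v
    have h1 : (fun t => f t * ((fderiv ℝ (mker n) (y - t) v : ℝ) : ℂ)) =
        fun t => -(fderiv ℝ (fun t => (mker n (y - t) : ℂ)) t v • f t) := by
      ext t; rw [fderiv_ker]; simp [mul_comm]
    rw [h1]
    have hT := (test_ker n y).1
    refine (hf.integrable_smul_left_of_hasCompactSupport ?_ (hT.2.fderiv_apply ℝ v)).neg
    exact (hT.1.continuous_fderiv (by simp)).clm_apply continuous_const
  obtain ⟨w1, w2⟩ := hw _ (test_ker n y).1 ((test_ker n y).2.trans hy)
  have e1 : wirtingerZ (moll n f) y = moll n g y := by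
    rw [wirtingerZ, moll_fderiv n hf, moll_fderiv n hf, moll_apply', ← integral_const_mul,
      ← integral_sub (hi 1) ((hi I).const_mul I), ← integral_div]
    rw [← neg_eq_iff_eq_neg, ← integral_neg] at w1
    simp only [mul_comm ((mker n _ : ℝ) : ℂ)]
    rw [← w1]
    congr 1; ext t
    rw [wirtingerZ, fderiv_ker, fderiv_ker]; ring
  have e2 : wirtingerZBar (moll n f) y = moll n h y := by
    rw [wirtingerZBar, moll_fderiv n hf, moll_fderiv n hf, moll_apply', ← integral_const_mul,
      ← integral_add (hi 1) ((hi I).const_mul I), ← integral_div]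
    rw [← neg_eq_iff_eq_neg, ← integral_neg] at w2
    simp only [mul_comm ((mker n _ : ℝ) : ℂ)]
    rw [← w2]
    congr 1; ext t
    rw [wirtingerZBar, fderiv_ker, fderiv_ker]; ring
  rw [← e1, ← e2]
  exact hasFDerivAt_bel hd

lemma mker_lint (n : ℕ) : ∫⁻ t, ENNReal.ofReal (mker n t) = 1 := by
  rw [← ofReal_integral_eq_lintegral_ofReal (mker_integrable n) (Eventually.of_forall (mker_nonneg n)),
    mker_integral, ENNReal.ofReal_one]

lemma moll_int (n : ℕ) {g : ℂ → ℂ} (hg : LocallyIntegrable g) (y : ℂ) :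
    Integrable fun t => (mker n t : ℂ) * g (y - t) := by
  have hg' : LocallyIntegrable fun t => (mker n (y - t) : ℂ) • g t := by
    have hT := (test_ker n y).1
    exact (hg.integrable_smul_left_of_hasCompactSupport hT.1.continuous hT.2).locallyIntegrable
  have hT := (test_ker n y).1
  have := (hg.integrable_smul_left_of_hasCompactSupport hT.1.continuous hT.2).comp_sub_left y
  simpa using this

lemma moll_sub_le (n : ℕ) {g : ℂ → ℂ} (hg : LocallyIntegrable g) (c y : ℂ) :
    ‖moll n g y - c‖ₑ ≤ ∫⁻ t, ENNReal.ofReal (mker n t) * ‖g (y - t) - c‖ₑ := by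
  have h1 : moll n g y - c = ∫ t, (mker n t : ℂ) * (g (y - t) - c) := by
    simp only [mul_sub]
    have hi2 : Integrable fun t => (mker n t : ℂ) * c := (mker_integrable n).ofReal.mul_const c
    rw [integral_sub (moll_int n hg y) hi2, ← moll_apply,
      integral_mul_const, integral_complex_ofReal, mker_integral]
    simp
  rw [h1]
  refine (enorm_integral_le_lintegral_enorm _).trans (le_of_eq ?_)
  congr 1; ext t
  rw [enorm_mul, ← ofReal_norm (mker n t : ℂ), Complex.norm_real, Real.norm_of_nonneg (mker_nonneg n t)]

lemma moll_L1 (n : ℕ) {g : ℂ → ℂ} (hg : LocallyIntegrable g) (hgm : Measurable g) (c x : ℂ) {R : ℝ} (hn : rad n ≤ R) :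
    ∫⁻ y in closedBall x R, ‖moll n g y - c‖ₑ ≤ ∫⁻ y in closedBall x (2 * R), ‖g y - c‖ₑ := by
  have hm : Measurable fun p : ℂ × ℂ => ENNReal.ofReal (mker n p.2) * ‖g (p.1 - p.2) - c‖ₑ := by
    have h1 : Measurable (mker n) := (mker_contDiff n).continuous.measurable
    have h2 : Measurable fun p : ℂ × ℂ => g (p.1 - p.2) := hgm.comp (measurable_fst.sub measurable_snd)
    exact (ENNReal.measurable_ofReal.comp (h1.comp measurable_snd)).mul (h2.sub_const c).enorm
  calc ∫⁻ y in closedBall x R, ‖moll n g y - c‖ₑ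
      ≤ ∫⁻ y in closedBall x R, ∫⁻ t, ENNReal.ofReal (mker n t) * ‖g (y - t) - c‖ₑ :=
        lintegral_mono fun y => moll_sub_le n hg c y
    _ = ∫⁻ t, ∫⁻ y in closedBall x R, ENNReal.ofReal (mker n t) * ‖g (y - t) - c‖ₑ :=
        lintegral_lintegral_swap hm.aemeasurable
    _ ≤ ∫⁻ t, ENNReal.ofReal (mker n t) * ∫⁻ y in closedBall x (2 * R), ‖g y - c‖ₑ := by
        refine lintegral_mono fun t => ?_
        by_cases ht : rad n ≤ ‖t‖
        · simp [mker_eq_zero ht]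
        push Not at ht
        simp only
        have hm2 : Measurable fun y => ‖g (y - t) - c‖ₑ := ((hgm.comp (measurable_id.sub_const t)).sub_const c).enorm
        rw [lintegral_const_mul _ hm2]
        refine mul_le_mul' le_rfl ?_
        rw [← lintegral_indicator measurableSet_closedBall, ← lintegral_indicator measurableSet_closedBall,
          ← lintegral_sub_right_eq_self (fun y => (closedBall x (2 * R)).indicator (fun y => ‖g y - c‖ₑ) y) t]
        refine lintegral_mono fun y => ?_
        by_cases hy : y ∈ closedBall x R
        · have : y - t ∈ closedBall x (2 * R) := by
            rw [mem_closedBall, dist_eq_norm] at *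
            have := norm_sub_le (y - x) t
            rw [show y - t - x = y - x - t by ring]; linarith
          rw [indicator_of_mem hy, indicator_of_mem this]
        · rw [indicator_of_notMem hy]; exact zero_le
    _ = _ := by
        have hm3 : Measurable fun t => ENNReal.ofReal (mker n t) :=
          ENNReal.measurable_ofReal.comp (mker_contDiff n).continuous.measurable
        rw [lintegral_mul_const _ hm3,
          mker_lint, one_mul]

end

end

section
open Complex MeasureTheory Metric Set Filter
open scoped ContDiff Topology ComplexConjugate Convolution
set_option linter.unnecessarySeqFocus false

noncomputable section

lemma moll_unif {f : ℂ → ℂ} (hf : LocallyIntegrable f) {x : ℂ} {R R' ε : ℝ} (hR : R < R') (hε : 0 < ε)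
    (hc : ContinuousOn f (closedBall x R')) :
    ∀ᶠ n in atTop, ∀ y ∈ closedBall x R, ‖moll n f y - f y‖ ≤ ε := by
  have hu := (isCompact_closedBall x R').uniformContinuousOn_of_continuous hc
  obtain ⟨δ, hδ, hd⟩ := Metric.uniformContinuousOn_iff.1 hu ε hε
  filter_upwards [rad_tendsto.eventually (Iio_mem_nhds (lt_min hδ (sub_pos.2 hR)))] with n hn y hy
  have hn' : rad n < min δ (R' - R) := hn
  rw [lt_min_iff] at hn'
  rw [← dist_eq_norm]
  refine (bp n).dist_normed_convolution_le hf.aestronglyMeasurable fun t ht => ?_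
  have ht' : dist t y < rad n := ht
  rw [mem_closedBall] at hy
  refine (hd t ?_ y ?_ (by linarith)).le
  · rw [mem_closedBall]; linarith [dist_triangle t y x]
  · rw [mem_closedBall]; linarith

lemma approx_lin {A : Set ℂ} {f g h : ℂ → ℂ} (hw : WD A f g h) (hf : LocallyIntegrable f)
    (hg : LocallyIntegrable g) (hh : LocallyIntegrable h) (hgm : Measurable g) (hhm : Measurable h)
    {x a b : ℂ} {R η : ℝ} (hR : 0 < R) (hη : 0 < η) (hA : closedBall x (2 * R) ⊆ A)
    (hc : ContinuousOn f (closedBall x (2 * R)))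
    (h1 : ∫⁻ y in closedBall x (2 * R), ‖g y - a‖ₑ ≤ ENNReal.ofReal (η * R ^ 2))
    (h2 : ∫⁻ y in closedBall x (2 * R), ‖h y - b‖ₑ ≤ ENNReal.ofReal (η * R ^ 2)) :
    ∃ s ∈ Ioo (R / 2) R, ∃ c, ∀ y, ‖y‖ = s → ‖f (x + y) - c - bel a b y‖ ≤ 18 * η * s := by
  obtain ⟨n, hn1, hn2⟩ := ((rad_tendsto.eventually (Iio_mem_nhds hR)).and
    (moll_unif hf (R := R) (R' := 2 * R) (by linarith) (mul_pos hη hR) hc)).exists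
  have hn1 : rad n < R := hn1
  set v : ℂ → ℂ := fun y => moll n f (x + y) - bel a b y with hv
  have hvc : ContDiff ℝ 1 v := by
    refine ContDiff.sub ?_ (bel a b).contDiff
    exact ((moll_contDiff n hf).of_le (by exact_mod_cast le_top)).comp (contDiff_const.add contDiff_id)
  have hD : ∀ y ∈ closedBall (0:ℂ) R, ENNReal.ofReal ‖fderiv ℝ v y‖ ≤
      ‖moll n g (x + y) - a‖ₑ + ‖moll n h (x + y) - b‖ₑ := by
    intro y hy
    rw [mem_closedBall_zero_iff] at hy
    have hs : closedBall (x + y) (rad n) ⊆ A := by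
      refine (closedBall_subset_closedBall' ?_).trans hA
      simp only [dist_self_add_left]; linarith
    have hd := moll_wd hw hf hs
    have hd2 : HasFDerivAt v (bel (moll n g (x + y)) (moll n h (x + y)) - bel a b) y := by
      refine HasFDerivAt.sub ?_ (bel a b).hasFDerivAt
      have := hd.comp y ((hasFDerivAt_id y).const_add x)
      rw [ContinuousLinearMap.comp_id] at this
      exact this
    rw [hd2.fderiv, bel_sub, ← ofReal_norm, ← ofReal_norm, ← ENNReal.ofReal_add (norm_nonneg _) (norm_nonneg _)]
    exact ENNReal.ofReal_le_ofReal (norm_bel_le _ _)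
  have htr : ∀ u : ℂ → ℂ, Measurable u → ∀ c, ∫⁻ y in closedBall (0:ℂ) R, ‖u (x + y) - c‖ₑ = ∫⁻ y in closedBall x R, ‖u y - c‖ₑ := by
    intro u hu c
    rw [← lintegral_indicator measurableSet_closedBall, ← lintegral_indicator measurableSet_closedBall,
      ← lintegral_add_left_eq_self (fun y => (closedBall x R).indicator (fun y => ‖u y - c‖ₑ) y) x]
    congr 1; ext y
    by_cases hy : ‖y‖ ≤ R
    · rw [indicator_of_mem (by simpa using hy), indicator_of_mem (by simpa using hy)]
    · rw [indicator_of_notMem (by simpa using hy), indicator_of_notMem (by simpa using hy)]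
  have hmg : Measurable (moll n g) := (moll_contDiff n hg).continuous.measurable
  have hmh : Measurable (moll n h) := (moll_contDiff n hh).continuous.measurable
  have hE : ∫⁻ z in closedBall 0 R, ENNReal.ofReal ‖fderiv ℝ v z‖ ≤ ENNReal.ofReal (2 * η * R ^ 2) := by
    calc _ ≤ ∫⁻ y in closedBall (0:ℂ) R, (‖moll n g (x + y) - a‖ₑ + ‖moll n h (x + y) - b‖ₑ) :=
          setLIntegral_mono' measurableSet_closedBall hD
      _ = (∫⁻ y in closedBall (0:ℂ) R, ‖moll n g (x + y) - a‖ₑ) + ∫⁻ y in closedBall (0:ℂ) R, ‖moll n h (x + y) - b‖ₑ :=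
          lintegral_add_left ((hmg.comp (measurable_const_add x)).sub_const a).enorm _
      _ = _ := by rw [htr _ hmg, htr _ hmh]
      _ ≤ ENNReal.ofReal (η * R ^ 2) + ENNReal.ofReal (η * R ^ 2) :=
          add_le_add ((moll_L1 n hg hgm a x hn1.le).trans h1) ((moll_L1 n hh hhm b x hn1.le).trans h2)
      _ = _ := by rw [← ENNReal.ofReal_add (by positivity) (by positivity)]; congr 1; ring
  obtain ⟨s, hs, ho⟩ := circle_osc hvc hR (A := 2 * η * R ^ 2) (by positivity) hE
  have hs0 : 0 < s := by linarith [hs.1]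
  refine ⟨s, hs, v s, fun y hy => ?_⟩
  have h3 := ho y s hy (by rw [Complex.norm_real, Real.norm_of_nonneg hs0.le])
  have h4 := hn2 (x + y) (by simp; linarith [hs.2])
  rw [show 4 * (2 * η * R ^ 2) / R = 8 * η * R by field_simp; ring] at h3
  calc ‖f (x + y) - v s - bel a b y‖ = ‖(v y - v s) - (moll n f (x + y) - f (x + y))‖ := by
        congr 1; simp only [hv]; ring
    _ ≤ _ := norm_sub_le _ _
    _ ≤ 8 * η * R + η * R := add_le_add h3 h4
    _ ≤ 18 * η * s := by nlinarith [hs.1]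

lemma cover_lin {f : ℂ → ℂ} {x a b c : ℂ} {s κ : ℝ} (hs : 0 < s)
    (hab : ‖b‖ < ‖a‖) (hc : ContinuousOn f (closedBall x s))
    (h : ∀ y, ‖y‖ = s → ‖f (x + y) - c - bel a b y‖ ≤ (‖a‖ - ‖b‖) * κ * s) :
    (fun w => c + w) '' (bel a b '' ball 0 (s * (1 - κ))) ⊆ f '' closedBall x s := by
  rintro _ ⟨_, ⟨w, hw, rfl⟩, rfl⟩
  rw [mem_ball_zero_iff] at hw
  set L := belE a b hab
  have hL : ∀ v, L v = bel a b v := fun v => by rw [← coe_belE a b hab]; rfl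
  have hLi : ∀ v, (‖a‖ - ‖b‖) * ‖L.symm v‖ ≤ ‖v‖ := fun v => by
    have := norm_bel_apply_ge a b (L.symm v)
    rwa [← hL, L.apply_symm_apply] at this
  obtain ⟨y, hy, hy2⟩ := degree (u := fun y => L.symm (f (x + y) - c) - w) hs (by
    refine ContinuousOn.sub (L.symm.continuous.comp_continuousOn (ContinuousOn.sub ?_ continuousOn_const)) continuousOn_const
    refine hc.comp (by fun_prop) fun y hy => ?_
    simpa using hy) (fun y hy => by
      have h1 := h y hy
      have h2 := hLi (f (x + y) - c - bel a b y)
      rw [map_sub, ← hL, L.symm_apply_apply, hL] at h2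
      have h3 : ‖L.symm (f (x + y) - c) - y‖ ≤ κ * s := by
        have := h2.trans h1
        rw [mul_assoc] at this
        exact le_of_mul_le_mul_left this (sub_pos.2 hab)
      calc _ = ‖L.symm (f (x + y) - c) - y - w‖ := by congr 1; ring
        _ ≤ _ := norm_sub_le _ _
        _ < s := by linarith)
  refine ⟨x + y, by simpa using hy, ?_⟩
  have : L (L.symm (f (x + y) - c)) = L w := by rw [sub_eq_zero.1 hy2]
  rw [L.apply_symm_apply, hL] at this
  simp only [← this]; ring

lemma vol_lin {f : ℂ → ℂ} {x a b c : ℂ} {s κ : ℝ} (hs : 0 < s) (hκ : κ < 1)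
    (hab : ‖b‖ < ‖a‖) (hc : ContinuousOn f (closedBall x s))
    (h : ∀ y, ‖y‖ = s → ‖f (x + y) - c - bel a b y‖ ≤ (‖a‖ - ‖b‖) * κ * s) :
    ENNReal.ofReal ((‖a‖ ^ 2 - ‖b‖ ^ 2) * (1 - κ) ^ 2) * volume (closedBall x s) ≤ volume (f '' closedBall x s) := by
  refine le_trans (le_of_eq ?_) (measure_mono (cover_lin hs hab hc h))
  have hJ : 0 < ‖a‖ ^ 2 - ‖b‖ ^ 2 := by nlinarith [norm_nonneg a, norm_nonneg b]
  have h1 : volume ((fun w => c + w) '' (bel a b '' ball 0 (s * (1 - κ)))) = volume (bel a b '' ball 0 (s * (1 - κ))) := by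
    rw [image_add_left, measure_preimage_add]
  rw [h1, Measure.addHaar_image_continuousLinearMap, show LinearMap.det (bel a b : ℂ →ₗ[ℝ] ℂ) = ‖a‖ ^ 2 - ‖b‖ ^ 2 from det_bel a b, abs_of_pos hJ, Complex.volume_ball, Complex.volume_closedBall,
    ENNReal.ofReal_mul hJ.le, mul_assoc]
  congr 1
  rw [← mul_assoc]; congr 1
  rw [← ENNReal.ofReal_pow hs.le, ← ENNReal.ofReal_pow (by nlinarith), ← ENNReal.ofReal_mul (by positivity)]
  congr 1; ring

end

end

section
open Complex MeasureTheory Metric Set Filter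
open scoped ContDiff Topology ComplexConjugate Convolution
set_option linter.unnecessarySeqFocus false

noncomputable section

lemma small_leb {g : ℂ → ℂ} {x : ℂ}
    (h : Tendsto (fun r => (∫⁻ y in closedBall x r, ‖g y - g x‖ₑ) / volume (closedBall x r)) (𝓝[>] 0) (𝓝 0))
    {η : ℝ} (hη : 0 < η) : ∀ᶠ r in 𝓝[>] (0:ℝ), ∫⁻ y in closedBall x r, ‖g y - g x‖ₑ ≤ ENNReal.ofReal (η * r ^ 2) := by
  have h1 : (0:ENNReal) < ENNReal.ofReal (η / Real.pi) := by
    rw [ENNReal.ofReal_pos]; positivity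
  filter_upwards [h.eventually (Iio_mem_nhds h1), self_mem_nhdsWithin] with r hr hr0
  have hr0 : 0 < r := hr0
  have hr : _ < _ := hr
  rw [ENNReal.div_lt_iff (Or.inl (measure_closedBall_pos _ _ hr0).ne') (Or.inl measure_closedBall_lt_top.ne)] at hr
  refine hr.le.trans (le_of_eq ?_)
  rw [Complex.volume_closedBall, ← ENNReal.ofReal_pow hr0.le, ← ENNReal.ofReal_coe_nnreal, NNReal.coe_real_pi,
    ← ENNReal.ofReal_mul (by positivity), ← ENNReal.ofReal_mul (by positivity)]
  congr 1; field_simp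

lemma density {A : Set ℂ} {f g h : ℂ → ℂ} (hA : IsOpen A) (hw : WD A f g h) (hf : LocallyIntegrable f)
    (hg : Integrable g) (hh : Integrable h) (hgm : Measurable g) (hhm : Measurable h)
    (hc : ContinuousOn f A) (ν : Measure ℂ) [IsFiniteMeasure ν]
    (hν : ∀ x s, closedBall x s ⊆ A → volume (f '' closedBall x s) ≤ ν (closedBall x s))
    (hlt : ∀ᵐ x, x ∈ A → g x ≠ 0 → ‖h x‖ < ‖g x‖) (hz : ∀ᵐ x, x ∈ A → g x = 0 → h x = 0) :
    ∀ᵐ x, x ∈ A → ENNReal.ofReal (‖g x‖ ^ 2 - ‖h x‖ ^ 2) ≤ ν.rnDeriv volume x := by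
  filter_upwards [hlt, hz, (Besicovitch.vitaliFamily (volume : Measure ℂ)).ae_tendsto_lintegral_enorm_sub_div_of_integrable hg,
    (Besicovitch.vitaliFamily (volume : Measure ℂ)).ae_tendsto_lintegral_enorm_sub_div_of_integrable hh,
    Besicovitch.ae_tendsto_rnDeriv ν (volume : Measure ℂ)] with x hlt hz hg1 hh1 hn hx
  by_cases hg0 : g x = 0
  · simp [hg0, hz hx hg0]
  have hlt := hlt hx hg0
  replace hg1 := hg1.comp (Besicovitch.tendsto_filterAt volume x)
  replace hh1 := hh1.comp (Besicovitch.tendsto_filterAt volume x)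
  set J := ‖g x‖ ^ 2 - ‖h x‖ ^ 2 with hJ
  have key : ∀ κ ∈ Ioo (0:ℝ) 1, ENNReal.ofReal (J * (1 - κ) ^ 2) ≤ ν.rnDeriv volume x := by
    intro κ hκ
    by_contra! hcon
    set η := (‖g x‖ - ‖h x‖) * κ / 18 with hη
    have hη0 : 0 < η := by have := sub_pos.2 hlt; have := hκ.1; positivity
    have e1 := small_leb hg1 (η := η / 4) (by positivity)
    have e2 := small_leb hh1 (η := η / 4) (by positivity)
    have e3 := hn.eventually (Iio_mem_nhds hcon)
    have e4 : ∀ᶠ r in 𝓝[>] (0:ℝ), closedBall x r ⊆ A := by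
      obtain ⟨r, hr, hr2⟩ := Metric.nhds_basis_closedBall.mem_iff.1 (hA.mem_nhds hx)
      filter_upwards [Ioo_mem_nhdsGT hr] with t ht
      exact (closedBall_subset_closedBall ht.2.le).trans hr2
    obtain ⟨δ, hδ, hall⟩ := mem_nhdsGT_iff_exists_Ioo_subset.1 (e1.and (e2.and (e3.and e4)))
    have hδ : 0 < δ := hδ
    have hR : 0 < δ / 4 := by linarith
    have hin : 2 * (δ / 4) ∈ Ioo 0 δ := ⟨by linarith, by linarith⟩
    obtain ⟨a1, a2, -, a4⟩ := hall hin
    have hrw : η / 4 * (2 * (δ / 4)) ^ 2 = η * (δ / 4) ^ 2 := by ring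
    rw [hrw] at a1 a2
    obtain ⟨s, hs, c, hsc⟩ := approx_lin hw hf hg.locallyIntegrable hh.locallyIntegrable hgm hhm hR hη0 a4 (hc.mono a4) a1 a2
    have hs0 : 0 < s := by linarith [hs.1]
    obtain ⟨-, -, b3, b4⟩ := hall (show s ∈ Ioo 0 δ from ⟨hs0, by linarith [hs.2]⟩)
    have hv := vol_lin (κ := κ) hs0 hκ.2 hlt (hc.mono b4) (c := c) fun y hy => by
      refine (hsc y hy).trans (le_of_eq ?_)
      rw [hη]; ring
    have b3 : _ < _ := b3
    rw [ENNReal.div_lt_iff (Or.inl (measure_closedBall_pos _ _ hs0).ne') (Or.inl measure_closedBall_lt_top.ne)] at b3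
    exact absurd (b3.trans_le (hv.trans (hν x s b4))) (lt_irrefl _)
  have hlim : Tendsto (fun κ : ℝ => ENNReal.ofReal (J * (1 - κ) ^ 2)) (𝓝[>] 0) (𝓝 (ENNReal.ofReal J)) := by
    have : Continuous fun κ : ℝ => ENNReal.ofReal (J * (1 - κ) ^ 2) := ENNReal.continuous_ofReal.comp (by fun_prop)
    have := (this.tendsto 0).mono_left (nhdsWithin_le_nhds (s := Ioi 0))
    simpa using this
  exact le_of_tendsto hlim (by
    filter_upwards [Ioo_mem_nhdsGT (zero_lt_one' ℝ)] with κ hκ using key κ hκ)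

/-- energy bound on a subdisc -/
lemma energy_sub {A : Set ℂ} {f g h : ℂ → ℂ} (hA : IsOpen A) (hw : WD A f g h) (hf : LocallyIntegrable f)
    (hg : Integrable g) (hh : Integrable h) (hgm : Measurable g) (hhm : Measurable h)
    (hc : ContinuousOn f A) (ν : Measure ℂ) [IsFiniteMeasure ν]
    (hν : ∀ x s, closedBall x s ⊆ A → volume (f '' closedBall x s) ≤ ν (closedBall x s))
    {k : ℝ} (hk0 : 0 ≤ k) (hk : k < 1)
    (hlt : ∀ᵐ x, x ∈ A → ‖h x‖ ≤ k * ‖g x‖) :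
    ∫⁻ x in A, ENNReal.ofReal ((1 - k ^ 2) * ‖g x‖ ^ 2) ≤ ν univ := by
  have h1 := density hA hw hf hg hh hgm hhm hc ν hν
    (by filter_upwards [hlt] with x hx hxA h0
        have := norm_pos_iff.2 h0
        nlinarith [hx hxA])
    (by filter_upwards [hlt] with x hx hxA h0
        have := hx hxA; rw [h0] at this
        simpa using this)
  calc _ ≤ ∫⁻ x in A, ν.rnDeriv volume x := by
        refine setLIntegral_mono_ae' hA.measurableSet ?_
        filter_upwards [h1, hlt] with x hx hx2 hxA
        refine le_trans (ENNReal.ofReal_le_ofReal ?_) (hx hxA)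
        have := hx2 hxA
        have h3 : ‖h x‖ ^ 2 ≤ (k * ‖g x‖) ^ 2 := pow_le_pow_left₀ (norm_nonneg _) this 2
        nlinarith
    _ ≤ _ := Measure.setLIntegral_rnDeriv_le A
    _ ≤ ν univ := measure_mono (subset_univ _)

end

end

section
open Complex MeasureTheory Metric Set Filter
open scoped ContDiff Topology ComplexConjugate Convolution
set_option linter.unnecessarySeqFocus false

noncomputable section

lemma exists_nu {Ω : ℂ → ℂ} (hc : ContinuousOn Ω (ball 0 1)) (hb : BijOn Ω (ball 0 1) (ball 0 1)) :
    ∃ ν : Measure ℂ, ν univ = volume (ball (0:ℂ) 1) ∧ ∀ S ⊆ ball (0:ℂ) 1, MeasurableSet S → ν S = volume (Ω '' S) := by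
  have hE : MeasurableEmbedding ((ball (0:ℂ) 1).restrict Ω) := hc.measurableEmbedding measurableSet_ball hb.injOn
  have key : ∀ S, MeasurableSet S → Measure.map Subtype.val (Measure.comap ((ball (0:ℂ) 1).restrict Ω) volume) S =
      volume (Ω '' (S ∩ ball 0 1)) := by
    intro S hS
    rw [Measure.map_apply measurable_subtype_coe hS, hE.comap_apply]
    congr 1
    ext y
    constructor
    · rintro ⟨a, ha, rfl⟩; exact ⟨a, ⟨ha, a.2⟩, rfl⟩
    · rintro ⟨a, ⟨ha, ha2⟩, rfl⟩; exact ⟨⟨a, ha2⟩, ha, rfl⟩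
  refine ⟨Measure.map Subtype.val (Measure.comap ((ball (0:ℂ) 1).restrict Ω) volume), ?_, fun S hS hm => ?_⟩
  · rw [key _ MeasurableSet.univ, univ_inter, hb.image_eq]
  · rw [key _ hm, inter_eq_left.2 hS]

lemma sol_L2 {μ Ω g h : ℂ → ℂ} {k : ℝ} (hk0 : 0 ≤ k) (hk : k < 1)
    (hc : ContinuousOn Ω (ball 0 1)) (hb : BijOn Ω (ball 0 1) (ball 0 1))
    (hd : HasDistribWirtingerDerivs (ball 0 1) Ω g h)
    (hlt : ∀ᵐ z ∂(volume.restrict (ball (0:ℂ) 1)), ‖h z‖ ≤ k * ‖g z‖) :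
    MemLp g 2 (volume.restrict (ball (0:ℂ) 1)) := by
  obtain ⟨hg, hh, hw⟩ := hd
  have hga := hg.aestronglyMeasurable
  have hha := hh.aestronglyMeasurable
  set g0 := hga.mk g with hg0
  set h0 := hha.mk h with hh0
  have hgm : Measurable g0 := hga.stronglyMeasurable_mk.measurable
  have hhm : Measurable h0 := hha.stronglyMeasurable_mk.measurable
  have eg : g =ᵐ[volume.restrict (ball 0 1)] g0 := hga.ae_eq_mk
  have eh : h =ᵐ[volume.restrict (ball 0 1)] h0 := hha.ae_eq_mk
  have eg' := (ae_restrict_iff' measurableSet_ball).1 eg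
  have eh' := (ae_restrict_iff' measurableSet_ball).1 eh
  have hlt' := (ae_restrict_iff' measurableSet_ball).1 hlt
  obtain ⟨ν, hν1, hν2⟩ := exists_nu hc hb
  haveI : IsFiniteMeasure ν := ⟨by rw [hν1]; exact measure_ball_lt_top⟩
  have key : ∀ ρ < (1:ℝ), ∫⁻ x in ball 0 ρ, ENNReal.ofReal ((1 - k ^ 2) * ‖g0 x‖ ^ 2) ≤ ν univ := by
    intro ρ hρ
    set C := closedBall (0:ℂ) ρ
    have hC : C ⊆ ball 0 1 := closedBall_subset_ball hρ
    have hBC : ball (0:ℂ) ρ ⊆ C := ball_subset_closedBall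
    have int : ∀ u v : ℂ → ℂ, LocallyIntegrableOn u (ball 0 1) → u =ᵐ[volume.restrict (ball 0 1)] v →
        Integrable (C.indicator v) := by
      intro u v hu huv
      rw [integrable_indicator_iff measurableSet_closedBall]
      have h1 : IntegrableOn u C := (hu.mono_set hC).integrableOn_isCompact (isCompact_closedBall 0 ρ)
      exact h1.congr (ae_restrict_of_ae_restrict_of_subset hC huv)
    have hfi : Integrable (C.indicator Ω) := by
      rw [integrable_indicator_iff measurableSet_closedBall]
      exact (hc.mono hC).integrableOn_compact (isCompact_closedBall 0 ρ)
    have hind : ∀ u ψ : ℂ → ℂ, tsupport ψ ⊆ ball 0 ρ → ∫ z in ball 0 1, u z * ψ z = ∫ z, C.indicator u z * ψ z := by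
      intro u ψ hψ
      rw [← integral_indicator measurableSet_ball]
      congr 1; ext z
      by_cases hz : ψ z = 0
      · rw [hz, mul_zero]; exact indicator_apply_eq_zero.2 fun _ => by rw [hz, mul_zero]
      · have hz2 := hψ (subset_tsupport _ hz)
        rw [indicator_of_mem (hC (hBC hz2)), indicator_of_mem (hBC hz2)]
    have hcongr : ∀ u v ψ : ℂ → ℂ, u =ᵐ[volume.restrict (ball 0 1)] v → ∫ z in ball 0 1, u z * ψ z = ∫ z in ball 0 1, v z * ψ z := by
      intro u v ψ huv
      refine integral_congr_ae ?_
      filter_upwards [huv] with z hz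
      rw [hz]
    have hwd : WD (ball 0 ρ) (C.indicator Ω) (C.indicator g0) (C.indicator h0) := by
      intro φ hφ hs
      obtain ⟨w1, w2⟩ := hw φ hφ.1 hφ.2 (hs.trans (ball_subset_ball hρ.le))
      rw [hcongr g g0 φ eg, hind _ _ ((tsupport_wZ φ).trans hs), hind _ _ hs] at w1
      rw [hcongr h h0 φ eh, hind _ _ ((tsupport_wZBar φ).trans hs), hind _ _ hs] at w2
      exact ⟨w1, w2⟩
    have := energy_sub isOpen_ball hwd hfi.locallyIntegrable (int g g0 hg eg) (int h h0 hh eh)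
      (hgm.indicator measurableSet_closedBall) (hhm.indicator measurableSet_closedBall)
      ((hc.mono (hBC.trans hC)).congr fun z hz => indicator_of_mem (hBC hz) _) ν (fun x s hxs => by
        rw [hν2 _ (hxs.trans (hBC.trans hC)) measurableSet_closedBall]
        refine measure_mono (subset_of_eq ?_)
        exact image_congr fun z hz => indicator_of_mem (hBC (hxs hz)) _) hk0 hk (by
        filter_upwards [eg', eh', hlt'] with x h1 h2 h3 hx
        have hx1 := hC (hBC hx)
        rw [indicator_of_mem (hBC hx), indicator_of_mem (hBC hx), ← h1 hx1, ← h2 hx1]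
        exact h3 hx1)
    refine le_trans (le_of_eq ?_) this
    refine setLIntegral_congr_fun measurableSet_ball fun x hx => ?_
    simp only [indicator_of_mem (hBC hx)]
  have hU : ball (0:ℂ) 1 = ⋃ n, ball 0 (1 - rad n) := by
    ext z
    simp only [mem_iUnion, mem_ball_zero_iff]
    constructor
    · intro hz
      obtain ⟨n, hn⟩ := (rad_tendsto.eventually (Iio_mem_nhds (sub_pos.2 hz))).exists
      have hn : rad n < _ := hn
      exact ⟨n, by linarith⟩
    · rintro ⟨n, hn⟩; linarith [rad_pos n]
  have hmono : Monotone fun n => ball (0:ℂ) (1 - rad n) := by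
    intro m n hmn
    refine ball_subset_ball ?_
    have : rad n ≤ rad m := Nat.one_div_le_one_div hmn
    linarith
  have htot : ∫⁻ x in ball (0:ℂ) 1, ENNReal.ofReal ((1 - k ^ 2) * ‖g0 x‖ ^ 2) ≤ ν univ := by
    rw [hU, setLIntegral_iUnion_of_directed _ hmono.directed_le]
    exact iSup_le fun n => key _ (by linarith [rad_pos n])
  refine MemLp.ae_eq eg.symm ?_
  rw [memLp_two_iff_integrable_sq_norm hga.stronglyMeasurable_mk.aestronglyMeasurable]
  have hk2 : 0 < 1 - k ^ 2 := by nlinarith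
  have : Integrable (fun x => (1 - k ^ 2) * ‖g0 x‖ ^ 2) (volume.restrict (ball 0 1)) := by
    refine ⟨(measurable_const.mul (hgm.norm.pow_const 2)).aestronglyMeasurable, ?_⟩
    rw [hasFiniteIntegral_iff_ofReal (Eventually.of_forall fun x => by positivity)]
    exact htot.trans_lt (measure_lt_top _ _)
  have := this.const_mul (1 - k ^ 2)⁻¹
  refine this.congr (Eventually.of_forall fun x => ?_)
  simp only; rw [inv_mul_cancel_left₀ hk2.ne']

end

end

section
open Complex MeasureTheory Metric Set Filter
open scoped ContDiff Topology ComplexConjugate Convolution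
set_option linter.unnecessarySeqFocus false

noncomputable section

lemma moll_T {ψ : ℂ → ℂ} (hψ : Continuous ψ) : TendstoUniformlyOn (fun n => moll n ψ) ψ atTop (ball 0 1) := by
  rw [Metric.tendstoUniformlyOn_iff]
  intro ε hε
  filter_upwards [moll_unif hψ.locallyIntegrable (x := 0) (R := 1) (R' := 2) (by norm_num) (half_pos hε) hψ.continuousOn] with n hn z hz
  rw [dist_comm, dist_eq_norm]
  linarith [hn z (ball_subset_closedBall hz)]

lemma moll_supp {ψ : ℂ → ℂ} {ρ ρ' : ℝ} {n : ℕ} (hs : ∀ z, ρ < ‖z‖ → ψ z = 0) (hn : ρ + rad n ≤ ρ') :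
    ∀ z, ρ' < ‖z‖ → moll n ψ z = 0 := by
  intro z hz
  rw [moll_apply]
  refine integral_eq_zero_of_ae (Eventually.of_forall fun t => ?_)
  by_cases ht : rad n ≤ ‖t‖
  · simp [mker_eq_zero ht]
  · have : ρ < ‖z - t‖ := by
      have := norm_sub_norm_le z t
      push Not at ht; linarith
    simp [hs _ this]

lemma lim_int {u : ℂ → ℂ} (hu : LocallyIntegrableOn u (ball 0 1)) {ψ : ℂ → ℂ} (hψ : Continuous ψ) {ρ : ℝ} (hρ : ρ < 1)
    (hs : ∀ z, ρ < ‖z‖ → ψ z = 0) {B : ℝ} (hB : ∀ z, ‖ψ z‖ ≤ B) :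
    Tendsto (fun n => ∫ z in ball 0 1, u z * moll n ψ z) atTop (𝓝 (∫ z in ball 0 1, u z * ψ z)) := by
  set ρ' := (1 + ρ) / 2
  set C := closedBall (0:ℂ) ρ' with hCd
  have hC : C ⊆ ball 0 1 := closedBall_subset_ball (by simp only [ρ']; linarith)
  have hui : IntegrableOn (C.indicator u) (ball 0 1) := by
    refine Integrable.integrableOn ?_
    rw [integrable_indicator_iff measurableSet_closedBall]
    exact (hu.mono_set hC).integrableOn_isCompact (isCompact_closedBall 0 ρ')
  have h1 := unif_int (moll_T hψ) (fun n => (moll_contDiff n hψ.locallyIntegrable).continuous.continuousOn) hψ.continuousOn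
    (C := B) (fun n z _ => moll_norm_le n hB z) (fun z _ => hB z) hui
  have hcut : ∀ η : ℂ → ℂ, (∀ z, ρ' < ‖z‖ → η z = 0) → ∀ z, η z * C.indicator u z = u z * η z := by
    intro η hη z
    by_cases hz : z ∈ C
    · rw [indicator_of_mem hz, mul_comm]
    · rw [hη z (by simpa [hCd] using hz)]; simp
  have hρ' : ∀ z, ρ' < ‖z‖ → ψ z = 0 := fun z hz => hs z (lt_trans (by simp only [ρ']; linarith) hz)
  simp only [hcut ψ hρ'] at h1
  refine h1.congr' ?_
  filter_upwards [rad_tendsto.eventually (Iio_mem_nhds (show (0:ℝ) < (1 - ρ) / 2 by linarith))] with n hn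
  have hn : rad n < _ := hn
  simp only [hcut _ (moll_supp hs (n := n) (ρ' := ρ') (by simp only [ρ']; linarith))]

lemma wd_self {φ : ℂ → ℂ} (hφ : ContDiff ℝ 1 φ) : WD univ φ (wirtingerZ φ) (wirtingerZBar φ) := by
  intro ψ hψ _
  have := ibp_C1 (A := univ) (fun z _ => hφ.contDiffAt) (hψ.1.of_le (by exact_mod_cast le_top)) hψ.2 (subset_univ _)
  simpa using this

lemma wd_C1 {O g h φ : ℂ → ℂ} (hd : HasDistribWirtingerDerivs (ball 0 1) O g h) (hc : ContinuousOn O (ball 0 1))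
    (hφ : ContDiff ℝ 1 φ) (hcs : HasCompactSupport φ) (hs : tsupport φ ⊆ ball 0 1) :
    (∫ z in ball 0 1, O z * wirtingerZ φ z) = -(∫ z in ball 0 1, g z * φ z) ∧
    (∫ z in ball 0 1, O z * wirtingerZBar φ z) = -(∫ z in ball 0 1, h z * φ z) := by
  obtain ⟨hg, hh, hw⟩ := hd
  have hO : LocallyIntegrableOn O (ball 0 1) := hc.locallyIntegrableOn measurableSet_ball
  have hcpt : IsCompact (tsupport φ) := hcs
  obtain ⟨ρ, hρ, hsρ⟩ : ∃ ρ < (1:ℝ), tsupport φ ⊆ closedBall 0 ρ := by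
    rcases (tsupport φ).eq_empty_or_nonempty with he | hne
    · exact ⟨0, one_pos, by rw [he]; exact empty_subset _⟩
    obtain ⟨z, hz, hm⟩ := hcpt.exists_isMaxOn hne continuous_norm.continuousOn
    exact ⟨‖z‖, by simpa using hs hz, fun w hw => by simpa using hm hw⟩
  have off : ∀ z, ρ < ‖z‖ → z ∉ tsupport φ := fun z hz hz2 => by
    have := hsρ hz2; simp at this; linarith
  have wc : Continuous (wirtingerZ φ) := (contDiff_wZ (m := 0) hφ (by simp)).continuous
  have wbc : Continuous (wirtingerZBar φ) := (contDiff_wZBar (m := 0) hφ (by simp)).continuous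
  have bd : ∀ ψ : ℂ → ℂ, Continuous ψ → tsupport ψ ⊆ tsupport φ → ∃ B, ∀ z, ‖ψ z‖ ≤ B := fun ψ h1 h2 =>
    HasCompactSupport.exists_bound_of_continuous (hcpt.of_isClosed_subset (isClosed_tsupport _) h2) h1
  have lim : ∀ u ψ : ℂ → ℂ, LocallyIntegrableOn u (ball 0 1) → Continuous ψ → tsupport ψ ⊆ tsupport φ →
      Tendsto (fun n => ∫ z in ball 0 1, u z * moll n ψ z) atTop (𝓝 (∫ z in ball 0 1, u z * ψ z)) := by
    intro u ψ hu hψ hsp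
    obtain ⟨B, hB⟩ := bd ψ hψ hsp
    exact lim_int hu hψ hρ (fun z hz => image_eq_zero_of_notMem_tsupport fun h => off z hz (hsp h)) hB
  have hfd : ∀ n y, HasFDerivAt (moll n φ) (bel (moll n (wirtingerZ φ) y) (moll n (wirtingerZBar φ) y)) y := fun n y =>
    moll_wd (wd_self hφ) hφ.continuous.locallyIntegrable (subset_univ _)
  have e1 : ∀ n, wirtingerZ (moll n φ) = moll n (wirtingerZ φ) := fun n => funext fun y => wirtingerZ_of_hasFDerivAt (hfd n y)
  have e2 : ∀ n, wirtingerZBar (moll n φ) = moll n (wirtingerZBar φ) := fun n => funext fun y => wirtingerZBar_of_hasFDerivAt (hfd n y)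
  have ev : ∀ᶠ n in atTop, (∫ z in ball 0 1, O z * moll n (wirtingerZ φ) z) = -(∫ z in ball 0 1, g z * moll n φ z) ∧
      (∫ z in ball 0 1, O z * moll n (wirtingerZBar φ) z) = -(∫ z in ball 0 1, h z * moll n φ z) := by
    filter_upwards [rad_tendsto.eventually (Iio_mem_nhds (show (0:ℝ) < (1 - ρ) / 2 by linarith))] with n hn
    have hn : rad n < _ := hn
    have h0 := moll_supp (ψ := φ) (ρ := ρ) (ρ' := (1 + ρ) / 2) (n := n)
      (fun z hz => image_eq_zero_of_notMem_tsupport (off z hz)) (by linarith)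
    have hsup : tsupport (moll n φ) ⊆ closedBall 0 ((1 + ρ) / 2) := by
      refine closure_minimal (fun z hz => ?_) isClosed_closedBall
      by_contra hcon
      exact hz (h0 z (by simpa using hcon))
    rw [← e1, ← e2]
    exact hw _ (moll_contDiff n hφ.continuous.locallyIntegrable)
      ((isCompact_closedBall _ _).of_isClosed_subset (isClosed_tsupport _) hsup)
      (hsup.trans (closedBall_subset_ball (by linarith)))
  exact ⟨tendsto_nhds_unique_of_eventuallyEq (lim _ _ hO wc (tsupport_wZ φ)) (lim _ _ hg hφ.continuous subset_rfl).neg (ev.mono fun n h => h.1),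
    tendsto_nhds_unique_of_eventuallyEq (lim _ _ hO wbc (tsupport_wZBar φ)) (lim _ _ hh hφ.continuous subset_rfl).neg (ev.mono fun n h => h.2)⟩

end

end

section
open Complex MeasureTheory Metric Set Filter
open scoped ContDiff Topology ComplexConjugate Convolution
set_option linter.unnecessarySeqFocus false

noncomputable section

lemma contDiffAt_wZ {F : ℂ → ℂ} {z : ℂ} (h : ContDiffAt ℝ 2 F z) :
    ContDiffAt ℝ 1 (wirtingerZ F) z ∧ ContDiffAt ℝ 1 (wirtingerZBar F) z := by
  have h1 : ContDiffAt ℝ 1 (fderiv ℝ F) z := h.fderiv_right (by norm_num)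
  have h2 : ∀ v : ℂ, ContDiffAt ℝ 1 (fun y => fderiv ℝ F y v) z := fun v => h1.clm_apply contDiffAt_const
  exact ⟨((h2 1).sub (contDiffAt_const.mul (h2 I))).div_const 2, ((h2 1).add (contDiffAt_const.mul (h2 I))).div_const 2⟩

lemma wZ_symm {F : ℂ → ℂ} {z : ℂ} (h : ContDiffAt ℝ 2 F z) :
    wirtingerZBar (wirtingerZ F) z = wirtingerZ (wirtingerZBar F) z := by
  have hs := h.isSymmSndFDerivAt (by simp)
  have h1 : DifferentiableAt ℝ (fderiv ℝ F) z := (h.fderiv_right (m := 1) (by norm_num)).differentiableAt (by simp)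
  have h2 : ∀ v : ℂ, HasFDerivAt (fun y => fderiv ℝ F y v) ((fderiv ℝ (fderiv ℝ F) z).flip v) z := fun v => by
    have := h1.hasFDerivAt.clm_apply (hasFDerivAt_const v z)
    simpa using this
  have e1 : HasFDerivAt (wirtingerZ F) ((2:ℂ)⁻¹ • ((fderiv ℝ (fderiv ℝ F) z).flip 1 - I • (fderiv ℝ (fderiv ℝ F) z).flip I)) z := by
    have := ((h2 1).sub ((h2 I).const_mul I)).const_mul ((2:ℂ)⁻¹)
    convert! this using 1
    ext y; rw [wirtingerZ]; simp; ring
  have e2 : HasFDerivAt (wirtingerZBar F) ((2:ℂ)⁻¹ • ((fderiv ℝ (fderiv ℝ F) z).flip 1 + I • (fderiv ℝ (fderiv ℝ F) z).flip I)) z := by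
    have := ((h2 1).add ((h2 I).const_mul I)).const_mul ((2:ℂ)⁻¹)
    convert! this using 1
    ext y; rw [wirtingerZBar]; simp; ring
  rw [wirtingerZBar, wirtingerZ, e1.fderiv, e2.fderiv]
  have := hs 1 I
  simp [this]; ring

/-- pull back of a test function -/
lemma pullback {μ F G ψ : ℂ → ℂ} (N : Nice μ F G) (hψ : Test ψ) (hs : tsupport ψ ⊆ ball 0 1) :
    ∃ θ : ℂ → ℂ, ContDiff ℝ 2 θ ∧ HasCompactSupport θ ∧ tsupport θ ⊆ ball 0 1 ∧ ∀ z ∈ ball (0:ℂ) 1, θ z = ψ (F z) := by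
  set θ : ℂ → ℂ := (ball (0:ℂ) 1).indicator fun z => ψ (F z) with hθ
  have hGc : ContinuousOn G (tsupport ψ) := fun z hz =>
    (N.gs z (by simpa using (hs.trans ball_subset_closedBall) hz)).continuousAt.continuousWithinAt
  have hK : IsCompact (G '' tsupport ψ) := IsCompact.image_of_continuousOn hψ.2 hGc
  have hKb : G '' tsupport ψ ⊆ ball 0 1 := by
    rintro _ ⟨z, hz, rfl⟩
    simpa using N.gb z (by simpa using hs hz)
  have hsup : tsupport θ ⊆ G '' tsupport ψ := by
    refine closure_minimal (fun z hz => ?_) hK.isClosed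
    have hzb : z ∈ ball (0:ℂ) 1 := by
      by_contra hcon; exact hz (indicator_of_notMem hcon _)
    refine ⟨F z, subset_tsupport _ ?_, N.gf z (by simpa using ball_subset_closedBall hzb)⟩
    intro h0; apply hz; rw [hθ, indicator_of_mem hzb, h0]
  refine ⟨θ, contDiff_iff_contDiffAt.2 fun z => ?_, hK.of_isClosed_subset (isClosed_tsupport _) hsup, hsup.trans hKb,
    fun z hz => indicator_of_mem hz _⟩
  by_cases hz : z ∈ ball (0:ℂ) 1
  · have : ContDiffAt ℝ 2 (fun z => ψ (F z)) z :=
      ((contDiff_infty.1 hψ.1 2).contDiffAt).comp z (N.fs z (by simpa using ball_subset_closedBall hz))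
    refine this.congr_of_eventuallyEq ?_
    filter_upwards [isOpen_ball.mem_nhds hz] with y hy using indicator_of_mem hy _
  · have : θ =ᶠ[𝓝 z] fun _ => 0 := by
      have hz' : z ∉ tsupport θ := fun h => hz (hKb (hsup h))
      exact notMem_tsupport_iff_eventuallyEq.1 hz'
    exact contDiffAt_const.congr_of_eventuallyEq this

lemma chain_id {F θ ψ : ℂ → ℂ} {z : ℂ} (hF : ContDiffAt ℝ 2 F z) (hψ : DifferentiableAt ℝ ψ (F z)) (hθ : DifferentiableAt ℝ θ z)
    (he : θ =ᶠ[𝓝 z] fun z => ψ (F z)) :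
    wirtingerZBar (fun z => wirtingerZ F z * θ z) z - wirtingerZ (fun z => wirtingerZBar F z * θ z) z =
      wirtingerZBar ψ (F z) * ((‖wirtingerZ F z‖ ^ 2 - ‖wirtingerZBar F z‖ ^ 2 : ℝ) : ℂ) := by
  have h1 := (contDiffAt_wZ hF).1.differentiableAt (by simp)
  have h2 := (contDiffAt_wZ hF).2.differentiableAt (by simp)
  have hd : HasFDerivAt θ _ z := ((hasFDerivAt_bel hψ).comp z (hasFDerivAt_bel (hF.differentiableAt (by simp)))).congr_of_eventuallyEq he
  rw [bel_comp] at hd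
  rw [wZBar_mul h1 hθ, wZ_mul h2 hθ, wZ_symm hF, wirtingerZ_of_hasFDerivAt hd, wirtingerZBar_of_hasFDerivAt hd]
  push_cast
  rw [← Complex.mul_conj', ← Complex.mul_conj']
  ring


lemma pull_int {μ m F G ψ O g h : ℂ → ℂ} (N : Nice m F G) (hψ : Test ψ) (hs : tsupport ψ ⊆ ball 0 1)
    (hm : ∀ z, ‖m z‖ < 1) (hd : HasDistribWirtingerDerivs (ball 0 1) O g h) (hc : ContinuousOn O (ball 0 1))
    (hμ : ∀ᵐ z ∂(volume.restrict (ball (0:ℂ) 1)), h z = μ z * g z)  :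
    (∫ w in ball 0 1, O (G w) * wirtingerZBar ψ w) =
      ∫ z in ball 0 1, (wirtingerZ F z * ψ (F z)) * ((m z - μ z) * g z) := by
  obtain ⟨θ, hθ, hθc, hθs, hθe⟩ := pullback N hψ hs
  have hle : ∀ z ∈ ball (0:ℂ) 1, ‖z‖ ≤ 1 := fun z hz => by simpa using ball_subset_closedBall hz
  have hFs : ∀ z ∈ ball (0:ℂ) 1, ContDiffAt ℝ 2 F z := fun z hz => N.fs z (hle z hz)
  have hθ1 : ContDiff ℝ 1 θ := hθ.of_le (by norm_num)
  set P : ℂ → ℂ := fun z => wirtingerZ F z * θ z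
  set Q : ℂ → ℂ := fun z => wirtingerZBar F z * θ z
  have hP : ContDiff ℝ 1 P := contDiff_mul_supp (fun z hz => (contDiffAt_wZ (hFs z hz)).1) (fun z _ => hθ1.contDiffAt) hθs
  have hQ : ContDiff ℝ 1 Q := contDiff_mul_supp (fun z hz => (contDiffAt_wZ (hFs z hz)).2) (fun z _ => hθ1.contDiffAt) hθs
  have hPc : HasCompactSupport P := hθc.mul_left
  have hQc : HasCompactSupport Q := hθc.mul_left
  have hPs : tsupport P ⊆ ball 0 1 := (tsupport_mul_subset_right).trans hθs
  have hQs : tsupport Q ⊆ ball 0 1 := (tsupport_mul_subset_right).trans hθs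
  have w1 := (wd_C1 hd hc hP hPc hPs).2
  have w2 := (wd_C1 hd hc hQ hQc hQs).1
  have himg : F '' ball 0 1 = ball 0 1 := by
    apply Subset.antisymm
    · rintro _ ⟨z, hz, rfl⟩; simpa using N.fb z (by simpa using hz)
    · intro w hw; exact ⟨G w, by simpa using N.gb w (by simpa using hw), N.fg w (hle w hw)⟩
  have hinj : InjOn F (ball 0 1) := fun x hx y hy hxy => by
    rw [← N.gf x (hle x hx), ← N.gf y (hle y hy), hxy]
  have hcv := integral_image_eq_integral_abs_det_fderiv_smul volume measurableSet_ball (f := F) (s := ball 0 1)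
    (fun z hz => (hasFDerivAt_bel ((hFs z hz).differentiableAt (by simp))).hasFDerivWithinAt) hinj
    (fun w => O (G w) * wirtingerZBar ψ w)
  rw [himg] at hcv
  rw [hcv]
  have hpt : ∀ z ∈ ball (0:ℂ) 1, |(bel (wirtingerZ F z) (wirtingerZBar F z)).det| • (O (G (F z)) * wirtingerZBar ψ (F z)) =
      O z * wirtingerZBar P z - O z * wirtingerZ Q z := by
    intro z hz
    have hid := chain_id (θ := θ) (ψ := ψ) (hFs z hz) (hψ.1.differentiable (by simp) _) (hθ1.differentiable (by simp) z) (by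
      filter_upwards [isOpen_ball.mem_nhds hz] with y hy using hθe y hy)
    have hJ : 0 ≤ ‖wirtingerZ F z‖ ^ 2 - ‖wirtingerZBar F z‖ ^ 2 := by
      rw [N.wZBar (hle z hz), norm_mul, mul_pow]
      have h1 := hm z
      have h2 : ‖m z‖ ^ 2 ≤ 1 := pow_le_one₀ (norm_nonneg _) h1.le
      nlinarith [sq_nonneg ‖wirtingerZ F z‖]
    rw [det_bel, abs_of_nonneg hJ, N.gf z (hle z hz), ← mul_sub, hid, Complex.real_smul]
    ring
  rw [setIntegral_congr_fun measurableSet_ball hpt]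
  have intO : ∀ ψ : ℂ → ℂ, ∀ u : ℂ → ℂ, LocallyIntegrableOn u (ball 0 1) → Continuous ψ → HasCompactSupport ψ → tsupport ψ ⊆ ball 0 1 →
      IntegrableOn (fun z => u z * ψ z) (ball 0 1) := by
    intro ψ u hu hψc hψs hψb
    have h1 : IntegrableOn u (tsupport ψ) := (hu.mono_set hψb).integrableOn_isCompact hψs
    have h2 : IntegrableOn (fun z => u z * ψ z) (tsupport ψ) := h1.mul_continuousOn hψc.continuousOn hψs
    refine IntegrableOn.mono_set (t := univ) ?_ (subset_univ _)
    refine (integrableOn_iff_integrable_of_support_subset (fun z hz => subset_tsupport _ fun h0 => hz ?_)).1 h2 |>.integrableOn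
    simp [h0]
  have hO : LocallyIntegrableOn O (ball 0 1) := hc.locallyIntegrableOn measurableSet_ball
  rw [integral_sub
    (intO _ _ hO (contDiff_wZBar (m := 0) hP (by simp)).continuous (hPc.of_isClosed_subset (isClosed_tsupport _) (tsupport_wZBar P)) ((tsupport_wZBar P).trans hPs))
    (intO _ _ hO (contDiff_wZ (m := 0) hQ (by simp)).continuous (hQc.of_isClosed_subset (isClosed_tsupport _) (tsupport_wZ Q)) ((tsupport_wZ Q).trans hQs)),
    w1, w2, neg_sub_neg, ← integral_sub (intO _ _ hd.1 hQ.continuous hQc hQs) (intO _ _ hd.2.1 hP.continuous hPc hPs)]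
  refine integral_congr_ae ?_
  filter_upwards [hμ, ae_restrict_mem measurableSet_ball] with z hz hzb
  simp only [P, Q]
  rw [hz, hθe z hzb, N.wZBar (hle z hzb)]
  ring

end

end

section
open Complex MeasureTheory Metric Set Filter
open scoped ContDiff Topology ComplexConjugate Convolution
set_option linter.unnecessarySeqFocus false

noncomputable section

lemma Appr.weyl {k : ℝ} {U : Ultrafilter ℕ} {μ : ℂ → ℂ} {m f g : ℕ → ℂ → ℂ} {F G : ℂ → ℂ}
    (A : Appr k U μ m f g F G) (hU : (U : Filter ℕ) ≤ atTop) (hμ : Measurable μ) (bμ : ∀ z, ‖μ z‖ ≤ k)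
    (hk0 : 0 ≤ k) (hk : k < 1) {O p q : ℂ → ℂ} (hd : HasDistribWirtingerDerivs (ball 0 1) O p q)
    (hc : ContinuousOn O (closedBall 0 1)) (hO : ∀ z, ‖z‖ ≤ 1 → ‖O z‖ ≤ 1)
    (hq : ∀ᵐ z ∂(volume.restrict (ball (0:ℂ) 1)), q z = μ z * p z)
    (hp : MemLp p 2 (volume.restrict (ball (0:ℂ) 1))) {ψ : ℂ → ℂ} (hψ : Test ψ) (hs : tsupport ψ ⊆ ball 0 1) :
    ∫ w in ball 0 1, O (G w) * wirtingerZBar ψ w = 0 := by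
  have hle : ∀ z ∈ ball (0:ℂ) 1, ‖z‖ ≤ 1 := fun z hz => by simpa using ball_subset_closedBall hz
  have hle' : ∀ z ∈ closedBall (0:ℂ) 1, ‖z‖ ≤ 1 := fun z hz => by simpa using hz
  have bsub : ball (0:ℂ) 1 ⊆ closedBall 0 1 := ball_subset_closedBall
  have hmapg : ∀ n, ∀ z ∈ closedBall (0:ℂ) 1, g n z ∈ closedBall (0:ℂ) 1 := fun n z hz => by
    simpa using (A.nice n).gc z (hle' z hz)
  have hmapG : ∀ z ∈ closedBall (0:ℂ) 1, G z ∈ closedBall (0:ℂ) 1 := fun z hz => by simpa using A.bg z (hle' z hz)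
  have hu : TendstoUniformlyOn (fun n z => O (g n z)) (fun z => O (G z)) U (closedBall 0 1) :=
    UniformContinuousOn.comp_tendstoUniformlyOn_eventually (Eventually.of_forall hmapg) hmapG
      ((isCompact_closedBall (0:ℂ) 1).uniformContinuousOn_of_continuous hc) A.ug
  have hcg : ∀ n, ContinuousOn (g n) (closedBall 0 1) := fun n z hz =>
    ((A.nice n).gs z (hle' z hz)).continuousAt.continuousWithinAt
  have hcf : ∀ n, ContinuousOn (f n) (closedBall 0 1) := fun n z hz =>
    ((A.nice n).fs z (hle' z hz)).continuousAt.continuousWithinAt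
  have l1 := unif_int (hu.mono bsub) (fun n => (hc.comp (hcg n) (hmapg n)).mono bsub)
    ((hc.comp A.cg hmapG).mono bsub) (C := 1)
    (fun n z hz => hO _ (hle' _ (hmapg n z (bsub hz)))) (fun z hz => hO _ (hle' _ (hmapG z (bsub hz))))
    (ψ := wirtingerZBar ψ) ((hψ.wZBar.1.continuous.integrable_of_hasCompactSupport hψ.wZBar.2).integrableOn)
  obtain ⟨B, hB⟩ := HasCompactSupport.exists_bound_of_continuous hψ.2 hψ.1.continuous
  have hB0 : 0 ≤ B := (norm_nonneg _).trans (hB 0)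
  have hae : ∀ᵐ z ∂(volume.restrict (ball (0:ℂ) 1)), Tendsto (fun n => m n z) atTop (𝓝 (μ z)) :=
    (ae_restrict_iff' measurableSet_ball).2 A.ae
  have hD := dct_n2 (hp.const_mul (B:ℂ)) (fun n => (A.test n).1.continuous.measurable) hμ A.bd bμ hae
  have hcmp : ∀ n z, ‖ψ (f n z) * ((m n z - μ z) * p z)‖ ≤ ‖(m n z - μ z) * ((B:ℂ) * p z)‖ := fun n z => by
    rw [norm_mul, norm_mul, norm_mul, norm_mul, Complex.norm_real, Real.norm_of_nonneg hB0]
    have := mul_le_mul_of_nonneg_right (hB (f n z)) (by positivity : 0 ≤ ‖m n z - μ z‖ * ‖p z‖)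
    linarith
  have hw : ∀ n, MemLp (fun z => ψ (f n z) * ((m n z - μ z) * p z)) 2 (volume.restrict (ball (0:ℂ) 1)) := fun n => by
    refine (hD.1 n).of_le ?_ (Eventually.of_forall (hcmp n))
    exact ((hψ.1.continuous.comp_continuousOn ((hcf n).mono bsub)).aestronglyMeasurable measurableSet_ball).mul
      ((((A.test n).1.continuous.measurable.sub hμ).aestronglyMeasurable).mul hp.1)
  have hw0 : Tendsto (fun n => n2 (volume.restrict (ball (0:ℂ) 1)) (fun z => ψ (f n z) * ((m n z - μ z) * p z))) atTop (𝓝 0) :=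
    squeeze_zero (fun n => n2_nonneg _ _) (fun n => n2_mono (hD.1 n) (hcmp n)) hD.2
  have l2 := (cs_tendsto (fun n => ((A.nice n).memLp hk0 hk (A.bd n)).1) (fun n => ((A.nice n).memLp hk0 hk (A.bd n)).2) hw hw0).mono_left hU
  refine tendsto_nhds_unique l1 (l2.congr fun n => ?_)
  rw [pull_int (A.nice n) hψ hs (fun z => (A.bd n z).trans_lt hk) hd (hc.mono bsub) hq]
  simp only [mul_assoc]

lemma weyl_holo {Φ : ℂ → ℂ} (hc : ContinuousOn Φ (closedBall 0 1))
    (h0 : ∀ ψ, Test ψ → tsupport ψ ⊆ ball 0 1 → ∫ w in ball 0 1, Φ w * wirtingerZBar ψ w = 0) :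
    DifferentiableOn ℂ Φ (ball 0 1) := by
  set f := (closedBall (0:ℂ) 1).indicator Φ with hf
  have hfe : ∀ z ∈ ball (0:ℂ) 1, f z = Φ z := fun z hz => indicator_of_mem (ball_subset_closedBall hz) _
  have hfi : Integrable f := by
    rw [hf, integrable_indicator_iff measurableSet_closedBall]
    exact hc.integrableOn_compact (isCompact_closedBall 0 1)
  have hfl := hfi.locallyIntegrable
  have key : ∀ n y, closedBall y (rad n) ⊆ ball 0 1 → DifferentiableAt ℂ (moll n f) y := by
    intro n y hy
    have hd : DifferentiableAt ℝ (moll n f) y := (moll_contDiff n hfl).differentiable (by simp) y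
    have hi : ∀ v, Integrable fun t => f t * ((fderiv ℝ (mker n) (y - t) v : ℝ) : ℂ) := by
      intro v
      have h1 : (fun t => f t * ((fderiv ℝ (mker n) (y - t) v : ℝ) : ℂ)) =
          fun t => -(fderiv ℝ (fun t => (mker n (y - t) : ℂ)) t v • f t) := by
        ext t; rw [fderiv_ker]; simp [mul_comm]
      rw [h1]
      have hT := (test_ker n y).1
      refine (hfl.integrable_smul_left_of_hasCompactSupport ?_ (hT.2.fderiv_apply ℝ v)).neg
      exact (hT.1.continuous_fderiv (by simp)).clm_apply continuous_const
    have hts := (test_ker n y).2.trans hy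
    have w := h0 _ (test_ker n y).1 hts
    have e2 : wirtingerZBar (moll n f) y = 0 := by
      rw [wirtingerZBar, moll_fderiv n hfl, moll_fderiv n hfl, ← integral_const_mul,
        ← integral_add (hi 1) ((hi I).const_mul I), ← integral_div, ← neg_eq_zero, ← integral_neg, ← w,
        ← integral_indicator measurableSet_ball]
      congr 1; ext t
      by_cases ht : t ∈ ball (0:ℂ) 1
      · rw [indicator_of_mem ht, hfe t ht, wirtingerZBar, fderiv_ker, fderiv_ker]; ring
      · rw [indicator_of_notMem ht]
        have h1 : wirtingerZBar (fun t => (mker n (y - t) : ℂ)) t = 0 :=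
          image_eq_zero_of_notMem_tsupport fun h => ht (hts (tsupport_wZBar _ h))
        rw [wirtingerZBar, fderiv_ker, fderiv_ker] at h1
        linear_combination (f t) * h1
    have hb := hasFDerivAt_bel hd
    rw [e2] at hb
    have hcx : HasFDerivAt (𝕜 := ℂ) (moll n f) ((wirtingerZ (moll n f) y) • (1 : ℂ →L[ℂ] ℂ)) y :=
      hasFDerivAt_of_restrictScalars ℝ hb (by ext v <;> simp)
    exact hcx.differentiableAt
  intro x hx
  obtain ⟨R, hR0, hR⟩ : ∃ R > 0, closedBall x (3 * R) ⊆ ball 0 1 := by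
    obtain ⟨r, hr, hr2⟩ := Metric.nhds_basis_closedBall.mem_iff.1 (isOpen_ball.mem_nhds hx)
    exact ⟨r / 3, by positivity, by convert hr2 using 2; ring⟩
  have hfc : ContinuousOn f (closedBall x (2 * R)) := by
    have : closedBall x (2 * R) ⊆ ball 0 1 := (closedBall_subset_closedBall (by linarith)).trans hR
    exact (hc.mono (this.trans ball_subset_closedBall)).congr fun z hz => hfe z (this hz)
  have hT : TendstoUniformlyOn (fun n => moll n f) f atTop (ball x R) := by
    rw [Metric.tendstoUniformlyOn_iff]
    intro ε hε
    filter_upwards [moll_unif hfl (x := x) (R := R) (R' := 2 * R) (by linarith) (half_pos hε) hfc] with n hn z hz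
    rw [dist_comm, dist_eq_norm]
    linarith [hn z (ball_subset_closedBall hz)]
  have hdf : DifferentiableOn ℂ f (ball x R) := by
    refine hT.tendstoLocallyUniformlyOn.differentiableOn ?_ isOpen_ball
    filter_upwards [rad_tendsto.eventually (Iio_mem_nhds hR0)] with n hn y hy
    have hn : rad n < R := hn
    refine (key n y ((closedBall_subset_closedBall' ?_).trans hR)).differentiableWithinAt
    rw [mem_ball] at hy; linarith
  have hda := hdf.differentiableAt (ball_mem_nhds x hR0)
  refine (hda.congr_of_eventuallyEq ?_).differentiableWithinAt
  filter_upwards [isOpen_ball.mem_nhds hx] with z hz using (hfe z hz).symm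

end

end

section
open Complex MeasureTheory Metric Set Filter
open scoped Topology ComplexConjugate
noncomputable section

theorem not_ev_const {Φ : ℂ → ℂ} (hb : BijOn Φ (ball 0 1) (ball 0 1)) {p : ℂ} (hp : p ∈ ball (0:ℂ) 1)
    (h : ∀ᶠ z in 𝓝 p, Φ z = Φ p) : False := by
  have h2 : ∀ᶠ z in 𝓝 p, z = p := by
    filter_upwards [h, isOpen_ball.mem_nhds hp] with z h1 h2 using hb.injOn h2 hp h1
  have h3 : {p} ∈ 𝓝 p := h2
  have : (𝓝[≠] p).NeBot := inferInstance
  have h4 : ∀ᶠ z in 𝓝[≠] p, False := by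
    filter_upwards [nhdsWithin_le_nhds h2, self_mem_nhdsWithin] with z h1 h2 using h2 h1
  exact h4.exists.elim fun _ h => h

theorem inv_holo {Φ H : ℂ → ℂ} (hd : DifferentiableOn ℂ Φ (ball 0 1))
    (hb : BijOn Φ (ball 0 1) (ball 0 1)) (hH : ∀ z ∈ ball (0:ℂ) 1, H (Φ z) = z) :
    DifferentiableOn ℂ H (ball 0 1) := by
  have hΦH : ∀ w ∈ ball (0:ℂ) 1, Φ (H w) = w := by
    intro w hw
    obtain ⟨z, hz, rfl⟩ := hb.surjOn hw
    rw [hH z hz]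
  have hct : ∀ w ∈ ball (0:ℂ) 1, ContinuousAt H w := by
    intro w hw
    obtain ⟨p, hp, rfl⟩ := hb.surjOn hw
    have hA : AnalyticAt ℂ Φ p := hd.analyticAt (isOpen_ball.mem_nhds hp)
    rcases hA.eventually_constant_or_nhds_le_map_nhds with h | h
    · exact (not_ev_const hb hp h).elim
    · rw [ContinuousAt, hH p hp]
      refine (Filter.map_mono h).trans ?_
      rw [Filter.map_map]
      refine (tendsto_id (x := 𝓝 p)).congr' ?_
      filter_upwards [isOpen_ball.mem_nhds hp] with z hz using (hH z hz).symm
  intro w hw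
  refine (AnalyticAt.differentiableAt (analyticAt_of_differentiable_on_punctured_nhds_of_continuousAt ?_
    (hct w hw))).differentiableWithinAt
  obtain ⟨p, hp, rfl⟩ := hb.surjOn hw
  have hA : AnalyticAt ℂ Φ p := hd.analyticAt (isOpen_ball.mem_nhds hp)
  have hT : Tendsto H (𝓝[≠] (Φ p)) (𝓝[≠] p) := by
    refine tendsto_nhdsWithin_iff.2 ⟨?_, ?_⟩
    · have := (hct _ hw).tendsto
      rw [hH p hp] at this
      exact this.mono_left nhdsWithin_le_nhds
    · filter_upwards [self_mem_nhdsWithin, nhdsWithin_le_nhds (isOpen_ball.mem_nhds hw)] with y hy hy2 h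
      have h : H y = p := h
      exact hy (by rw [← hΦH y hy2, h]; rfl)
  have hne : ∀ᶠ z in 𝓝[≠] p, deriv Φ z ≠ 0 := by
    rcases hA.deriv.eventually_eq_zero_or_eventually_ne_zero with h | h
    · exfalso
      obtain ⟨r, hr, hr2⟩ := Metric.eventually_nhds_iff_ball.1 (h.and (isOpen_ball.mem_nhds hp))
      refine not_ev_const hb hp ?_
      filter_upwards [ball_mem_nhds p hr] with z hz
      refine isOpen_ball.is_const_of_deriv_eq_zero (convex_ball p r).isPreconnected
        (hd.mono fun y hy => (hr2 y hy).2) (fun y hy => (hr2 y hy).1) hz (mem_ball_self hr)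
    · exact h
  filter_upwards [hT.eventually hne, nhdsWithin_le_nhds (isOpen_ball.mem_nhds hw)] with y hy hy2
  have hHy : H y ∈ ball (0:ℂ) 1 := by
    obtain ⟨z, hz, rfl⟩ := hb.surjOn hy2
    rwa [hH z hz]
  refine (HasDerivAt.of_local_left_inverse (hct y hy2)
    (hd.differentiableAt (isOpen_ball.mem_nhds hHy)).hasDerivAt hy ?_).differentiableAt
  filter_upwards [isOpen_ball.mem_nhds hy2] with u hu using hΦH u hu

theorem dmob_id (a z : ℂ) : ‖1 + conj a * z‖ ^ 2 - ‖z + a‖ ^ 2 = (1 - ‖a‖ ^ 2) * (1 - ‖z‖ ^ 2) := by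
  simp only [← Complex.normSq_eq_norm_sq, Complex.normSq_apply]
  simp
  ring

theorem dmob_ne {a z : ℂ} (ha : ‖a‖ < 1) (hz : ‖z‖ < 1) : 1 + conj a * z ≠ 0 := by
  intro h
  have h1 := dmob_id a z
  rw [h] at h1
  have : 0 < (1 - ‖a‖ ^ 2) * (1 - ‖z‖ ^ 2) := by
    apply mul_pos <;> nlinarith [norm_nonneg a, norm_nonneg z]
  simp only [norm_zero] at h1
  nlinarith [sq_nonneg ‖z + a‖]

theorem dmob_lt {a z : ℂ} (ha : ‖a‖ < 1) (hz : ‖z‖ < 1) : ‖(z + a) / (1 + conj a * z)‖ < 1 := by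
  have h1 := dmob_id a z
  have h3 := norm_pos_iff.2 (dmob_ne ha hz)
  have : 0 < (1 - ‖a‖ ^ 2) * (1 - ‖z‖ ^ 2) := by
    apply mul_pos <;> nlinarith [norm_nonneg a, norm_nonneg z]
  rw [norm_div, div_lt_one h3]
  exact lt_of_pow_lt_pow_left₀ 2 h3.le (by linarith)

theorem dmob_alg {a b z : ℂ} (h1 : 1 + b * z ≠ 0) (h2 : 1 - b * a ≠ 0) :
    ((z + a) / (1 + b * z) + -a) / (1 + -b * ((z + a) / (1 + b * z))) = z := by
  obtain ⟨t, ht⟩ : ∃ t, t = (z + a) / (1 + b * z) := ⟨_, rfl⟩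
  have e : t * (1 + b * z) = z + a := by rw [ht, div_mul_cancel₀ _ h1]
  rw [← ht]
  have h3 : 1 + -b * t ≠ 0 := by
    intro h
    apply h2
    linear_combination (1 + b * z) * h + b * e
  rw [div_eq_iff h3]
  linear_combination e

/-- Every holomorphic bijection of the disc is a Moebius map. -/
theorem disc_aut {Φ H : ℂ → ℂ} (hd : DifferentiableOn ℂ Φ (ball 0 1))
    (hb : BijOn Φ (ball 0 1) (ball 0 1)) (hH : ∀ z ∈ ball (0:ℂ) 1, H (Φ z) = z) :
    ∃ a c : ℂ, ‖a‖ < 1 ∧ ∀ w ∈ ball (0:ℂ) 1, Φ w * (1 - conj a * w) = c * (w - a) := by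
  have hHd := inv_holo hd hb hH
  have hΦH : ∀ w ∈ ball (0:ℂ) 1, Φ (H w) = w := by
    intro w hw
    obtain ⟨z, hz, rfl⟩ := hb.surjOn hw
    rw [hH z hz]
  have hHb : ∀ w ∈ ball (0:ℂ) 1, H w ∈ ball (0:ℂ) 1 := by
    intro w hw
    obtain ⟨z, hz, rfl⟩ := hb.surjOn hw
    rwa [hH z hz]
  set a := H 0 with ha
  have ha1 : ‖a‖ < 1 := by simpa using hHb 0 (by simp)
  have ha1' : ‖-a‖ < 1 := by rwa [norm_neg]
  have hmd : ∀ b : ℂ, ‖b‖ < 1 → DifferentiableOn ℂ (fun z => (z + b) / (1 + conj b * z)) (ball 0 1) := by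
    intro b hb z hz
    refine DifferentiableAt.differentiableWithinAt ?_
    refine DifferentiableAt.div (by fun_prop) (by fun_prop) (dmob_ne hb (by simpa using hz))
  have hmm : ∀ b : ℂ, ‖b‖ < 1 → MapsTo (fun z => (z + b) / (1 + conj b * z)) (ball 0 1) (ball 0 1) := by
    intro b hb z hz
    simpa only [mem_ball_zero_iff] using dmob_lt hb (by simpa using hz)
  have hinv : ∀ z ∈ ball (0:ℂ) 1, ((z + a) / (1 + conj a * z) + -a) / (1 + conj (-a) * ((z + a) / (1 + conj a * z))) = z := by
    intro z hz
    have h1 := dmob_ne ha1 (mem_ball_zero_iff.1 hz)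
    have h2 : (1 : ℂ) - conj a * a ≠ 0 := by
      have := dmob_ne ha1 ha1'
      intro h; apply this; linear_combination h
    rw [map_neg]
    exact dmob_alg h1 h2
  have hinv' : ∀ w ∈ ball (0:ℂ) 1, ((w + -a) / (1 + conj (-a) * w) + a) / (1 + conj a * ((w + -a) / (1 + conj (-a) * w))) = w := by
    intro w hw
    have h1 := dmob_ne ha1' (mem_ball_zero_iff.1 hw)
    have h2 : (1 : ℂ) - conj a * a ≠ 0 := by
      have := dmob_ne ha1 ha1'
      intro h; apply this; linear_combination h
    rw [map_neg] at *
    have := dmob_alg (a := -a) (b := -conj a) (z := w) h1 (by rwa [neg_mul_neg])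
    rwa [neg_neg, neg_neg] at this
  set m := fun z : ℂ => (z + a) / (1 + conj a * z) with hm
  set l := fun z : ℂ => (z + -a) / (1 + conj (-a) * z) with hl
  have h1d : DifferentiableOn ℂ (Φ ∘ m) (ball 0 1) := hd.comp (hmd a ha1) (hmm a ha1)
  have h1m : MapsTo (Φ ∘ m) (ball 0 1) (ball 0 1) := hb.mapsTo.comp (hmm a ha1)
  have h2d : DifferentiableOn ℂ (l ∘ H) (ball 0 1) := (hmd (-a) ha1').comp hHd hHb
  have h2m : MapsTo (l ∘ H) (ball 0 1) (ball 0 1) := (hmm (-a) ha1').comp hHb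
  have h10 : (Φ ∘ m) 0 = 0 := by
    simp only [Function.comp, hm]; simpa using hΦH 0 (by simp)
  have h20 : (l ∘ H) 0 = 0 := by
    simp [Function.comp, hl, ← ha]
  have hnorm : ‖(Φ ∘ m) (1/2)‖ = ‖(1/2 : ℂ)‖ := by
    have hh : (1/2 : ℂ) ∈ ball (0:ℂ) 1 := by simp; norm_num
    have e1 := Complex.norm_le_norm_of_mapsTo_ball h1d (h1m.mono_right ball_subset_closedBall) h10 (by simpa using hh : ‖(1/2:ℂ)‖ < 1)
    have e2 := Complex.norm_le_norm_of_mapsTo_ball h2d (h2m.mono_right ball_subset_closedBall) h20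
      (by simpa using h1m hh : ‖(Φ ∘ m) (1/2)‖ < 1)
    have e3 : (l ∘ H) ((Φ ∘ m) (1/2)) = 1/2 := by
      simp only [Function.comp]
      rw [hH _ (hmm a ha1 hh)]
      exact hinv _ hh
    rw [e3] at e2
    exact le_antisymm e1 e2
  obtain ⟨c, -, hc⟩ := Complex.affine_of_mapsTo_ball_of_exists_norm_dslope_eq_div' (R₂ := 1) h1d
    (by rw [h10]; exact h1m.mono_right ball_subset_closedBall) ⟨1/2, by simp; norm_num, by
      rw [dslope_of_ne _ (by norm_num), slope_def_field, h10, norm_div, sub_zero, sub_zero, hnorm]; norm_num⟩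
  refine ⟨a, c, ha1, fun w hw => ?_⟩
  have e := hc (hmm (-a) ha1' hw)
  simp only [Function.comp, h10] at e
  have e4 : m (l w) = w := hinv' w hw
  have h1 := dmob_ne ha1' (mem_ball_zero_iff.1 hw)
  change Φ (m (l w)) = Φ (m 0) + (l w - 0) • c at e
  rw [e4, show Φ (m 0) = 0 from h10] at e
  rw [e, hl]
  simp only [sub_zero, zero_add, smul_eq_mul]
  rw [map_neg] at h1 ⊢
  have e5 : (w + -a) / (1 + -conj a * w) * (1 + -conj a * w) = w + -a := div_mul_cancel₀ _ h1
  linear_combination c * e5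

theorem disc_rigid {Φ : ℂ → ℂ} (hd : DifferentiableOn ℂ Φ (ball 0 1)) (hc : ContinuousOn Φ (closedBall 0 1))
    (hb : BijOn Φ (ball 0 1) (ball 0 1)) (h1 : Φ 1 = 1) (h2 : Φ (-1) = -1) (h3 : Φ I = I) :
    ∀ z ∈ ball (0:ℂ) 1, Φ z = z := by
  obtain ⟨a, c, ha, h⟩ := disc_aut (H := Function.invFunOn Φ (ball 0 1)) hd hb
    (fun z hz => hb.injOn.leftInvOn_invFunOn hz)
  have hE : EqOn (fun w => Φ w * (1 - conj a * w)) (fun w => c * (w - a)) (closedBall 0 1) := by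
    have hcl : closure (ball (0:ℂ) 1) = closedBall 0 1 := closure_ball _ one_ne_zero
    rw [← hcl]
    refine EqOn.of_subset_closure (s := ball 0 1) (t := closure (ball 0 1)) h ?_ ?_ subset_closure subset_rfl
    · rw [hcl]; exact hc.mul (by fun_prop)
    · fun_prop
  have e1 := hE (x := 1) (by simp)
  have e2 := hE (x := -1) (by simp)
  have e3 := hE (x := I) (by simp)
  simp only [h1, h2, h3] at e1 e2 e3
  have hc1 : c = 1 := by linear_combination (e2 - e1) / 2
  subst hc1
  have ha2 : conj a = a := by linear_combination -e1
  rw [ha2] at e3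
  have ha0 : a = 0 := by
    have : a * 2 = 0 := by linear_combination e3 + a * I_mul_I
    simpa using this
  intro z hz
  simpa [ha0] using h z hz
end

end

section
open Complex MeasureTheory Metric Set Filter
open scoped Topology
noncomputable section

theorem Appr.unique {k : ℝ} {U : Ultrafilter ℕ} {μ ν : ℂ → ℂ} {m f g : ℕ → ℂ → ℂ} {F G : ℂ → ℂ}
    (A : Appr k U ν m f g F G) (hU : (U : Filter ℕ) ≤ atTop) (hν : Measurable ν) (bν : ∀ z, ‖ν z‖ ≤ k)
    (hk0 : 0 ≤ k) (hk : k < 1) (he : ∀ᵐ z ∂(volume.restrict (ball (0:ℂ) 1)), μ z = ν z)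
    {O : ℂ → ℂ} (hO : IsNormalizedBeltramiSolution μ O) : ∀ z ∈ ball (0:ℂ) 1, O z = F z := by
  obtain ⟨hc, hbc, hb, h1, h2, h3, p, q, hd, hq⟩ := hO
  have hcl : closure unitDisc = closedBall (0:ℂ) 1 := closure_ball _ one_ne_zero
  rw [hcl] at hc hbc
  unfold unitDisc at hb hd hq
  have hq' : ∀ᵐ z ∂(volume.restrict (ball (0:ℂ) 1)), q z = ν z * p z := by
    filter_upwards [hq, he] with z e1 e2
    rw [e1, e2]
  have hlt : ∀ᵐ z ∂(volume.restrict (ball (0:ℂ) 1)), ‖q z‖ ≤ k * ‖p z‖ := by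
    filter_upwards [hq'] with z e1
    rw [e1, norm_mul]
    exact mul_le_mul_of_nonneg_right (bν z) (norm_nonneg _)
  have hp := sol_L2 (μ := μ) hk0 hk (hc.mono ball_subset_closedBall) hb hd hlt
  have hG : MapsTo G (closedBall 0 1) (closedBall 0 1) := fun z hz => by
    simpa using A.bg z (by simpa using hz)
  have hGb : BijOn G (ball 0 1) (ball 0 1) := by
    refine ⟨fun z hz => by simpa using A.bg' z (by simpa using hz), fun z hz w hw e => ?_, fun z hz => ?_⟩
    · rw [← A.fg z (by simpa using (ball_subset_closedBall hz)), e, A.fg w (by simpa using (ball_subset_closedBall hw))]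
    · exact ⟨F z, by simpa using A.bf' z (by simpa using hz), A.gf z (by simpa using (ball_subset_closedBall hz))⟩
  have hcΦ : ContinuousOn (O ∘ G) (closedBall 0 1) := hc.comp A.cg hG
  have hG1 : G 1 = 1 := by
    have := A.gf 1 (by simp)
    rwa [A.f1] at this
  have hG2 : G (-1) = -1 := by
    have := A.gf (-1) (by simp)
    rwa [A.fm] at this
  have hG3 : G I = I := by
    have := A.gf I (by simp)
    rwa [A.fI] at this
  have hΦ := disc_rigid (Φ := O ∘ G) (weyl_holo hcΦ fun ψ hψ hs =>
    A.weyl hU hν bν hk0 hk hd hc (fun z hz => by simpa using hbc.mapsTo (show z ∈ closedBall (0:ℂ) 1 by simpa using hz))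
      hq' hp hψ hs) hcΦ (hb.comp hGb) (by simp [hG1, h1]) (by simp [hG2, h2]) (by simp [hG3, h3])
  intro z hz
  have := hΦ (F z) (by simpa using A.bf' z (by simpa using hz))
  rwa [Function.comp, A.gf z (by simpa using (ball_subset_closedBall hz))] at this

theorem Appr.bij {k : ℝ} {U : Ultrafilter ℕ} {ν : ℂ → ℂ} {m f g : ℕ → ℂ → ℂ} {F G : ℂ → ℂ}
    (A : Appr k U ν m f g F G) : BijOn F (closedBall 0 1) (closedBall 0 1) ∧ BijOn F (ball 0 1) (ball 0 1) := by
  refine ⟨⟨fun z hz => by simpa using A.bf z (by simpa using hz), fun z hz w hw e => ?_, fun z hz => ?_⟩,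
    ⟨fun z hz => by simpa using A.bf' z (by simpa using hz), fun z hz w hw e => ?_, fun z hz => ?_⟩⟩
  · rw [← A.gf z (by simpa using hz), e, A.gf w (by simpa using hw)]
  · exact ⟨G z, by simpa using A.bg z (by simpa using hz), A.fg z (by simpa using hz)⟩
  · rw [← A.gf z (by simpa using (ball_subset_closedBall hz)), e, A.gf w (by simpa using (ball_subset_closedBall hw))]
  · exact ⟨G z, by simpa using A.bg' z (by simpa using hz), A.fg z (by simpa using (ball_subset_closedBall hz))⟩

theorem trunc_coef (μ : ℂ → ℂ) {k : ℝ} (hμ : Measurable μ) (hk0 : 0 ≤ k)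
    (h : ∀ᵐ z ∂(volume.restrict (ball (0:ℂ) 1)), ‖μ z‖ ≤ k) :
    ∃ ν : ℂ → ℂ, Measurable ν ∧ (∀ z, ‖ν z‖ ≤ k) ∧ ∀ᵐ z ∂(volume.restrict (ball (0:ℂ) 1)), μ z = ν z := by
  refine ⟨indicator {z | ‖μ z‖ ≤ k} μ, hμ.indicator (measurableSet_le hμ.norm measurable_const), fun z => ?_, ?_⟩
  · by_cases hz : z ∈ {z | ‖μ z‖ ≤ k}
    · rw [indicator_of_mem hz]; exact hz
    · rw [indicator_of_notMem hz]; simpa using hk0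
  · filter_upwards [h] with z hz
    rw [indicator_of_mem]
    exact hz
end

end

/-- **Ahlfors–Bers theorem** (measurable Riemann mapping theorem for the disc).
Let `μ` be measurable on the unit disc with `‖μ‖_∞ ≤ k < 1`.  Then there is a homeomorphism
`ω` of `𝔻` onto `𝔻`, extending to a homeomorphism of the closed disc fixing `1, −1, i`,
possessing locally integrable distributional derivatives `∂_z ω = g`, `∂_z̄ ω = h`
satisfying the Beltrami equation `h = μ g` a.e. on `𝔻` (so that `‖h‖ ≤ k ‖g‖` a.e., i.e.
`ω` is `k`-quasiconformal); moreover any two such solutions coincide on `𝔻`. -/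
theorem ahlfors_bers (μ : ℂ → ℂ) (k : ℝ) (hμmeas : Measurable μ)
    (hk0 : 0 ≤ k) (hk1 : k < 1)
    (hμ : ∀ᵐ z ∂(volume.restrict unitDisc), ‖μ z‖ ≤ k) :
    (∃ ω : ℂ → ℂ, IsNormalizedBeltramiSolution μ ω ∧
      ∃ g h : ℂ → ℂ, HasDistribWirtingerDerivs unitDisc ω g h ∧
        (∀ᵐ z ∂(volume.restrict unitDisc), h z = μ z * g z) ∧
        (∀ᵐ z ∂(volume.restrict unitDisc), ‖h z‖ ≤ k * ‖g z‖)) ∧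
    ∀ ω₁ ω₂ : ℂ → ℂ, IsNormalizedBeltramiSolution μ ω₁ → IsNormalizedBeltramiSolution μ ω₂ →
      Set.EqOn ω₁ ω₂ unitDisc := by
  obtain ⟨ν, hν, bν, he⟩ := trunc_coef μ hμmeas hk0 hμ
  obtain ⟨U, m, f, g, F, G, hU, A⟩ := exists_appr hν bν hk0 hk1
  have hcl : closure unitDisc = closedBall (0:ℂ) 1 := closure_ball _ one_ne_zero
  refine ⟨?_, fun ω₁ ω₂ h₁ h₂ z hz => ?_⟩
  · obtain ⟨p, -, hd⟩ := A.weak hU hν bν hk0 hk1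
    have e1 : ∀ᵐ z ∂(volume.restrict unitDisc), ν z * p z = μ z * p z := by
      filter_upwards [he] with z hz
      rw [hz]
    refine ⟨F, ⟨?_, ?_, A.bij.2, A.f1, A.fm, A.fI, p, _, hd, e1⟩, p, _, hd, e1, ?_⟩
    · rw [hcl]; exact A.cf
    · rw [hcl]; exact A.bij.1
    · refine Filter.Eventually.of_forall fun z => ?_
      rw [norm_mul]
      exact mul_le_mul_of_nonneg_right (bν z) (norm_nonneg _)
  · rw [A.unique hU hν bν hk0 hk1 he h₁ z hz, A.unique hU hν bν hk0 hk1 he h₂ z hz]
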